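/- Let √3/2 ≤ t < 1, let F be a C^∞-smooth complex-valued function on an open neighbourhood U of 0 in ℂ whose partial derivatives of all orders ≤ 3 vanish at 0 (so F(z) = o(|z|³) as z → 0), and let M_t = {(z, p_t(z,z̄) + F(z)) : z ∈ U} with p_t(z,z̄) = z²z̄ + t z z̄² + (t²/3) z̄³. Then for every δ > 0 the polynomially convex hull of M_t ∩ B̄(0;δ) contains a one-parameter family of analytic discs with boundary in M_t and passing through the origin: there is a continuous map G : (0,1) × 𝔻̄ → ℂ² such that, for each s ∈ (0,1), φ_s := G(s,·) is a nonconstant analytic disc, φ_s(∂𝔻) ⊆ M_t ∩ B̄(0;δ), 0 ∈ φ_s(𝔻̄), φ_s(𝔻̄) is contained in the polynomially convex hull of M_t ∩ B̄(0;δ), and the images φ_s(𝔻̄) for distinct s are distinct. -/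

import Mathlib

open Complex ComplexConjugate

/-- The polynomially convex hull of a set `K ⊆ ℂ²`. -/
def polyHull2 (K : Set (ℂ × ℂ)) : Set (ℂ × ℂ) :=
  { z | ∀ p : MvPolynomial (Fin 2) ℂ,
      ‖MvPolynomial.eval (fun i => if i = 0 then z.1 else z.2) p‖ ≤
        sSup ((fun w : ℂ × ℂ =>
          ‖MvPolynomial.eval (fun i => if i = 0 then w.1 else w.2) p‖) '' K) }

/-- A set `K ⊆ ℂ²` is polynomially convex if it equals its polynomially convex hull. -/
def PolyConvex2 (K : Set (ℂ × ℂ)) : Prop := polyHull2 K = K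

/-- The closed Euclidean ball of radius `r` centred at the origin in `ℂ²`. -/
def eClosedBall (r : ℝ) : Set (ℂ × ℂ) := { z | ‖z.1‖ ^ 2 + ‖z.2‖ ^ 2 ≤ r ^ 2 }

/-- The open Euclidean ball of radius `r` centred at the origin in `ℂ²`. -/
def eOpenBall (r : ℝ) : Set (ℂ × ℂ) := { z | ‖z.1‖ ^ 2 + ‖z.2‖ ^ 2 < r ^ 2 }

/-- The surface `M_t = {(z, z²z̄ + t z z̄² + (t²/3) z̄³ + F(z)) : z ∈ U}`. -/
def Mset (t : ℝ) (U : Set ℂ) (F : ℂ → ℂ) : Set (ℂ × ℂ) :=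
  { zw | ∃ z ∈ U, zw = (z, z ^ 2 * conj z + (t : ℂ) * z * (conj z) ^ 2
      + ((t : ℂ) ^ 2 / 3) * (conj z) ^ 3 + F z) }

lemma A_lower (r θ : ℝ) (h0 : 0 ≤ r) (h1 : r < 1) (hθ : |θ| ≤ Real.pi) :
    ((1 - r) + |θ|) / 8 ≤ ‖circleMap 0 1 θ - (r:ℂ)‖ := by
  have hc : ‖circleMap 0 1 θ‖ = 1 := by simp
  have e1 : 1 - r ≤ ‖circleMap 0 1 θ - (r:ℂ)‖ := by
    have := norm_sub_norm_le (circleMap 0 1 θ) (r:ℂ)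
    rw [hc, Complex.norm_of_nonneg h0] at this
    exact this
  have e2 : ‖circleMap 0 1 θ - 1‖ ≤ 2 * ‖circleMap 0 1 θ - (r:ℂ)‖ := by
    have : circleMap 0 1 θ - 1 = (circleMap 0 1 θ - (r:ℂ)) + (((r - 1 : ℝ)) : ℂ) := by
      push_cast; ring
    rw [this]
    refine (norm_add_le _ _).trans ?_
    have : ‖(((r - 1 : ℝ)) : ℂ)‖ = 1 - r := by
      rw [Complex.norm_real, Real.norm_eq_abs, abs_of_neg (by linarith)]; ring
    rw [this]; linarith
  have e3 : 2 / Real.pi * |θ| ≤ ‖circleMap 0 1 θ - 1‖ := by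
    have : ‖circleMap 0 1 θ - 1‖ = ‖2 * Real.sin (θ / 2)‖ := by
      have := Complex.norm_exp_I_mul_ofReal_sub_one θ
      rw [← this]; simp [circleMap, mul_comm]
    rw [this, norm_mul, Real.norm_eq_abs, Real.norm_eq_abs]
    have h2 := Real.mul_abs_le_abs_sin (x := θ/2) (by rw [abs_div, abs_two]; linarith)
    rw [abs_div, abs_two] at h2
    rw [abs_two]; linarith
  have hp : 2 / Real.pi * |θ| ≥ |θ| / 2 := by
    have : (1:ℝ)/2 ≤ 2 / Real.pi := by
      rw [div_le_div_iff₀ (by norm_num) Real.pi_pos]; linarith [Real.pi_le_four]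
    nlinarith [abs_nonneg θ]
  linarith

lemma A_int0 (a h : ℝ) (ha : 0 < a) (hh : 0 < h) :
    ∫ θ in (-Real.pi)..Real.pi, (h + |θ|) ^ (-1 - a) ≤ 2 / a * h ^ (-a) := by
  have hcont : Continuous fun θ : ℝ => (h + |θ|) ^ (-1 - a) := by
    apply Continuous.rpow_const (by fun_prop)
    intro x; left; positivity
  have key : ∫ θ in (0:ℝ)..Real.pi, (h + |θ|) ^ (-1 - a) ≤ 1 / a * h ^ (-a) := by
    have e : ∫ θ in (0:ℝ)..Real.pi, (h + |θ|) ^ (-1 - a) = ∫ θ in (0:ℝ)..Real.pi, (h + θ) ^ (-1 - a) := by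
      apply intervalIntegral.integral_congr
      intro x hx
      rw [Set.uIcc_of_le Real.pi_pos.le] at hx
      simp only [abs_of_nonneg hx.1]
    rw [e, intervalIntegral.integral_comp_add_left (fun x => x ^ (-1 - a)), integral_rpow]
    · have h1 : -1 - a + 1 = -a := by ring
      rw [h1, add_zero]
      have : 0 ≤ (h + Real.pi) ^ (-a) := by have := Real.pi_pos; positivity
      rw [div_neg, ← neg_div, one_div_mul_eq_div]
      gcongr; linarith
    · right; refine ⟨by linarith, ?_⟩
      rw [Set.uIcc_of_le (by linarith [Real.pi_pos])]
      intro hx; linarith [hx.1]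
  have e2 : ∫ θ in (-Real.pi)..0, (h + |θ|) ^ (-1 - a) = ∫ θ in (0:ℝ)..Real.pi, (h + |θ|) ^ (-1 - a) := by
    have := intervalIntegral.integral_comp_neg (a := 0) (b := Real.pi) (fun θ : ℝ => (h + |θ|) ^ (-1 - a))
    simp only [abs_neg, neg_zero] at this
    exact this.symm
  rw [← intervalIntegral.integral_add_adjacent_intervals (b := 0) (hcont.intervalIntegrable _ _)
    (hcont.intervalIntegrable _ _), e2]
  have : 2 / a * h ^ (-a) = 1 / a * h ^ (-a) + 1 / a * h ^ (-a) := by ring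
  linarith

lemma A_cm_sub (θ φ : ℝ) (r : ℝ) : ‖circleMap 0 1 θ - circleMap 0 r φ‖ = ‖circleMap 0 1 (θ - φ) - (r:ℂ)‖ := by
  have : circleMap 0 1 θ - circleMap 0 r φ = circleMap 0 1 φ * (circleMap 0 1 (θ - φ) - (r:ℂ)) := by
    simp only [circleMap, zero_add, ofReal_one, one_mul, mul_sub, ← Complex.exp_add]
    congr 1
    · congr 1; push_cast; ring
    · ring
  rw [this, norm_mul]; simp

lemma A_ne (z : ℂ) (hz : ‖z‖ < 1) (θ : ℝ) : 0 < ‖circleMap 0 1 θ - z‖ := by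
  have := norm_sub_norm_le (circleMap 0 1 θ) z
  have hc : ‖circleMap 0 1 θ‖ = 1 := by simp
  linarith

lemma A_cont (z : ℂ) (hz : ‖z‖ < 1) (b : ℝ) : Continuous fun θ : ℝ => ‖circleMap 0 1 θ - z‖ ^ b := by
  apply Continuous.rpow_const
  · exact ((continuous_circleMap 0 1).sub continuous_const).norm
  · intro x; left; exact (A_ne z hz x).ne'

/-- the single integral lemma -/
lemma A_int (a : ℝ) (ha : 0 < a) : ∃ C : ℝ, 0 < C ∧ ∀ z : ℂ, ‖z‖ < 1 →
    ∫ θ in (-Real.pi)..Real.pi, ‖circleMap 0 1 θ - z‖ ^ (-1 - a) ≤ C * (1 - ‖z‖) ^ (-a) := by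
  refine ⟨8 ^ (1 + a) * (2 / a), by positivity, fun z hz => ?_⟩
  set r := ‖z‖
  have hzr : z = circleMap 0 r (arg z) := by
    simp [circleMap, r, Complex.norm_mul_exp_arg_mul_I]
  have hr0 : 0 ≤ r := norm_nonneg _
  have hr : ‖(r:ℂ)‖ < 1 := by rw [Complex.norm_of_nonneg hr0]; exact hz
  have e1 : ∫ θ in (-Real.pi)..Real.pi, ‖circleMap 0 1 θ - z‖ ^ (-1 - a)
      = ∫ θ in (-Real.pi)..Real.pi, ‖circleMap 0 1 θ - (r:ℂ)‖ ^ (-1 - a) := by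
    have hper : Function.Periodic (fun θ : ℝ => ‖circleMap 0 1 θ - (r:ℂ)‖ ^ (-1 - a)) (2 * Real.pi) := by
      intro x; simp only [periodic_circleMap 0 1 x]
    have h1 : ∀ θ, ‖circleMap 0 1 θ - z‖ ^ (-1 - a)
        = (fun θ : ℝ => ‖circleMap 0 1 θ - (r:ℂ)‖ ^ (-1 - a)) (θ - arg z) := by
      intro θ; simp only; rw [← A_cm_sub, ← hzr]
    simp_rw [h1]
    rw [intervalIntegral.integral_comp_sub_right (fun θ : ℝ => ‖circleMap 0 1 θ - (r:ℂ)‖ ^ (-1 - a))]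
    have := hper.intervalIntegral_add_eq (-Real.pi - arg z) (-Real.pi)
    rw [show -Real.pi - arg z + 2 * Real.pi = Real.pi - arg z by ring,
      show -Real.pi + 2 * Real.pi = Real.pi by ring] at this
    exact this
  rw [e1]
  calc _ ≤ ∫ θ in (-Real.pi)..Real.pi, 8 ^ (1 + a) * ((1 - r) + |θ|) ^ (-1 - a) := by
        apply intervalIntegral.integral_mono_on (by linarith [Real.pi_pos])
        · exact (A_cont _ hr _).intervalIntegrable _ _
        · apply Continuous.intervalIntegrable
          apply Continuous.mul continuous_const
          apply Continuous.rpow_const (by fun_prop)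
          intro x; left; have := abs_nonneg x; linarith
        · intro θ hθ
          have hl := A_lower r θ hr0 hz (abs_le.2 hθ)
          have hpos : 0 < (1 - r) + |θ| := by have := abs_nonneg θ; linarith
          calc ‖circleMap 0 1 θ - (r:ℂ)‖ ^ (-1 - a) ≤ (((1 - r) + |θ|) / 8) ^ (-1 - a) := by
                apply Real.rpow_le_rpow_of_nonpos (by positivity) hl (by linarith)
            _ = _ := by
                rw [Real.div_rpow hpos.le (by norm_num), div_eq_mul_inv, ← Real.rpow_neg (by norm_num)]
                rw [mul_comm]; congr 2; ring
    _ = 8 ^ (1 + a) * ∫ θ in (-Real.pi)..Real.pi, ((1 - r) + |θ|) ^ (-1 - a) := by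
        rw [intervalIntegral.integral_const_mul]
    _ ≤ _ := by
        rw [mul_assoc]
        gcongr
        exact A_int0 a (1 - r) ha (by linarith)

/-- distance to the corner -/
noncomputable def dd (z : ℂ) : ℝ := ‖1 + z‖

/-- punctured circle -/
def Sc : Set ℂ := {z | ‖z‖ = 1 ∧ z ≠ -1}
/-- punctured closed disc -/
def Pd : Set ℂ := {z | ‖z‖ ≤ 1 ∧ z ≠ -1}

/-- weighted Hoelder class -/
structure Cl (g : ℝ) (A : Set ℂ) (p M : ℝ) (u : ℂ → ℂ) : Prop where
  sup : ∀ z ∈ A, ‖u z‖ ≤ M * dd z ^ p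
  hol : ∀ z ∈ A, ∀ w ∈ A, ‖z - w‖ ≤ dd z / 4 → ‖u z - u w‖ ≤ M * dd z ^ (p - g) * ‖z - w‖ ^ g

lemma dd_pos {z : ℂ} (h : z ≠ -1) : 0 < dd z := by
  unfold dd; rw [norm_pos_iff]; intro h1; apply h; linear_combination h1

lemma Pd_pos {z : ℂ} (h : z ∈ Pd) : 0 < dd z := dd_pos h.2
lemma Sc_sub : Sc ⊆ Pd := fun _ h => ⟨h.1.le, h.2⟩
lemma dd_sub (z w : ℂ) : dd z ≤ dd w + ‖z - w‖ := by
  unfold dd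
  calc ‖1 + z‖ = ‖(1 + w) + (z - w)‖ := by congr 1; ring
    _ ≤ _ := norm_add_le _ _
lemma dd_le_two {z : ℂ} (h : ‖z‖ ≤ 1) : dd z ≤ 2 := by
  unfold dd; refine (norm_add_le _ _).trans ?_; rw [norm_one]; linarith
lemma dd_ge (z : ℂ) : 1 - ‖z‖ ≤ dd z := by
  unfold dd; have := norm_sub_norm_le (1:ℂ) (-z); simp at this; linarith
lemma ball_ne {z : ℂ} (h : ‖z‖ < 1) : z ≠ -1 := by rintro rfl; simp at h

/-- A function with real boundary values is constant. -/
lemma const_of_im_zero (g : ℂ → ℂ) (hc : ContinuousOn g (Metric.closedBall 0 1))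
    (hd : DifferentiableOn ℂ g (Metric.ball 0 1)) (him : ∀ z, ‖z‖ = 1 → (g z).im = 0) :
    ∀ z, ‖z‖ ≤ 1 → g z = g 0 := by
  have hcl : closure (Metric.ball (0:ℂ) 1) = Metric.closedBall 0 1 := closure_ball _ one_ne_zero
  have main : ∀ c : ℂ, (c = I ∨ c = -I) → ∀ z, ‖z‖ ≤ 1 → ‖cexp (c * g z)‖ ≤ 1 := by
    intro c hcI z hz
    have hdc : DiffContOnCl ℂ (fun z => cexp (c * g z)) (Metric.ball 0 1) := by
      refine ⟨(hd.const_mul c).cexp, ?_⟩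
      rw [hcl]; exact (continuousOn_const.mul hc).cexp
    refine Complex.norm_le_of_forall_mem_frontier_norm_le Metric.isBounded_ball hdc ?_ ?_
    · intro w hw
      rw [frontier_ball _ one_ne_zero] at hw
      have : (g w).im = 0 := him w (by simpa using hw)
      rw [Complex.norm_exp]
      rcases hcI with rfl | rfl <;> simp [this]
    · rw [hcl]; simpa using hz
  have him0 : ∀ z, ‖z‖ ≤ 1 → (g z).im = 0 := by
    intro z hz
    have h1 := main I (Or.inl rfl) z hz
    have h2 := main (-I) (Or.inr rfl) z hz
    rw [Complex.norm_exp, Real.exp_le_one_iff] at h1 h2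
    simp at h1 h2
    linarith
  have hball : ∀ z ∈ Metric.ball (0:ℂ) 1, g z = g 0 := by
    intro z hz
    have hd0 : ∀ x ∈ Metric.ball (0:ℂ) 1, fderivWithin ℂ g (Metric.ball 0 1) x = 0 := by
      intro x hx
      have hdx : HasDerivAt g (deriv g x) x := (hd.differentiableAt (Metric.isOpen_ball.mem_nhds hx)).hasDerivAt
      have hz0 : deriv g x = 0 := by
        have hre : ∀ v : ℂ, (deriv g x * v).im = 0 := by
          intro v
          have h1 : HasDerivAt (fun s : ℝ => g (x + s * v)) (deriv g x * v) 0 := by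
            have hl : HasDerivAt (fun s : ℝ => x + (s:ℂ) * v) v 0 := by
              have := ((hasDerivAt_id (0:ℝ)).ofReal_comp.mul_const v).const_add x
              simpa using this
            have hdx' : HasDerivAt g (deriv g x) (x + ((0:ℝ):ℂ) * v) := by simpa using hdx
            exact hdx'.comp (0:ℝ) hl
          have h2 : HasDerivAt (fun s : ℝ => (g (x + s * v)).im) (deriv g x * v).im 0 := by
            exact Complex.imCLM.hasFDerivAt.comp_hasDerivAt (0:ℝ) h1
          have h3 : (fun s : ℝ => (g (x + s * v)).im) =ᶠ[nhds 0] fun _ => 0 := by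
            have : Filter.Tendsto (fun s : ℝ => x + (s:ℂ) * v) (nhds 0) (nhds x) := by
              have : Continuous (fun s : ℝ => x + (s:ℂ) * v) := by fun_prop
              simpa using this.tendsto 0
            filter_upwards [this.eventually (Metric.isOpen_ball.mem_nhds hx)] with s hs
            apply him0; simpa using (Metric.mem_ball.1 hs).le
          exact h2.unique ((hasDerivAt_const (0:ℝ) (0:ℝ)).congr_of_eventuallyEq h3)
        apply Complex.ext
        · have := hre I; simpa using this
        · have := hre 1; simpa using this
      rw [fderivWithin_of_isOpen Metric.isOpen_ball hx]
      have := hdx.hasFDerivAt.fderiv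
      rw [this, hz0]; ext; simp
    exact (convex_ball (0:ℂ) 1).is_const_of_fderivWithin_eq_zero hd hd0 hz (by simp)
  intro z hz
  have hz' : z ∈ closure (Metric.ball (0:ℂ) 1) := by rw [hcl]; simpa using hz
  have : Set.EqOn g (fun _ => g 0) (closure (Metric.ball (0:ℂ) 1)) :=
    Set.EqOn.of_subset_closure (s := Metric.ball 0 1) (fun z hz => hball z hz)
      (by rw [hcl]; exact hc) continuousOn_const subset_closure subset_rfl
  exact this hz'

lemma path0 (g g' : ℝ → ℂ) (a b q A : ℝ) (ha : 0 < a) (hab : a ≤ b) (hq : 0 < q)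
    (hg : ∀ s ∈ Set.Icc a b, HasDerivAt g (g' s) s) (hb : ∀ s ∈ Set.Icc a b, ‖g' s‖ ≤ A * s ^ (q - 1)) :
    ‖g b - g a‖ ≤ A / q * (b ^ q - a ^ q) := by
  have hB : ∀ x ∈ Set.Ico a b, HasDerivWithinAt (fun s : ℝ => A / q * (s ^ q - a ^ q)) (A * x ^ (q - 1)) (Set.Ici x) x := by
    intro x hx
    have hx0 : x ≠ 0 := by linarith [hx.1]
    have := (((Real.hasDerivAt_rpow_const (x := x) (p := q) (Or.inl hx0)).sub_const (a ^ q)).const_mul (A / q)).hasDerivWithinAt (s := Set.Ici x)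
    have e : A * x ^ (q - 1) = A / q * (q * x ^ (q - 1)) := by
      have := hq.ne'
      field_simp
    rw [e]; exact this
  have := image_norm_le_of_norm_deriv_right_le_deriv_boundary' (f := fun s => g s - g a) (f' := g') (a := a) (b := b)
    (B := fun s => A / q * (s ^ q - a ^ q)) (B' := fun x => A * x ^ (q - 1))
    (fun x hx => ((hg x hx).continuousAt.sub continuousAt_const).continuousWithinAt)
    (fun x hx => ((hg x ⟨hx.1, hx.2.le⟩).sub_const _).hasDerivWithinAt) (by simp)
    (by
      apply ContinuousOn.mul continuousOn_const
      apply ContinuousOn.sub _ continuousOn_const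
      exact continuousOn_id.rpow_const (fun x hx => Or.inr hq.le)) hB
    (fun x hx => hb x ⟨hx.1, hx.2.le⟩)
  exact this ⟨hab, le_rfl⟩

/-- radial/segment version: f differentiable on the ball, path z0 + s v -/
lemma pathline (f : ℂ → ℂ) (hd : DifferentiableOn ℂ f (Metric.ball 0 1)) (z0 v : ℂ) (a b q A : ℝ) (ha : 0 < a) (hab : a ≤ b)
    (hq : 0 < q) (hin : ∀ s ∈ Set.Icc a b, ‖z0 + s * v‖ < 1)
    (hb : ∀ s ∈ Set.Icc a b, ‖deriv f (z0 + s * v)‖ * ‖v‖ ≤ A * s ^ (q - 1)) :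
    ‖f (z0 + b * v) - f (z0 + a * v)‖ ≤ A / q * (b ^ q - a ^ q) := by
  refine path0 (fun s : ℝ => f (z0 + s * v)) (fun s => deriv f (z0 + s * v) * v) a b q A ha hab hq ?_ ?_
  · intro s hs
    have hl : HasDerivAt (fun s : ℝ => z0 + (s:ℂ) * v) v s := by
      have := ((hasDerivAt_id s).ofReal_comp.mul_const v).const_add z0
      simpa using this
    have h1 : HasDerivAt f (deriv f (z0 + s * v)) (z0 + s * v) :=
      (hd.differentiableAt (Metric.isOpen_ball.mem_nhds (by simpa using hin s hs))).hasDerivAt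
    exact h1.comp s hl
  · intro s hs; rw [norm_mul]; exact hb s hs

lemma lim0 (G : ℝ → ℂ) (q A b0 : ℝ) (hb0 : 0 < b0) (hq : 0 < q) (hA : 0 ≤ A)
    (h : ∀ a b, 0 < a → a ≤ b → b ≤ b0 → ‖G b - G a‖ ≤ A * (b ^ q - a ^ q)) :
    ∃ l, Filter.Tendsto G (nhdsWithin 0 (Set.Ioi 0)) (nhds l) ∧ ∀ b, 0 < b → b ≤ b0 → ‖G b - l‖ ≤ A * b ^ q := by
  have hle : ∀ a b, 0 < a → a ≤ b → b ≤ b0 → ‖G b - G a‖ ≤ A * b ^ q := by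
    intro a b ha hab hb
    refine (h a b ha hab hb).trans ?_
    have : 0 ≤ a ^ q := by positivity
    gcongr; linarith
  have ht : Filter.Tendsto (fun b : ℝ => A * b ^ q) (nhdsWithin 0 (Set.Ioi 0)) (nhds 0) := by
    have : Filter.Tendsto (fun b : ℝ => A * b ^ q) (nhds 0) (nhds (A * 0 ^ q)) :=
      ((continuous_id.rpow_const (fun x => Or.inr hq.le)).tendsto 0).const_mul A
    rw [Real.zero_rpow hq.ne', mul_zero] at this
    exact this.mono_left nhdsWithin_le_nhds
  have hc : Cauchy (Filter.map G (nhdsWithin 0 (Set.Ioi 0))) := by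
    rw [Metric.cauchy_iff]
    refine ⟨inferInstance, fun ε hε => ?_⟩
    obtain ⟨b, hb1, hb2, hb3⟩ := ((ht.eventually (gt_mem_nhds (half_pos hε))).and
      (Ioo_mem_nhdsGT hb0)).exists
    refine ⟨G '' Set.Ioc 0 b, Filter.image_mem_map (Ioc_mem_nhdsGT hb2), ?_⟩
    rintro _ ⟨x, hx, rfl⟩ _ ⟨y, hy, rfl⟩
    rw [dist_eq_norm]
    have e1 := hle x b hx.1 hx.2 hb3.le
    have e2 := hle y b hy.1 hy.2 hb3.le
    calc ‖G x - G y‖ = ‖(G b - G y) - (G b - G x)‖ := by congr 1; ring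
      _ ≤ _ := norm_sub_le _ _
      _ < ε := by linarith
  obtain ⟨l, hl⟩ := cauchy_map_iff_exists_tendsto.1 hc
  refine ⟨l, hl, fun b hb hbb => ?_⟩
  refine le_of_tendsto ((tendsto_const_nhds.sub hl).norm) ?_
  filter_upwards [Ioc_mem_nhdsGT hb] with a ha
  exact hle a b ha.1 ha.2 hbb

lemma rp4 (d k e : ℝ) (hd : 0 < d) (hk : 0 < k) (hk4 : k ≤ 4) (hk1 : 1 ≤ k) (_he : e ≤ 0) (he1 : -1 ≤ e) :
    (d / k) ^ e ≤ 4 * d ^ e := by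
  rw [Real.div_rpow hd.le hk.le, div_eq_inv_mul, ← Real.rpow_neg hk.le]
  gcongr
  calc k ^ (-e) ≤ k ^ (1:ℝ) := Real.rpow_le_rpow_of_exponent_le hk1 (by linarith)
    _ ≤ 4 := by simpa using hk4

lemma HL (g p : ℝ) (hp : 0 < p) (hpg : p ≤ g) (hg : g < 1) : ∃ C : ℝ, 0 < C ∧ ∀ (M : ℝ) (f : ℂ → ℂ), 0 ≤ M →
    DifferentiableOn ℂ f (Metric.ball 0 1) →
    (∀ z, ‖z‖ < 1 → ‖deriv f z‖ ≤ M * dd z ^ (p - g) * (1 - ‖z‖) ^ (g - 1)) →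
    ∃ (L : ℂ) (F : ℂ → ℂ), (∀ z, ‖z‖ < 1 → F z = f z - L) ∧ Cl g Pd p (C * M) F ∧
      Filter.Tendsto (fun s : ℝ => f (-1 + s)) (nhdsWithin 0 (Set.Ioi 0)) (nhds L) ∧
      ∀ z ∈ Pd, Filter.Tendsto (fun s : ℝ => f (z + s * (-z)) - L) (nhdsWithin 0 (Set.Ioi 0)) (nhds (F z)) := by
  have hg0 : 0 < g := by linarith
  refine ⟨8 / g + 1 / p + 24, by positivity, fun M f hM hd hder => ?_⟩
  -- radial
  have hrad : ∀ z ∈ Pd, ∃ l, Filter.Tendsto (fun s : ℝ => f (z + s * (-z))) (nhdsWithin 0 (Set.Ioi 0)) (nhds l) ∧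
      ∀ b, 0 < b → b ≤ dd z / 2 → ‖f (z + b * (-z)) - l‖ ≤ M * (dd z / 2) ^ (p - g) / g * b ^ g := by
    intro z hz
    have hdz := Pd_pos hz
    have hd2 := dd_le_two hz.1
    refine lim0 (fun s : ℝ => f (z + s * (-z))) g _ (dd z / 2) (by positivity) hg0 (by positivity) ?_
    intro a b ha hab hb
    have hs1 : ∀ s ∈ Set.Icc a b, ‖z + s * (-z)‖ ≤ 1 - s := by
      intro s hs
      have : z + s * (-z) = ((1 - s : ℝ) : ℂ) * z := by push_cast; ring
      rw [this, norm_mul, Complex.norm_of_nonneg (by linarith [hs.2])]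
      have := hz.1
      have h1s : 0 ≤ 1 - s := by linarith [hs.2]
      nlinarith
    refine pathline f hd z (-z) a b g _ ha hab hg0 ?_ ?_
    · intro s hs; have := hs1 s hs; linarith [hs.1]
    · intro s hs
      have h1 := hs1 s hs
      have hs0 : 0 < s := by linarith [hs.1]
      have h2 := hder (z + s * (-z)) (by linarith)
      have h3 : dd z / 2 ≤ dd (z + s * (-z)) := by
        have := dd_sub z (z + s * (-z))
        have h4 : ‖z - (z + s * (-z))‖ ≤ s := by
          rw [show z - (z + s * (-z)) = (s:ℂ) * z by ring, norm_mul, Complex.norm_of_nonneg hs0.le]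
          nlinarith [hz.1]
        linarith [hs.2]
      have h5 : dd (z + s * (-z)) ^ (p - g) ≤ (dd z / 2) ^ (p - g) :=
        Real.rpow_le_rpow_of_nonpos (by positivity) h3 (by linarith)
      have h6 : (1 - ‖z + s * (-z)‖) ^ (g - 1) ≤ s ^ (g - 1) :=
        Real.rpow_le_rpow_of_nonpos hs0 (by linarith) (by linarith)
      calc _ ≤ (M * dd (z + s * (-z)) ^ (p - g) * (1 - ‖z + s * (-z)‖) ^ (g - 1)) * 1 := by
            have h7 : ‖-z‖ ≤ 1 := by rw [norm_neg]; exact hz.1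
            exact mul_le_mul h2 h7 (norm_nonneg _) ((norm_nonneg _).trans h2)
        _ ≤ _ := by rw [mul_one]; gcongr; apply Real.rpow_nonneg; linarith
  choose! F0 hF0 hF0b using hrad
  -- the real axis
  obtain ⟨L, hL, hLb⟩ := lim0 (fun s : ℝ => f (-1 + s)) p (M / p) 1 one_pos hp (by positivity) (by
    intro a b ha hab hb
    have hs1 : ∀ s ∈ Set.Icc a b, ‖(-1 : ℂ) + s * 1‖ = 1 - s := by
      intro s hs
      have : (-1 : ℂ) + s * 1 = -((1 - s : ℝ) : ℂ) := by push_cast; ring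
      rw [this, norm_neg, Complex.norm_of_nonneg (by linarith [hs.2])]
    have := pathline f hd (-1) 1 a b p M ha hab hp (fun s hs => by rw [hs1 s hs]; linarith [hs.1]) (by
      intro s hs
      have hs0 : 0 < s := by linarith [hs.1]
      have h2 := hder (-1 + s * 1) (by rw [hs1 s hs]; linarith)
      have h3 : dd (-1 + s * 1) = s := by
        unfold dd; rw [show 1 + (-1 + (s:ℂ) * 1) = s by ring, Complex.norm_of_nonneg hs0.le]
      rw [hs1 s hs, h3, sub_sub_cancel, mul_assoc, ← Real.rpow_add hs0] at h2
      rw [norm_one, mul_one]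
      convert h2 using 3
      ring)
    simpa using this)
  have seg : ∀ x y : ℂ, ∀ d e B : ℝ, 0 < e → 0 < d → ‖x‖ ≤ 1 - e → ‖y‖ ≤ 1 - e → ‖y - x‖ ≤ B →
      (∀ v ∈ segment ℝ x y, d ≤ dd v) → ‖f y - f x‖ ≤ M * d ^ (p - g) * e ^ (g - 1) * B := by
    intro x y d e B he hd0 hx hy hB hv
    have hseg : ∀ v ∈ segment ℝ x y, ‖v‖ ≤ 1 - e := by
      intro v hv
      have := (convex_closedBall (0:ℂ) (1 - e)).segment_subset (by simpa using hx) (by simpa using hy) hv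
      simpa using this
    have := (convex_segment (𝕜 := ℝ) x y).norm_image_sub_le_of_norm_deriv_le (f := f) (C := M * d ^ (p - g) * e ^ (g - 1))
      (fun v hv' => hd.differentiableAt (Metric.isOpen_ball.mem_nhds (by have := hseg v hv'; simp; linarith)))
      (by
        intro v hv'
        have h1 := hseg v hv'
        have h2 := hder v (by linarith)
        refine h2.trans ?_
        have h5 : dd v ^ (p - g) ≤ d ^ (p - g) :=
          Real.rpow_le_rpow_of_nonpos hd0 (hv v hv') (by linarith)
        have h6 : (1 - ‖v‖) ^ (g - 1) ≤ e ^ (g - 1) :=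
          Real.rpow_le_rpow_of_nonpos he (by linarith) (by linarith)
        gcongr
        apply Real.rpow_nonneg; linarith)
      (left_mem_segment ℝ x y) (right_mem_segment ℝ x y)
    refine this.trans ?_
    gcongr
  have hshr : ∀ z ∈ Pd, ∀ e : ℝ, 0 < e → e ≤ 1 → ‖z + e * (-z)‖ ≤ 1 - e ∧ ‖(z + e * (-z)) - z‖ ≤ e := by
    intro z hz e he he1
    constructor
    · have : z + e * (-z) = ((1 - e : ℝ) : ℂ) * z := by push_cast; ring
      rw [this, norm_mul, Complex.norm_of_nonneg (by linarith)]
      nlinarith [hz.1]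
    · rw [show (z + e * (-z)) - z = -((e:ℂ) * z) by ring, norm_neg, norm_mul, Complex.norm_of_nonneg he.le]
      nlinarith [hz.1]
  refine ⟨L, fun z => F0 z - L, ?_, ⟨?_, ?_⟩, hL, ?_⟩
  · intro z hz
    have hzP : z ∈ Pd := ⟨hz.le, ball_ne hz⟩
    have h1 := hF0 z hzP
    have h2 : Filter.Tendsto (fun s : ℝ => f (z + s * (-z))) (nhdsWithin 0 (Set.Ioi 0)) (nhds (f z)) := by
      have h3 : ContinuousAt f (z + ((0:ℝ):ℂ) * (-z)) := by
        have : z + ((0:ℝ):ℂ) * (-z) = z := by simp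
        rw [this]
        exact (hd.differentiableAt (Metric.isOpen_ball.mem_nhds (by simpa using hz))).continuousAt
      have h4 : ContinuousAt (fun s : ℝ => f (z + s * (-z))) 0 :=
        ContinuousAt.comp (f := fun s : ℝ => z + (s:ℂ) * (-z)) h3 (by fun_prop)
      have h5 := h4.tendsto
      simp only [ofReal_zero, zero_mul, add_zero] at h5
      exact h5.mono_left nhdsWithin_le_nhds
    change F0 z - L = _
    rw [tendsto_nhds_unique h1 h2]
  · -- sup
    intro z hz
    have hdz := Pd_pos hz
    have hd2 := dd_le_two hz.1
    set d := dd z with hdd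
    have he : 0 < d / 4 := by positivity
    obtain ⟨s1, s2⟩ := hshr z hz (d / 4) he (by linarith)
    have t1 := hF0b z hz (d / 4) he (by linarith)
    have t2 := hLb (d / 4) he (by linarith)
    have hq : ‖(-1 : ℂ) + ((d / 4 : ℝ) : ℂ)‖ = 1 - d / 4 := by
      have : (-1 : ℂ) + ((d/4:ℝ):ℂ) = -((1 - d/4 : ℝ) : ℂ) := by push_cast; ring
      rw [this, norm_neg, Complex.norm_of_nonneg (by linarith)]
    have t3 := seg (-1 + ((d / 4 : ℝ) : ℂ)) (z + ((d / 4 : ℝ) : ℂ) * (-z)) (d / 4) (d / 4) (3 / 2 * d) he he hq.le s1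
      (by
        have : (z + ((d / 4 : ℝ) : ℂ) * (-z)) - (-1 + ((d / 4 : ℝ) : ℂ))
          = ((z + ((d / 4 : ℝ) : ℂ) * (-z)) - z) + ((1 + z) - ((d / 4 : ℝ) : ℂ)) := by ring
        rw [this]
        refine (norm_add_le _ _).trans ?_
        have h1 := norm_sub_le (1 + z) ((d / 4 : ℝ) : ℂ)
        rw [Complex.norm_of_nonneg he.le] at h1
        have : ‖1 + z‖ = d := rfl
        linarith)
      (by
        intro v hv
        have := (convex_closedBall (0:ℂ) (1 - d / 4)).segment_subset (by simpa using hq.le) (by simpa using s1) hv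
        have h1 : ‖v‖ ≤ 1 - d / 4 := by simpa using this
        have := dd_ge v
        linarith)
    have hpg' : (d / 2) ^ (p - g) ≤ 4 * d ^ (p - g) := rp4 d 2 _ hdz (by norm_num) (by norm_num) (by norm_num) (by linarith) (by linarith)
    have c1 : M * (d / 2) ^ (p - g) / g * (d / 4) ^ g ≤ 4 / g * M * d ^ p := by
      calc _ ≤ M * (4 * d ^ (p - g)) / g * d ^ g := by gcongr; linarith
        _ = 4 / g * M * (d ^ (p - g) * d ^ g) := by ring
        _ = _ := by rw [← Real.rpow_add hdz]; congr 2; ring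
    have c2 : M / p * (d / 4) ^ p ≤ 1 / p * M * d ^ p := by
      calc _ ≤ M / p * d ^ p := by gcongr; linarith
        _ = _ := by ring
    have c3 : M * (d / 4) ^ (p - g) * (d / 4) ^ (g - 1) * (3 / 2 * d) ≤ 24 * M * d ^ p := by
      rw [mul_assoc M, ← Real.rpow_add he]
      have : (d / 4) ^ (p - g + (g - 1)) ≤ 4 * d ^ (p - g + (g - 1)) :=
        rp4 d 4 _ hdz (by norm_num) (by norm_num) (by norm_num) (by linarith) (by linarith)
      calc _ ≤ M * (4 * d ^ (p - g + (g - 1))) * (3 / 2 * d) := by gcongr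
        _ = 6 * M * (d ^ (p - g + (g - 1)) * d ^ (1:ℝ)) := by rw [Real.rpow_one]; ring
        _ = 6 * M * d ^ p := by rw [← Real.rpow_add hdz]; congr 2; ring
        _ ≤ _ := by have : 0 ≤ M * d ^ p := by positivity
                    linarith
    have hM' : 0 ≤ M / g * d ^ p := by positivity
    calc ‖F0 z - L‖ = ‖-(f (z + ((d / 4 : ℝ) : ℂ) * (-z)) - F0 z) + (f (z + ((d / 4 : ℝ) : ℂ) * (-z)) - f (-1 + ((d / 4 : ℝ) : ℂ)))
          + (f (-1 + ((d / 4 : ℝ) : ℂ)) - L)‖ := by congr 1; ring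
      _ ≤ _ := norm_add₃_le
      _ ≤ 4 / g * M * d ^ p + 24 * M * d ^ p + 1 / p * M * d ^ p := by
          rw [norm_neg]
          exact add_le_add (add_le_add (t1.trans c1) (t3.trans c3)) (t2.trans c2)
      _ ≤ _ := by
          have : (8 / g + 1 / p + 24) * M * d ^ p = 4 / g * M * d ^ p + 24 * M * d ^ p + 1 / p * M * d ^ p + 4 * (M / g * d ^ p) := by ring
          rw [this]; linarith
  · intro z hz w hw hzw
    have hdz := Pd_pos hz
    have hd2 := dd_le_two hz.1
    set d := dd z with hdd
    set e := ‖z - w‖ with hee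
    rcases (norm_nonneg (z - w)).eq_or_lt with h0 | he
    · have : z = w := by rw [← sub_eq_zero, ← norm_eq_zero]; exact h0.symm
      subst this; simp; positivity
    have hdw : 3 / 4 * d ≤ dd w := by have := dd_sub z w; linarith
    have hdw0 := Pd_pos hw
    obtain ⟨s1, s2⟩ := hshr z hz e he (by linarith)
    obtain ⟨r1, r2⟩ := hshr w hw e he (by linarith)
    have t1 := hF0b z hz e he (by linarith)
    have t2 := hF0b w hw e he (by linarith)
    have t3 := seg (w + (e:ℂ) * (-w)) (z + (e : ℂ) * (-z)) (d / 4) e e he (by positivity) r1 s1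
      (by
        have : z + (e : ℂ) * (-z) - (w + (e:ℂ) * (-w)) = ((1 - e : ℝ) : ℂ) * (z - w) := by push_cast; ring
        rw [this, norm_mul, Complex.norm_of_nonneg (by linarith)]
        have : 0 ≤ 1 - e := by linarith
        nlinarith)
      (by
        intro v hv
        have := (convex_closedBall z (2 * e)).segment_subset
          (by
            rw [mem_closedBall_iff_norm]
            calc ‖w + (e:ℂ) * (-w) - z‖ = ‖(w + (e:ℂ) * (-w) - w) - (z - w)‖ := by congr 1; ring
              _ ≤ _ := norm_sub_le _ _
              _ ≤ _ := by linarith)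
          (by rw [mem_closedBall_iff_norm]; linarith) hv
        rw [mem_closedBall_iff_norm, norm_sub_rev] at this
        have := dd_sub z v
        linarith)
    have k1 : (d / 2) ^ (p - g) ≤ 4 * d ^ (p - g) := rp4 d 2 _ hdz (by norm_num) (by norm_num) (by norm_num) (by linarith) (by linarith)
    have k4 : (d / 4) ^ (p - g) ≤ 4 * d ^ (p - g) := rp4 d 4 _ hdz (by norm_num) (by norm_num) (by norm_num) (by linarith) (by linarith)
    have k2 : (dd w / 2) ^ (p - g) ≤ 4 * d ^ (p - g) := by
      refine le_trans ?_ k4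
      exact Real.rpow_le_rpow_of_nonpos (by positivity) (by linarith) (by linarith)
    have c1 : M * (d / 2) ^ (p - g) / g * e ^ g ≤ 4 / g * (M * d ^ (p - g) * e ^ g) := by
      calc _ ≤ M * (4 * d ^ (p - g)) / g * e ^ g := by gcongr
        _ = _ := by ring
    have c2 : M * (dd w / 2) ^ (p - g) / g * e ^ g ≤ 4 / g * (M * d ^ (p - g) * e ^ g) := by
      calc _ ≤ M * (4 * d ^ (p - g)) / g * e ^ g := by gcongr
        _ = _ := by ring
    have c3 : M * (d / 4) ^ (p - g) * e ^ (g - 1) * e ≤ 4 * (M * d ^ (p - g) * e ^ g) := by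
      calc _ ≤ M * (4 * d ^ (p - g)) * e ^ (g - 1) * e := by gcongr
        _ = 4 * (M * d ^ (p - g) * (e ^ (g - 1) * e ^ (1:ℝ))) := by rw [Real.rpow_one]; ring
        _ = _ := by rw [← Real.rpow_add he]; congr 3; ring
    have hM' : 0 ≤ M * d ^ (p - g) * e ^ g := by positivity
    calc ‖F0 z - L - (F0 w - L)‖ = ‖-(f (z + (e : ℂ) * (-z)) - F0 z) + (f (z + (e : ℂ) * (-z)) - f (w + (e : ℂ) * (-w)))
          + (f (w + (e : ℂ) * (-w)) - F0 w)‖ := by congr 1; ring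
      _ ≤ _ := norm_add₃_le
      _ ≤ 4 / g * (M * d ^ (p - g) * e ^ g) + 4 * (M * d ^ (p - g) * e ^ g) + 4 / g * (M * d ^ (p - g) * e ^ g) := by
          rw [norm_neg]
          exact add_le_add (add_le_add (t1.trans c1) (t3.trans c3)) (t2.trans c2)
      _ ≤ _ := by
          have : (8 / g + 1 / p + 24) * M * d ^ (p - g) * e ^ g
            = 4 / g * (M * d ^ (p - g) * e ^ g) + 4 * (M * d ^ (p - g) * e ^ g) + 4 / g * (M * d ^ (p - g) * e ^ g)
              + (1 / p + 20) * (M * d ^ (p - g) * e ^ g) := by ring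
          rw [this]
          have : 0 ≤ (1 / p + 20) * (M * d ^ (p - g) * e ^ g) := by positivity
          linarith
  · intro z hz
    exact (hF0 z hz).sub_const L

lemma Cl.cont {g p M : ℝ} {A : Set ℂ} {u : ℂ → ℂ} (hA : A ⊆ Pd) (hg : 0 < g) (hp : 0 < p) (h : Cl g A p M u) (h0 : u (-1) = 0) :
    ContinuousOn u (insert (-1) A) := by
  have hdc : Continuous dd := by unfold dd; fun_prop
  intro z hz
  rcases hz with rfl | hz
  · have : Filter.Tendsto u (nhdsWithin (-1) (insert (-1) A)) (nhds 0) := by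
      have h1 : Filter.Tendsto (fun z => M * dd z ^ p) (nhdsWithin (-1) (insert (-1) A)) (nhds 0) := by
        have : Filter.Tendsto (fun z => M * dd z ^ p) (nhds (-1)) (nhds (M * dd (-1) ^ p)) :=
          ((hdc.rpow_const (fun x => Or.inr hp.le)).tendsto (-1)).const_mul M
        have e : dd (-1) = 0 := by simp [dd]
        rw [e, Real.zero_rpow hp.ne', mul_zero] at this
        exact this.mono_left nhdsWithin_le_nhds
      refine squeeze_zero_norm' ?_ h1
      filter_upwards [self_mem_nhdsWithin] with w hw
      rcases hw with rfl | hw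
      · rw [h0]; simp [dd, Real.zero_rpow hp.ne']
      · exact h.sup w hw
    rw [ContinuousWithinAt, h0]; exact this
  · have hdz := Pd_pos (hA hz)
    have h1 : Filter.Tendsto (fun w => M * dd z ^ (p - g) * ‖z - w‖ ^ g) (nhdsWithin z (insert (-1) A)) (nhds 0) := by
      have : Continuous (fun w => M * dd z ^ (p - g) * ‖z - w‖ ^ g) := by
        apply Continuous.mul continuous_const
        exact (by fun_prop : Continuous fun w => ‖z - w‖).rpow_const (fun x => Or.inr hg.le)
      have := this.tendsto z
      rw [sub_self, norm_zero, Real.zero_rpow hg.ne', mul_zero] at this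
      exact this.mono_left nhdsWithin_le_nhds
    rw [ContinuousWithinAt, tendsto_iff_norm_sub_tendsto_zero]
    refine squeeze_zero_norm' ?_ h1
    filter_upwards [self_mem_nhdsWithin, mem_nhdsWithin_of_mem_nhds (Metric.ball_mem_nhds z (ε := dd z / 4) (by positivity))] with w hw hb
    rw [norm_norm, norm_sub_rev]
    have hb' : ‖z - w‖ < dd z / 4 := by rw [norm_sub_rev]; exact mem_ball_iff_norm.1 hb
    refine h.hol z hz w ?_ hb'.le
    rcases hw with rfl | hw
    · exfalso; have : ‖z - (-1)‖ = dd z := by unfold dd; congr 1; ring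
      rw [this] at hb'; linarith
    · exact hw

lemma kx (k x p : ℝ) (hk : 1 ≤ k) (hx : 0 ≤ x) (hp1 : p ≤ 1) : (k * x) ^ p ≤ k * x ^ p := by
  rw [Real.mul_rpow (by linarith) hx]
  gcongr
  calc k ^ p ≤ k ^ (1:ℝ) := Real.rpow_le_rpow_of_exponent_le hk hp1
    _ = k := Real.rpow_one k

lemma dk (k d x e : ℝ) (hk : 1 ≤ k) (hd : 0 < d) (hx : d / k ≤ x) (he : e ≤ 0) (he1 : -1 ≤ e) : x ^ e ≤ k * d ^ e := by
  calc x ^ e ≤ (d / k) ^ e := Real.rpow_le_rpow_of_nonpos (by positivity) hx he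
    _ = k ^ (-e) * d ^ e := by rw [Real.div_rpow hd.le (by linarith), div_eq_inv_mul, ← Real.rpow_neg (by linarith)]
    _ ≤ k ^ (1:ℝ) * d ^ e := by gcongr <;> linarith
    _ = k * d ^ e := by rw [Real.rpow_one]

lemma splitp (k d x p g : ℝ) (hk : 1 ≤ k) (hd : 0 < d) (hx : d / k ≤ x) (hp : 0 < p) (hpg : p ≤ g) (hg : g < 1) :
    x ^ p ≤ k * d ^ (p - g) * x ^ g := by
  have hx0 : 0 < x := lt_of_lt_of_le (by positivity) hx
  have h1 := dk k d x (p - g) hk hd hx (by linarith) (by linarith)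
  calc x ^ p = x ^ (p - g) * x ^ g := by rw [← Real.rpow_add hx0]; congr 1; ring
    _ ≤ _ := by gcongr

lemma ptw {g p M : ℝ} (hM : 0 ≤ M) (hp : 0 < p) (hpg : p ≤ g) (hg : g < 1) {u : ℂ → ℂ} (h : Cl g Sc p M u) (h0 : u (-1) = 0)
    (z : ℂ) (hz : ‖z‖ < 1) (c : ℂ) (hc : (dd z ≤ 8 * (1 - ‖z‖) ∧ c = 0) ∨ (8 * (1 - ‖z‖) < dd z ∧ c = u (z / ‖z‖)))
    (w : ℂ) (hw : ‖w‖ = 1) : ‖u w - c‖ ≤ 300 * M * dd z ^ (p - g) * ‖w - z‖ ^ g := by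
  have hdz := dd_pos (ball_ne hz)
  set d := dd z
  set x := ‖w - z‖
  have hxh : 1 - ‖z‖ ≤ x := by have := norm_sub_norm_le w z; rw [hw] at this; exact this
  have hx0 : 0 < x := by linarith
  have hdw : dd w ≤ d + x := dd_sub w z
  have hM0 : 0 ≤ M * d ^ (p - g) * x ^ g := by positivity
  have hsup : ‖u w‖ ≤ M * (d + x) ^ p := by
    by_cases hw1 : w = -1
    · rw [hw1, h0, norm_zero]; positivity
    · refine (h.sup w ⟨hw, hw1⟩).trans ?_
      have : 0 ≤ dd w := norm_nonneg _
      gcongr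
  have hsup2 : ∀ k : ℝ, 1 ≤ k → d / k ≤ x → ‖u w‖ ≤ (k + 1) * k * (M * d ^ (p - g) * x ^ g) := by
    intro k hk hdk
    have h1 := splitp k d x p g hk hdz hdk hp hpg hg
    have h2 : d + x ≤ (k + 1) * x := by
      rw [div_le_iff₀ (by linarith)] at hdk; linarith
    calc ‖u w‖ ≤ M * (d + x) ^ p := hsup
      _ ≤ M * ((k + 1) * x) ^ p := by gcongr
      _ ≤ M * ((k + 1) * x ^ p) := by gcongr; exact kx _ _ _ (by linarith) hx0.le (by linarith)
      _ ≤ M * ((k + 1) * (k * d ^ (p - g) * x ^ g)) := by gcongr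
      _ = _ := by ring
  rcases hc with ⟨h1, rfl⟩ | ⟨h1, rfl⟩
  · have := hsup2 8 (by norm_num) (by linarith)
    rw [sub_zero]; linarith
  · have hz0 : z ≠ 0 := by
      rintro rfl; have : d = 1 := by simp [d, dd]
      rw [this] at h1; simp at h1
    have hnz : 0 < ‖z‖ := norm_pos_iff.2 hz0
    set y := z / ‖z‖
    have hy1 : ‖y‖ = 1 := by simp [y, hz0]
    have hyz : ‖y - z‖ = 1 - ‖z‖ := by
      have : y - z = y * ((1 - ‖z‖ : ℝ) : ℂ) := by
        have : (‖z‖ : ℂ) ≠ 0 := by exact_mod_cast hnz.ne'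
        simp only [y]; push_cast; field_simp
      rw [this, norm_mul, hy1, Complex.norm_of_nonneg (by linarith), one_mul]
    have e1 : dd y ≤ d + (1 - ‖z‖) := by rw [← hyz]; exact dd_sub y z
    have e2 : d ≤ dd y + (1 - ‖z‖) := by rw [← hyz, norm_sub_rev]; exact dd_sub z y
    have hdy : 0 < dd y := by linarith
    have hyS : y ∈ Sc := ⟨hy1, by intro h; rw [h] at hdy; simp [dd] at hdy⟩
    have hwy : ‖y - w‖ ≤ 2 * x := by
      have : y - w = (y - z) - (w - z) := by ring
      rw [this]; refine (norm_sub_le _ _).trans ?_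
      rw [hyz]; change _ + x ≤ _; linarith
    by_cases hn : ‖y - w‖ ≤ dd y / 4
    · have hwS : w ∈ Sc := by
        refine ⟨hw, ?_⟩
        rintro rfl
        have : ‖y - (-1)‖ = dd y := by unfold dd; congr 1; ring
        linarith
      have h3 := h.hol y hyS w hwS hn
      rw [norm_sub_rev]
      have h4 : dd y ^ (p - g) ≤ 2 * d ^ (p - g) := dk 2 d _ _ (by norm_num) hdz (by linarith) (by linarith) (by linarith)
      have h5 : ‖y - w‖ ^ g ≤ 2 * x ^ g :=
        (Real.rpow_le_rpow (norm_nonneg _) hwy (by linarith)).trans (kx 2 x g (by norm_num) hx0.le hg.le)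
      calc ‖u y - u w‖ ≤ M * dd y ^ (p - g) * ‖y - w‖ ^ g := h3
        _ ≤ M * (2 * d ^ (p - g)) * (2 * x ^ g) := by gcongr
        _ = 4 * (M * d ^ (p - g) * x ^ g) := by ring
        _ ≤ 300 * (M * d ^ (p - g) * x ^ g) := by gcongr; norm_num
        _ = _ := by ring
    · push Not at hn
      have hx10 : d / 10 ≤ x := by linarith
      have h2 := hsup2 10 (by norm_num) hx10
      have h3 : ‖u y‖ ≤ 12 * 10 * (M * d ^ (p - g) * x ^ g) := by
        calc ‖u y‖ ≤ M * dd y ^ p := h.sup y hyS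
          _ ≤ M * (12 * x) ^ p := by gcongr; linarith
          _ ≤ M * (12 * x ^ p) := by gcongr; exact kx _ _ _ (by norm_num) hx0.le (by linarith)
          _ ≤ M * (12 * (10 * d ^ (p - g) * x ^ g)) := by gcongr; exact splitp 10 d x p g (by norm_num) hdz hx10 hp hpg hg
          _ = _ := by ring
      calc ‖u w - u y‖ ≤ ‖u w‖ + ‖u y‖ := norm_sub_le _ _
        _ ≤ 300 * (M * d ^ (p - g) * x ^ g) := by linarith
        _ = _ := by ring

lemma cm_shift (f : ℂ → ℂ) : ∫ θ in (-Real.pi)..Real.pi, f (circleMap 0 1 θ) = ∫ θ in (0:ℝ)..(2 * Real.pi), f (circleMap 0 1 θ) := by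
  have hper : Function.Periodic (fun θ : ℝ => f (circleMap 0 1 θ)) (2 * Real.pi) := by
    intro x; simp only [periodic_circleMap 0 1 x]
  have := hper.intervalIntegral_add_eq (-Real.pi) 0
  rwa [show -Real.pi + 2 * Real.pi = Real.pi by ring, zero_add] at this

lemma int_k1 (z : ℂ) (hz : ‖z‖ < 1) : ∫ θ in (-Real.pi)..Real.pi, circleMap 0 1 θ / (circleMap 0 1 θ - z) = 2 * Real.pi := by
  rw [cm_shift (fun w => w / (w - z))]
  have := circleIntegral.integral_sub_inv_of_mem_ball (c := 0) (w := z) (R := 1) (by simpa using hz)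
  rw [circleIntegral] at this
  simp only [deriv_circleMap, smul_eq_mul] at this
  have h2 : ∀ θ : ℝ, circleMap 0 1 θ * I * (circleMap 0 1 θ - z)⁻¹ = I * (circleMap 0 1 θ / (circleMap 0 1 θ - z)) := by
    intro θ; rw [div_eq_mul_inv]; ring
  simp only [h2] at this
  rw [intervalIntegral.integral_const_mul] at this
  have hI := I_ne_zero
  apply mul_left_cancel₀ hI
  rw [this]; ring

lemma int_k2 (z : ℂ) (_hz : ‖z‖ < 1) : ∫ θ in (-Real.pi)..Real.pi, circleMap 0 1 θ / (circleMap 0 1 θ - z) ^ 2 = 0 := by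
  rw [cm_shift (fun w => w / (w - z) ^ 2)]
  have := circleIntegral.integral_sub_zpow_of_ne (n := -2) (by norm_num) 0 z 1
  rw [circleIntegral] at this
  simp only [deriv_circleMap, smul_eq_mul] at this
  have h2 : ∀ θ : ℝ, circleMap 0 1 θ * I * (circleMap 0 1 θ - z) ^ (-2 : ℤ) = I * (circleMap 0 1 θ / (circleMap 0 1 θ - z) ^ 2) := by
    intro θ; rw [div_eq_mul_inv, zpow_neg]; norm_cast; ring
  simp only [h2] at this
  rw [intervalIntegral.integral_const_mul] at this
  exact (mul_eq_zero.1 this).resolve_left I_ne_zero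

lemma cmn (θ : ℝ) : ‖circleMap 0 1 θ‖ = 1 := by simp

lemma cm_sub_ne (z : ℂ) (hz : ‖z‖ < 1) (θ : ℝ) : circleMap 0 1 θ - z ≠ 0 := norm_pos_iff.1 (A_ne z hz θ)

lemma sch_deriv (U : ℝ → ℂ) (hU : Continuous U) (z0 : ℂ) (hz0 : ‖z0‖ < 1) :
    HasDerivAt (fun z => ∫ θ in (-Real.pi)..Real.pi, (circleMap 0 1 θ + z) / (circleMap 0 1 θ - z) * U θ)
      (∫ θ in (-Real.pi)..Real.pi, 2 * (circleMap 0 1 θ / (circleMap 0 1 θ - z0) ^ 2) * U θ) z0 := by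
  set r := (1 - ‖z0‖) / 2 with hr
  have hr0 : 0 < r := by rw [hr]; linarith
  have hball : ∀ z ∈ Metric.ball z0 r, ‖z‖ < 1 - r := by
    intro z hz
    have h1 : ‖z - z0‖ < r := mem_ball_iff_norm.1 hz
    have := norm_sub_norm_le z z0
    rw [hr] at h1 ⊢; linarith
  have hcm : Continuous fun θ : ℝ => circleMap 0 1 θ := continuous_circleMap 0 1
  have hc1 : ∀ z, ‖z‖ < 1 → Continuous fun θ => (circleMap 0 1 θ + z) / (circleMap 0 1 θ - z) * U θ := by
    intro z hz
    exact ((hcm.add continuous_const).div (hcm.sub continuous_const) (cm_sub_ne z hz)).mul hU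
  refine (intervalIntegral.hasDerivAt_integral_of_dominated_loc_of_deriv_le (μ := MeasureTheory.volume)
    (F := fun z θ => (circleMap 0 1 θ + z) / (circleMap 0 1 θ - z) * U θ)
    (F' := fun z θ => 2 * (circleMap 0 1 θ / (circleMap 0 1 θ - z) ^ 2) * U θ)
    (bound := fun θ => 2 * (1 / r ^ 2) * ‖U θ‖) (s := Metric.ball z0 r)
    (Metric.ball_mem_nhds _ hr0) ?_ ?_ ?_ ?_ ?_ ?_).2
  · filter_upwards [Metric.ball_mem_nhds z0 hr0] with z hz
    exact (hc1 z (by linarith [hball z hz])).aestronglyMeasurable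
  · exact (hc1 z0 hz0).intervalIntegrable _ _
  · refine Continuous.aestronglyMeasurable ?_
    exact (continuous_const.mul (hcm.div ((hcm.sub continuous_const).pow 2) (fun θ => pow_ne_zero 2 (cm_sub_ne z0 hz0 θ)))).mul hU
  · refine Filter.Eventually.of_forall fun θ _ z hz => ?_
    have hz1 := hball z hz
    rw [norm_mul, norm_mul, norm_div, norm_pow, cmn]
    have : r ≤ ‖circleMap 0 1 θ - z‖ := by
      have := norm_sub_norm_le (circleMap 0 1 θ) z
      rw [cmn] at this; linarith
    rw [show ‖(2:ℂ)‖ = 2 by norm_num]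
    gcongr
  · exact ((continuous_const.mul hU.norm)).intervalIntegrable _ _
  · refine Filter.Eventually.of_forall fun θ _ z hz => ?_
    have hne := cm_sub_ne z (by linarith [hball z hz]) θ
    have h1 : HasDerivAt (fun z => (circleMap 0 1 θ + z) / (circleMap 0 1 θ - z))
       ((1 * (circleMap 0 1 θ - z) - (circleMap 0 1 θ + z) * (-1)) / (circleMap 0 1 θ - z) ^ 2) z :=
      ((hasDerivAt_id z).const_add _).div ((hasDerivAt_id z).const_sub _) hne
    have h2 := h1.mul_const (U θ)
    have e : 2 * (circleMap 0 1 θ / (circleMap 0 1 θ - z) ^ 2) * U θ = (1 * (circleMap 0 1 θ - z) - (circleMap 0 1 θ + z) * (-1)) / (circleMap 0 1 θ - z) ^ 2 * U θ := by ring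
    simp only [e]; exact h2

lemma int_norm_bound (U : ℝ → ℂ) (k : ℝ → ℂ) (hU : Continuous U) (hk : Continuous k) (z : ℂ) (hz : ‖z‖ < 1) (g B D C : ℝ)
    (hB : 0 ≤ B) (hD : 0 ≤ D)
    (hC : ∫ θ in (-Real.pi)..Real.pi, ‖circleMap 0 1 θ - z‖ ^ (-1 - (1 - g)) ≤ C * (1 - ‖z‖) ^ (-(1 - g)))
    (h1 : ∀ θ, ‖k θ‖ ≤ D * ‖circleMap 0 1 θ - z‖ ^ (-2:ℝ)) (h2 : ∀ θ, ‖U θ‖ ≤ B * ‖circleMap 0 1 θ - z‖ ^ g) :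
    ‖∫ θ in (-Real.pi)..Real.pi, k θ * U θ‖ ≤ D * B * (C * (1 - ‖z‖) ^ (g - 1)) := by
  have hpi : -Real.pi ≤ Real.pi := by linarith [Real.pi_pos]
  calc ‖∫ θ in (-Real.pi)..Real.pi, k θ * U θ‖ ≤ ∫ θ in (-Real.pi)..Real.pi, ‖k θ * U θ‖ :=
        intervalIntegral.norm_integral_le_integral_norm hpi
    _ ≤ ∫ θ in (-Real.pi)..Real.pi, (D * B) * ‖circleMap 0 1 θ - z‖ ^ (-1 - (1 - g)) := by
        apply intervalIntegral.integral_mono_on hpi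
        · exact (hk.mul hU).norm.intervalIntegrable _ _
        · exact (continuous_const.mul (A_cont z hz _)).intervalIntegrable _ _
        · intro θ _
          rw [norm_mul]
          have hp := A_ne z hz θ
          calc _ ≤ (D * ‖circleMap 0 1 θ - z‖ ^ (-2:ℝ)) * (B * ‖circleMap 0 1 θ - z‖ ^ g) := by
                gcongr
                · exact h1 θ
                · exact h2 θ
            _ = (D * B) * (‖circleMap 0 1 θ - z‖ ^ (-2:ℝ) * ‖circleMap 0 1 θ - z‖ ^ g) := by ring
            _ = _ := by rw [← Real.rpow_add hp]; congr 2; ring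
    _ = (D * B) * ∫ θ in (-Real.pi)..Real.pi, ‖circleMap 0 1 θ - z‖ ^ (-1 - (1 - g)) := by
        rw [intervalIntegral.integral_const_mul]
    _ ≤ _ := by
        rw [show g - 1 = -(1 - g) by ring]
        gcongr

lemma re_kernel (w z : ℂ) (hw : ‖w‖ = 1) (hz : ‖z‖ < 1) : ((w + z) / (w - z)).re = (1 - ‖z‖ ^ 2) * ‖w - z‖ ^ (-2:ℝ) := by
  have h1 : ‖w‖ ^ 2 = 1 := by rw [hw]; norm_num
  have hne : w - z ≠ 0 := by
    intro h; have : w = z := sub_eq_zero.1 h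
    rw [this] at hw; linarith
  have hn : (0:ℝ) < ‖w - z‖ := norm_pos_iff.2 hne
  rw [Real.rpow_neg hn.le, Complex.div_re]
  rw [show ((2:ℝ)) = ((2:ℕ):ℝ) by norm_num, Real.rpow_natCast, ← Complex.normSq_eq_norm_sq]
  rw [← h1, ← Complex.normSq_eq_norm_sq, ← Complex.normSq_eq_norm_sq]
  have : Complex.normSq (w - z) ≠ 0 := by simpa using hne
  field_simp
  simp [Complex.normSq_apply]
  ring

lemma schwarz0 (g p : ℝ) (hp : 0 < p) (hpg : p ≤ g) (hg : g < 1) : ∃ C : ℝ, 0 < C ∧ ∀ (M : ℝ) (u : ℂ → ℝ), 0 ≤ M →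
    Cl g Sc p M (fun z => (u z : ℂ)) → u (-1) = 0 →
    ∃ a : ℂ → ℂ, DifferentiableOn ℂ a (Metric.ball 0 1) ∧ Cl g Pd p (C * M) a ∧ ∀ z ∈ Sc, (a z).im = u z := by
  obtain ⟨C1, hC1, hint⟩ := A_int (1 - g) (by linarith)
  obtain ⟨C2, hC2, hHL⟩ := HL g p hp hpg hg
  refine ⟨C2 * (300 * C1), by positivity, fun M u hM hu hu1 => ?_⟩
  have hpi0 := Real.pi_pos
  set U : ℝ → ℂ := fun θ => (u (circleMap 0 1 θ) : ℂ) with hUdef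
  have hU : Continuous U := by
    have h1 := hu.cont Sc_sub (by linarith) hp (by simp [hu1])
    refine h1.comp_continuous (continuous_circleMap 0 1) ?_
    intro θ
    by_cases h : circleMap 0 1 θ = -1
    · exact Or.inl h
    · exact Or.inr ⟨cmn θ, h⟩
  have hcm : Continuous fun θ : ℝ => circleMap 0 1 θ := continuous_circleMap 0 1
  set f : ℂ → ℂ := fun z => I / (2 * Real.pi) * ∫ θ in (-Real.pi)..Real.pi, (circleMap 0 1 θ + z) / (circleMap 0 1 θ - z) * U θ with hf
  have hder : ∀ z, ‖z‖ < 1 → HasDerivAt f (I / (2 * Real.pi) * (∫ θ in (-Real.pi)..Real.pi, 2 * (circleMap 0 1 θ / (circleMap 0 1 θ - z) ^ 2) * U θ)) z :=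
    fun z hz => (sch_deriv U hU z hz).const_mul _
  have hdiff : DifferentiableOn ℂ f (Metric.ball 0 1) := fun z hz =>
    (hder z (by simpa using hz)).differentiableAt.differentiableWithinAt
  have hpw : ∀ z, ‖z‖ < 1 → ∀ c : ℝ, ((dd z ≤ 8 * (1 - ‖z‖) ∧ c = 0) ∨ (8 * (1 - ‖z‖) < dd z ∧ c = u (z / ‖z‖))) →
      ∀ θ, ‖U θ - c‖ ≤ 300 * M * dd z ^ (p - g) * ‖circleMap 0 1 θ - z‖ ^ g := by
    intro z hz c hc θ
    refine ptw hM hp hpg hg hu (by simp [hu1]) z hz c ?_ _ (cmn θ)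
    rcases hc with ⟨h1, h2⟩ | ⟨h1, h2⟩
    · left; exact ⟨h1, by simp [h2]⟩
    · right; exact ⟨h1, by simp [h2]⟩
  have hex : ∀ z : ℂ, ∃ c : ℝ, ((dd z ≤ 8 * (1 - ‖z‖) ∧ c = 0) ∨ (8 * (1 - ‖z‖) < dd z ∧ c = u (z / ‖z‖))) := by
    intro z
    rcases le_or_gt (dd z) (8 * (1 - ‖z‖)) with h | h
    · exact ⟨0, Or.inl ⟨h, rfl⟩⟩
    · exact ⟨_, Or.inr ⟨h, rfl⟩⟩
  have hk2c : ∀ z, ‖z‖ < 1 → Continuous fun θ : ℝ => circleMap 0 1 θ / (circleMap 0 1 θ - z) ^ 2 := fun z hz =>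
    hcm.div ((hcm.sub continuous_const).pow 2) (fun θ => pow_ne_zero 2 (cm_sub_ne z hz θ))
  have hk1c : ∀ z, ‖z‖ < 1 → Continuous fun θ : ℝ => circleMap 0 1 θ / (circleMap 0 1 θ - z) := fun z hz =>
    hcm.div (hcm.sub continuous_const) (cm_sub_ne z hz)
  have hbd : ∀ z, ‖z‖ < 1 → ‖deriv f z‖ ≤ (300 * C1 * M) * dd z ^ (p - g) * (1 - ‖z‖) ^ (g - 1) := by
    intro z hz
    obtain ⟨c, hc⟩ := hex z
    have h1 := hpw z hz c hc
    rw [(hder z hz).deriv]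
    have e : ∫ θ in (-Real.pi)..Real.pi, 2 * (circleMap 0 1 θ / (circleMap 0 1 θ - z) ^ 2) * U θ
        = 2 * ∫ θ in (-Real.pi)..Real.pi, (circleMap 0 1 θ / (circleMap 0 1 θ - z) ^ 2) * (U θ - c) := by
      have h3 : ∫ θ in (-Real.pi)..Real.pi, (circleMap 0 1 θ / (circleMap 0 1 θ - z) ^ 2) * (U θ - c)
        = (∫ θ in (-Real.pi)..Real.pi, (circleMap 0 1 θ / (circleMap 0 1 θ - z) ^ 2) * U θ)
          - ∫ θ in (-Real.pi)..Real.pi, (circleMap 0 1 θ / (circleMap 0 1 θ - z) ^ 2) * c := by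
        rw [← intervalIntegral.integral_sub]
        · congr 1; ext θ; ring
        · exact ((hk2c z hz).mul hU).intervalIntegrable _ _
        · exact ((hk2c z hz).mul continuous_const).intervalIntegrable _ _
      rw [h3, intervalIntegral.integral_mul_const, int_k2 z hz, zero_mul, sub_zero, ← intervalIntegral.integral_const_mul]
      congr 1; ext θ; ring
    rw [e]
    have h4 := int_norm_bound (fun θ => U θ - c) (fun θ => circleMap 0 1 θ / (circleMap 0 1 θ - z) ^ 2)
      (hU.sub continuous_const) (hk2c z hz) z hz g (300 * M * dd z ^ (p - g)) 1 C1
      (by have : 0 ≤ dd z := norm_nonneg _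
          positivity) zero_le_one (hint z hz) (by
        intro θ
        rw [norm_div, norm_pow, cmn, one_mul, Real.rpow_neg (norm_nonneg _), one_div]
        norm_cast) h1
    rw [norm_mul, norm_mul, norm_div, norm_mul, norm_I]
    rw [show ‖(2:ℂ)‖ = 2 by norm_num, Complex.norm_of_nonneg hpi0.le]
    have h5 : 1 / (2 * Real.pi) * 2 ≤ 1 := by
      rw [div_mul_eq_mul_div, div_le_one (by positivity)]; linarith [Real.pi_gt_three]
    rw [← mul_assoc]
    calc _ ≤ 1 * ‖∫ θ in (-Real.pi)..Real.pi, (circleMap 0 1 θ / (circleMap 0 1 θ - z) ^ 2) * (U θ - c)‖ := by gcongr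
      _ ≤ 1 * (300 * M * dd z ^ (p - g)) * (C1 * (1 - ‖z‖) ^ (g - 1)) := by rw [one_mul]; exact h4
      _ = _ := by ring
  have him : ∀ z, ‖z‖ < 1 → ∀ c : ℝ, ((dd z ≤ 8 * (1 - ‖z‖) ∧ c = 0) ∨ (8 * (1 - ‖z‖) < dd z ∧ c = u (z / ‖z‖))) →
      |(f z).im - c| ≤ (300 * C1 * M) * dd z ^ (p - g) * (1 - ‖z‖) ^ g := by
    intro z hz c hc
    have h1 := hpw z hz c hc
    have hcc : Continuous fun θ : ℝ => (circleMap 0 1 θ + z) / (circleMap 0 1 θ - z) :=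
      (hcm.add continuous_const).div (hcm.sub continuous_const) (cm_sub_ne z hz)
    have e1 : ∫ θ in (-Real.pi)..Real.pi, (circleMap 0 1 θ + z) / (circleMap 0 1 θ - z) = 2 * Real.pi := by
      have : ∀ θ, (circleMap 0 1 θ + z) / (circleMap 0 1 θ - z) = 2 * (circleMap 0 1 θ / (circleMap 0 1 θ - z)) - 1 := by
        intro θ; have := cm_sub_ne z hz θ; field_simp; ring
      simp_rw [this]
      rw [intervalIntegral.integral_sub, intervalIntegral.integral_const_mul, int_k1 z hz]
      · simp; ring
      · exact (continuous_const.mul (hk1c z hz)).intervalIntegrable _ _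
      · exact continuous_const.intervalIntegrable _ _
    have e2 : f z - c * I = I / (2 * Real.pi) * ∫ θ in (-Real.pi)..Real.pi, (circleMap 0 1 θ + z) / (circleMap 0 1 θ - z) * (U θ - c) := by
      have h3 : ∫ θ in (-Real.pi)..Real.pi, (circleMap 0 1 θ + z) / (circleMap 0 1 θ - z) * (U θ - c)
        = (∫ θ in (-Real.pi)..Real.pi, (circleMap 0 1 θ + z) / (circleMap 0 1 θ - z) * U θ)
          - ∫ θ in (-Real.pi)..Real.pi, (circleMap 0 1 θ + z) / (circleMap 0 1 θ - z) * c := by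
        rw [← intervalIntegral.integral_sub]
        · congr 1; ext θ; ring
        · exact (hcc.mul hU).intervalIntegrable _ _
        · exact (hcc.mul continuous_const).intervalIntegrable _ _
      rw [h3, intervalIntegral.integral_mul_const, e1]
      simp only [hf]
      have : (Real.pi : ℂ) ≠ 0 := by exact_mod_cast hpi0.ne'
      field_simp
    have e3 : (f z).im - c = 1 / (2 * Real.pi) * ∫ θ in (-Real.pi)..Real.pi, ((circleMap 0 1 θ + z) / (circleMap 0 1 θ - z)).re * (u (circleMap 0 1 θ) - c) := by
      have h3 : (f z).im - c = (f z - c * I).im := by simp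
      rw [h3, e2]
      have h4 : ∀ X : ℂ, (I / (2 * Real.pi) * X).im = 1 / (2 * Real.pi) * X.re := by
        intro X
        have : I / (2 * Real.pi) * X = ((1 / (2 * Real.pi) : ℝ) : ℂ) * (I * X) := by push_cast; ring
        rw [this, Complex.im_ofReal_mul]; simp
      rw [h4]
      congr 1
      have h5 := Complex.reCLM.intervalIntegral_comp_comm (μ := MeasureTheory.volume) (a := -Real.pi) (b := Real.pi) (f := fun θ => (circleMap 0 1 θ + z) / (circleMap 0 1 θ - z) * (U θ - c))
        ((hcc.mul (hU.sub continuous_const)).intervalIntegrable _ _)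
      simp only [Complex.reCLM_apply] at h5
      rw [← h5]
      congr 1; ext θ
      simp [hUdef]
    have e4 : ((∫ θ in (-Real.pi)..Real.pi, ((circleMap 0 1 θ + z) / (circleMap 0 1 θ - z)).re * (u (circleMap 0 1 θ) - c) : ℝ) : ℂ)
        = ∫ θ in (-Real.pi)..Real.pi, (((circleMap 0 1 θ + z) / (circleMap 0 1 θ - z)).re : ℂ) * (U θ - c) := by
      rw [← intervalIntegral.integral_ofReal]
      simp [hUdef]
    have hz2 : 1 - ‖z‖ ^ 2 ≤ 2 * (1 - ‖z‖) := by nlinarith [norm_nonneg z]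
    have hz3 : 0 ≤ 1 - ‖z‖ ^ 2 := by nlinarith [norm_nonneg z]
    have h4 := int_norm_bound (fun θ => U θ - c) (fun θ => (((circleMap 0 1 θ + z) / (circleMap 0 1 θ - z)).re : ℂ))
      (hU.sub continuous_const) (Complex.continuous_ofReal.comp (Complex.continuous_re.comp hcc)) z hz g (300 * M * dd z ^ (p - g)) (2 * (1 - ‖z‖)) C1
      (by have : 0 ≤ dd z := norm_nonneg _
          positivity) (by linarith) (hint z hz) (by
        intro θ
        rw [re_kernel _ z (cmn θ) hz, Complex.norm_of_nonneg (by positivity)]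
        gcongr) h1
    rw [← e4, Complex.norm_real, Real.norm_eq_abs] at h4
    rw [e3, abs_mul, abs_of_pos (by positivity)]
    have h0 : 0 < 1 - ‖z‖ := by linarith
    calc _ ≤ 1 / (2 * Real.pi) * (2 * (1 - ‖z‖) * (300 * M * dd z ^ (p - g)) * (C1 * (1 - ‖z‖) ^ (g - 1))) := by gcongr
      _ = 1 / Real.pi * ((300 * C1 * M) * dd z ^ (p - g) * ((1 - ‖z‖) ^ (g - 1) * (1 - ‖z‖) ^ (1:ℝ))) := by
          rw [Real.rpow_one]; field_simp
      _ = 1 / Real.pi * ((300 * C1 * M) * dd z ^ (p - g) * (1 - ‖z‖) ^ g) := by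
          rw [← Real.rpow_add h0]; congr 3; ring
      _ ≤ 1 * ((300 * C1 * M) * dd z ^ (p - g) * (1 - ‖z‖) ^ g) := by
          have : 0 ≤ dd z := norm_nonneg _
          gcongr
          rw [div_le_one hpi0]; linarith [Real.pi_gt_three]
      _ = _ := one_mul _
  obtain ⟨L, F, hF1, hF2, hF3, hF4⟩ := hHL (300 * C1 * M) f (by positivity) hdiff hbd
  have hLim : L.im = 0 := by
    have h1 : Filter.Tendsto (fun s : ℝ => (f (-1 + s)).im) (nhdsWithin 0 (Set.Ioi 0)) (nhds L.im) :=
      (Complex.continuous_im.tendsto L).comp hF3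
    refine tendsto_nhds_unique h1 ?_
    have h2 : Filter.Tendsto (fun s : ℝ => (300 * C1 * M) * s ^ p) (nhdsWithin 0 (Set.Ioi 0)) (nhds 0) := by
      have : Filter.Tendsto (fun b : ℝ => (300 * C1 * M) * b ^ p) (nhds 0) (nhds ((300 * C1 * M) * 0 ^ p)) :=
        ((continuous_id.rpow_const (fun x => Or.inr hp.le)).tendsto 0).const_mul _
      rw [Real.zero_rpow hp.ne', mul_zero] at this
      exact this.mono_left nhdsWithin_le_nhds
    refine squeeze_zero_norm' ?_ h2
    filter_upwards [Ioo_mem_nhdsGT (zero_lt_one' ℝ)] with s hs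
    have hs1 : ‖(-1 : ℂ) + s‖ = 1 - s := by
      have : (-1 : ℂ) + s = -((1 - s : ℝ) : ℂ) := by push_cast; ring
      rw [this, norm_neg, Complex.norm_of_nonneg (by linarith [hs.2])]
    have hs2 : dd (-1 + s) = s := by
      unfold dd; rw [show 1 + (-1 + (s:ℂ)) = s by ring, Complex.norm_of_nonneg hs.1.le]
    have := him (-1 + s) (by rw [hs1]; linarith [hs.1]) 0 (Or.inl ⟨by rw [hs1, hs2]; linarith [hs.1], rfl⟩)
    rw [hs1, hs2, sub_zero, sub_sub_cancel, mul_assoc, ← Real.rpow_add hs.1, sub_add_cancel] at this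
    exact this
  refine ⟨F, ?_, ?_, ?_⟩
  · refine (hdiff.sub_const L).congr ?_
    intro z hz; exact hF1 z (by simpa using hz)
  · convert hF2 using 1; ring
  · intro z hz
    have hzP := Sc_sub hz
    have hdz := Pd_pos hzP
    have h1 : Filter.Tendsto (fun s : ℝ => (f (z + s * (-z)) - L).im) (nhdsWithin 0 (Set.Ioi 0)) (nhds (F z).im) :=
      (Complex.continuous_im.tendsto _).comp (hF4 z hzP)
    refine tendsto_nhds_unique h1 ?_
    rw [tendsto_iff_norm_sub_tendsto_zero]
    have h2 : Filter.Tendsto (fun s : ℝ => (300 * C1 * M) * (2 * dd z ^ (p - g)) * s ^ g) (nhdsWithin 0 (Set.Ioi 0)) (nhds 0) := by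
      have : Filter.Tendsto (fun b : ℝ => (300 * C1 * M) * (2 * dd z ^ (p - g)) * b ^ g) (nhds 0) (nhds ((300 * C1 * M) * (2 * dd z ^ (p - g)) * 0 ^ g)) :=
        ((continuous_id.rpow_const (fun x => Or.inr (by linarith))).tendsto 0).const_mul _
      rw [Real.zero_rpow (by linarith), mul_zero] at this
      exact this.mono_left nhdsWithin_le_nhds
    refine squeeze_zero_norm' ?_ h2
    have hd2 := dd_le_two hzP.1
    filter_upwards [Ioo_mem_nhdsGT (show (0:ℝ) < dd z / 10 by positivity)] with s hs
    have hs0 := hs.1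
    have hs3 := hs.2
    have hzs : z + s * (-z) = ((1 - s : ℝ) : ℂ) * z := by push_cast; ring
    have hs1 : ‖z + s * (-z)‖ = 1 - s := by
      rw [hzs, norm_mul, Complex.norm_of_nonneg (by linarith), hz.1, mul_one]
    have hs2 : dd z - s ≤ dd (z + s * (-z)) := by
      have := dd_sub z (z + s * (-z))
      rw [show z - (z + s * (-z)) = s * z by ring, norm_mul, Complex.norm_of_nonneg hs0.le, hz.1, mul_one] at this
      linarith
    have hs4 : (z + s * (-z)) / ‖z + s * (-z)‖ = z := by
      rw [hs1, hzs]
      have : ((1 - s : ℝ) : ℂ) ≠ 0 := by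
        have : (1 - s : ℝ) ≠ 0 := by linarith
        exact_mod_cast this
      field_simp
    have h3 := him (z + s * (-z)) (by rw [hs1]; linarith) (u z) (Or.inr ⟨by rw [hs1]; linarith, by rw [hs4]⟩)
    rw [hs1, sub_sub_cancel] at h3
    rw [norm_norm, Complex.sub_im, hLim, sub_zero]
    refine h3.trans ?_
    gcongr
    exact dk 2 (dd z) _ _ (by norm_num) hdz (by linarith) (by linarith) (by linarith)

theorem schwarz (g p : ℝ) (hp : 0 < p) (hpg : p ≤ g) (hg : g < 1) : ∃ C : ℝ, 0 < C ∧ ∀ (M : ℝ) (u : ℂ → ℝ), 0 ≤ M →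
    Cl g Sc p M (fun z => (u z : ℂ)) →
    ∃ a : ℂ → ℂ, DifferentiableOn ℂ a (Metric.ball 0 1) ∧ Cl g Pd p (C * M) a ∧ a (-1) = 0 ∧ ∀ z ∈ Sc, (a z).im = u z := by
  obtain ⟨C, hC, h⟩ := schwarz0 g p hp hpg hg
  refine ⟨C, hC, fun M u hM hu => ?_⟩
  obtain ⟨a, h1, h2, h3⟩ := h M (Function.update u (-1) 0) hM (by
    constructor
    · intro z hz; simp only [Function.update_of_ne hz.2]; exact hu.sup z hz
    · intro z hz w hw; simp only [Function.update_of_ne hz.2, Function.update_of_ne hw.2]; exact hu.hol z hz w hw) (by simp)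
  refine ⟨Function.update a (-1) 0, ?_, ⟨?_, ?_⟩, by simp, ?_⟩
  · refine h1.congr fun z hz => ?_
    rw [Function.update_of_ne (ball_ne (by simpa using hz))]
  · intro z hz; simp only [Function.update_of_ne hz.2]; exact h2.sup z hz
  · intro z hz w hw; simp only [Function.update_of_ne hz.2, Function.update_of_ne hw.2]; exact h2.hol z hz w hw
  · intro z hz; simp only [Function.update_of_ne hz.2]
    have := h3 z hz
    rwa [Function.update_of_ne hz.2] at this

lemma near_rpow (a b q : ℝ) (ha : 0 < a) (h1 : a / 2 ≤ b) (h2 : b ≤ 2 * a) : b ^ q ≤ 2 ^ |q| * a ^ q := by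
  rcases le_total 0 q with hq | hq
  · rw [abs_of_nonneg hq, ← Real.mul_rpow (by norm_num) ha.le]
    exact Real.rpow_le_rpow (by linarith) h2 hq
  · rw [abs_of_nonpos hq]
    calc b ^ q ≤ (a / 2) ^ q := Real.rpow_le_rpow_of_nonpos (by linarith) h1 hq
      _ = _ := by rw [Real.div_rpow ha.le (by norm_num), Real.rpow_neg (by norm_num)]; ring

lemma dd_near {z w : ℂ} (h : ‖z - w‖ ≤ dd z / 4) : dd z / 2 ≤ dd w ∧ dd w ≤ 2 * dd z := by
  have h1 := dd_sub z w
  have h2 := dd_sub w z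
  rw [norm_sub_rev] at h2
  have : 0 ≤ dd z := norm_nonneg _
  constructor <;> linarith

lemma dd_near_rpow {z w : ℂ} (hz : z ∈ Pd) (h : ‖z - w‖ ≤ dd z / 4) (q : ℝ) : dd w ^ q ≤ 2 ^ |q| * dd z ^ q :=
  near_rpow _ _ q (Pd_pos hz) (dd_near h).1 (dd_near h).2

section
variable {g p q M N : ℝ} {A : Set ℂ} {u v : ℂ → ℂ}

lemma dd_rpow_nonneg (z : ℂ) (p : ℝ) : 0 ≤ dd z ^ p := Real.rpow_nonneg (norm_nonneg _) _

lemma Cl.mono_set {B : Set ℂ} (h : Cl g A p M u) (hB : B ⊆ A) : Cl g B p M u :=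
  ⟨fun z hz => h.sup z (hB hz), fun z hz w hw => h.hol z (hB hz) w (hB hw)⟩

lemma Cl.mono_M (h : Cl g A p M u) (hMN : M ≤ N) : Cl g A p N u := by
  refine ⟨fun z hz => (h.sup z hz).trans ?_, fun z hz w hw hn => (h.hol z hz w hw hn).trans ?_⟩
  · have := dd_rpow_nonneg z p; gcongr
  · have := dd_rpow_nonneg z (p - g); gcongr

lemma Cl.congr (h : Cl g A p M u) (he : ∀ z ∈ A, u z = v z) : Cl g A p M v := by
  refine ⟨fun z hz => ?_, fun z hz w hw hn => ?_⟩
  · rw [← he z hz]; exact h.sup z hz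
  · rw [← he z hz, ← he w hw]; exact h.hol z hz w hw hn

lemma Cl.of_le (h : Cl g A p M u) (h1 : ∀ z ∈ A, ‖v z‖ ≤ ‖u z‖) (h2 : ∀ z ∈ A, ∀ w ∈ A, ‖v z - v w‖ ≤ ‖u z - u w‖) :
    Cl g A p M v :=
  ⟨fun z hz => (h1 z hz).trans (h.sup z hz), fun z hz w hw hn => (h2 z hz w hw).trans (h.hol z hz w hw hn)⟩

lemma Cl.conj (h : Cl g A p M u) : Cl g A p M (fun z => conj (u z)) :=
  h.of_le (fun z _ => by simp) (fun z _ w _ => by rw [← map_sub, Complex.norm_conj])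

lemma Cl.neg (h : Cl g A p M u) : Cl g A p M (fun z => - u z) :=
  h.of_le (fun z _ => by simp) (fun z _ w _ => by rw [← norm_neg]; apply le_of_eq; congr 1; ring)

lemma Cl.re (h : Cl g A p M u) : Cl g A p M (fun z => ((u z).re : ℂ)) :=
  h.of_le (fun z _ => by rw [Complex.norm_real]; exact Complex.abs_re_le_norm _)
    (fun z _ w _ => by rw [← Complex.ofReal_sub, Complex.norm_real, ← Complex.sub_re]; exact Complex.abs_re_le_norm _)

lemma Cl.add (h : Cl g A p M u) (h' : Cl g A p N v) : Cl g A p (M + N) (fun z => u z + v z) := by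
  refine ⟨fun z hz => ?_, fun z hz w hw hn => ?_⟩
  · refine (norm_add_le _ _).trans ?_
    rw [add_mul]; exact add_le_add (h.sup z hz) (h'.sup z hz)
  · rw [show u z + v z - (u w + v w) = (u z - u w) + (v z - v w) by ring, add_mul, add_mul]
    exact (norm_add_le _ _).trans (add_le_add (h.hol z hz w hw hn) (h'.hol z hz w hw hn))

lemma Cl.sub (h : Cl g A p M u) (h' : Cl g A p N v) : Cl g A p (M + N) (fun z => u z - v z) := by
  have := h.add h'.neg
  simpa only [sub_eq_add_neg] using this

lemma Cl.const_mul (c : ℂ) (h : Cl g A p M u) : Cl g A p (‖c‖ * M) (fun z => c * u z) := by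
  refine ⟨fun z hz => ?_, fun z hz w hw hn => ?_⟩
  · rw [norm_mul, mul_assoc]; gcongr; exact h.sup z hz
  · rw [← mul_sub, norm_mul, mul_assoc, mul_assoc]; gcongr; rw [← mul_assoc]; exact h.hol z hz w hw hn

lemma Cl.lower (hA : A ⊆ Pd) (hM : 0 ≤ M) (h : Cl g A p M u) (hqp : q ≤ p) : Cl g A q (2 ^ (p - q) * M) u := by
  have key : ∀ z ∈ A, ∀ a b : ℝ, a - b = p - q → dd z ^ a ≤ 2 ^ (p - q) * dd z ^ b := by
    intro z hz a b hab
    have hd := Pd_pos (hA hz)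
    calc dd z ^ a = dd z ^ (p - q) * dd z ^ b := by rw [← Real.rpow_add hd]; congr 1; linarith
      _ ≤ _ := by
        gcongr
        exact dd_le_two (hA hz).1
  refine ⟨fun z hz => (h.sup z hz).trans ?_, fun z hz w hw hn => (h.hol z hz w hw hn).trans ?_⟩
  · calc M * dd z ^ p ≤ M * (2 ^ (p - q) * dd z ^ q) := by gcongr; exact key z hz _ _ rfl
      _ = _ := by ring
  · calc M * dd z ^ (p - g) * ‖z - w‖ ^ g ≤ M * (2 ^ (p - q) * dd z ^ (q - g)) * ‖z - w‖ ^ g := by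
          gcongr; exact key z hz _ _ (by ring)
      _ = _ := by ring

lemma Cl.mul (hA : A ⊆ Pd) (hM : 0 ≤ M) (h : Cl g A p M u) (h' : Cl g A q N v) :
    Cl g A (p + q) ((1 + 2 ^ |q|) * M * N) (fun z => u z * v z) := by
  refine ⟨fun z hz => ?_, fun z hz w hw hn => ?_⟩
  · have hd := Pd_pos (hA hz)
    have hN : 0 ≤ N * dd z ^ q := (norm_nonneg _).trans (h'.sup z hz)
    rw [norm_mul]
    have h2 : (0:ℝ) ≤ 2 ^ |q| := by positivity
    calc _ ≤ (M * dd z ^ p) * (N * dd z ^ q) := by gcongr; exact h.sup z hz; exact h'.sup z hz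
      _ ≤ (1 + 2 ^ |q|) * ((M * dd z ^ p) * (N * dd z ^ q)) := by
          apply le_mul_of_one_le_left (by positivity); linarith
      _ = _ := by rw [Real.rpow_add hd]; ring
  · have hd := Pd_pos (hA hz)
    have hN : 0 ≤ N := by
      have := (norm_nonneg _).trans (h'.sup z hz)
      exact nonneg_of_mul_nonneg_left this (by positivity)
    rw [show u z * v z - u w * v w = u z * (v z - v w) + (u z - u w) * v w by ring]
    refine (norm_add_le _ _).trans ?_
    rw [norm_mul, norm_mul]
    have h1 := h.sup z hz
    have h2 := h'.hol z hz w hw hn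
    have h3 := h.hol z hz w hw hn
    have h4 : ‖v w‖ ≤ N * (2 ^ |q| * dd z ^ q) := (h'.sup w hw).trans (by gcongr; exact dd_near_rpow (hA hz) hn q)
    calc _ ≤ (M * dd z ^ p) * (N * dd z ^ (q - g) * ‖z - w‖ ^ g) + (M * dd z ^ (p - g) * ‖z - w‖ ^ g) * (N * (2 ^ |q| * dd z ^ q)) := by
          gcongr
      _ = M * N * (dd z ^ p * dd z ^ (q - g)) * ‖z - w‖ ^ g + 2 ^ |q| * (M * N * (dd z ^ (p - g) * dd z ^ q) * ‖z - w‖ ^ g) := by ring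
      _ = _ := by
          rw [← Real.rpow_add hd, ← Real.rpow_add hd, show p + (q - g) = p + q - g by ring, show p - g + q = p + q - g by ring]
          ring

lemma lin_to_hol {d x e g : ℝ} (hd : 0 < d) (hx : 0 ≤ x) (hxd : x ≤ d / 4) (hg0 : 0 < g) (hg : g ≤ 1) : d ^ (e - 1) * x ≤ d ^ (e - g) * x ^ g := by
  rcases hx.eq_or_lt with rfl | hx
  · rw [mul_zero]; positivity
  · calc d ^ (e - 1) * x = d ^ (e - 1) * (x ^ (1 - g) * x ^ g) := by
          rw [← Real.rpow_add hx]; simp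
      _ ≤ d ^ (e - 1) * (d ^ (1 - g) * x ^ g) := by
          gcongr
          linarith
      _ = _ := by rw [← mul_assoc, ← Real.rpow_add hd]; congr 2; ring

lemma Cl.of_deriv (hg0 : 0 < g) (hg : g ≤ 1) (hM : 0 ≤ M) (hN : 0 ≤ N) (u' : ℂ → ℂ) (hu : ∀ z ∈ Pd, HasDerivAt u (u' z) z)
    (h1 : ∀ z ∈ Pd, ‖u z‖ ≤ M * dd z ^ p) (h2 : ∀ z ∈ Pd, ‖u' z‖ ≤ N * dd z ^ (p - 1)) :
    Cl g Pd p (M + 2 ^ |p - 1| * N) u := by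
  have h2' : (0:ℝ) ≤ 2 ^ |p - 1| := by positivity
  refine ⟨fun z hz => (h1 z hz).trans ?_, fun z hz w hw hn => ?_⟩
  · have := dd_rpow_nonneg z p
    gcongr
    exact le_add_of_nonneg_right (by positivity)
  · have hd := Pd_pos hz
    have hseg : ∀ x ∈ segment ℝ w z, x ∈ Pd ∧ ‖z - x‖ ≤ dd z / 4 := by
      intro x hx
      have e1 : ‖x‖ ≤ 1 := by
        have := (convex_closedBall (0:ℂ) 1).segment_subset (by simpa using hw.1) (by simpa using hz.1) hx
        simpa using this
      have e2 : ‖z - x‖ ≤ dd z / 4 := by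
        have := (convex_closedBall z (dd z / 4)).segment_subset (by rw [mem_closedBall_iff_norm, norm_sub_rev]; exact hn) (by simp; positivity) hx
        rw [mem_closedBall_iff_norm, norm_sub_rev] at this; exact this
      refine ⟨⟨e1, ?_⟩, e2⟩
      rintro rfl
      have : ‖z - (-1)‖ = dd z := by unfold dd; congr 1; ring
      linarith
    have := (convex_segment (𝕜 := ℝ) w z).norm_image_sub_le_of_norm_hasDerivWithin_le (f := u) (f' := u') (C := N * (2 ^ |p - 1| * dd z ^ (p - 1)))
      (fun x hx => (hu x (hseg x hx).1).hasDerivWithinAt)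
      (fun x hx => (h2 x (hseg x hx).1).trans (by gcongr; exact dd_near_rpow hz (hseg x hx).2 _))
      (left_mem_segment ℝ w z) (right_mem_segment ℝ w z)
    refine this.trans ?_
    have h3 := lin_to_hol (e := p) hd (norm_nonneg (z - w)) hn hg0 hg
    calc _ = 2 ^ |p - 1| * N * (dd z ^ (p - 1) * ‖z - w‖) := by ring
      _ ≤ 2 ^ |p - 1| * N * (dd z ^ (p - g) * ‖z - w‖ ^ g) := by gcongr
      _ ≤ (M + 2 ^ |p - 1| * N) * (dd z ^ (p - g) * ‖z - w‖ ^ g) := by gcongr; linarith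
      _ = _ := by ring

lemma Cl_dd (hg0 : 0 < g) (hg : g ≤ 1) (q : ℝ) : Cl g Pd q (1 + |q| * 2 ^ |q - 1|) (fun z => ((dd z ^ q : ℝ) : ℂ)) := by
  have h2 : 0 ≤ |q| * 2 ^ |q - 1| := by positivity
  refine ⟨fun z hz => ?_, fun z hz w hw hn => ?_⟩
  · have := dd_rpow_nonneg z q
    rw [Complex.norm_of_nonneg this]; nlinarith
  · have hd := Pd_pos hz
    rw [← Complex.ofReal_sub, Complex.norm_real]
    have hnear := dd_near hn
    have := (convex_Icc (dd z / 2) (2 * dd z)).norm_image_sub_le_of_norm_hasDerivWithin_le (f := fun x : ℝ => x ^ q) (f' := fun x => q * x ^ (q - 1))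
      (C := |q| * (2 ^ |q - 1| * dd z ^ (q - 1)))
      (fun x hx => (Real.hasDerivAt_rpow_const (Or.inl (by have := hx.1; linarith))).hasDerivWithinAt)
      (fun x hx => by
        have hx0 : 0 < x := by have := hx.1; linarith
        rw [norm_mul, Real.norm_eq_abs, Real.norm_of_nonneg (Real.rpow_nonneg hx0.le _)]
        gcongr; exact near_rpow _ _ _ hd hx.1 hx.2)
      (show dd w ∈ _ from hnear) (show dd z ∈ Set.Icc (dd z / 2) (2 * dd z) from ⟨by linarith, by linarith⟩)
    refine this.trans ?_
    have h5 : ‖dd z - dd w‖ ≤ ‖z - w‖ := by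
      rw [Real.norm_eq_abs, abs_le]
      have h6 := dd_sub z w
      have h7 := dd_sub w z
      rw [norm_sub_rev] at h7
      constructor <;> linarith
    have h3 := lin_to_hol (e := q) hd (norm_nonneg (z - w)) hn hg0 hg
    calc _ ≤ |q| * (2 ^ |q - 1| * dd z ^ (q - 1)) * ‖z - w‖ := by gcongr
      _ = |q| * 2 ^ |q - 1| * (dd z ^ (q - 1) * ‖z - w‖) := by ring
      _ ≤ |q| * 2 ^ |q - 1| * (dd z ^ (q - g) * ‖z - w‖ ^ g) := by gcongr
      _ ≤ (1 + |q| * 2 ^ |q - 1|) * (dd z ^ (q - g) * ‖z - w‖ ^ g) := by gcongr; linarith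
      _ = _ := by ring

lemma Cl.lim (U : ℕ → ℂ → ℂ) (hU : ∀ n, Cl g A p M (U n)) (hl : ∀ z ∈ A, Filter.Tendsto (fun n => U n z) Filter.atTop (nhds (u z))) :
    Cl g A p M u := by
  refine ⟨fun z hz => ?_, fun z hz w hw hn => ?_⟩
  · exact le_of_tendsto (hl z hz).norm (Filter.Eventually.of_forall fun n => (hU n).sup z hz)
  · exact le_of_tendsto ((hl z hz).sub (hl w hw)).norm (Filter.Eventually.of_forall fun n => (hU n).hol z hz w hw hn)

/-- uniqueness for the Schwarz problem -/
lemma sch_unique (hg : 0 < g) (hp : 0 < p) (h : Cl g Pd p M u) (h0 : u (-1) = 0) (hd : DifferentiableOn ℂ u (Metric.ball 0 1))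
    (him : ∀ z ∈ Sc, (u z).im = 0) : ∀ z ∈ Pd, u z = 0 := by
  have hc := h.cont subset_rfl hg hp h0
  have hcl : Metric.closedBall (0:ℂ) 1 ⊆ insert (-1) Pd := by
    intro z hz
    by_cases h : z = -1
    · exact Or.inl h
    · exact Or.inr ⟨by simpa using hz, h⟩
  have := const_of_im_zero u (hc.mono hcl) hd (by
    intro z hz
    by_cases h : z = -1
    · rw [h, h0]; simp
    · exact him z ⟨hz, h⟩)
  intro z hz
  rw [this z hz.1, ← this (-1) (by simp), h0]
end

lemma jetstep (F : ℂ → ℂ) (r C : ℝ) (n k : ℕ) (hC : 0 ≤ C) (h0 : iteratedFDeriv ℝ n F 0 = 0)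
    (hd : ∀ x, ‖x‖ < r → DifferentiableAt ℝ (iteratedFDeriv ℝ n F) x)
    (hb : ∀ x, ‖x‖ < r → ‖iteratedFDeriv ℝ (n + 1) F x‖ ≤ C * ‖x‖ ^ k) :
    ∀ x, ‖x‖ < r → ‖iteratedFDeriv ℝ n F x‖ ≤ C * ‖x‖ ^ (k + 1) := by
  intro x hx
  have hin : ∀ y ∈ Metric.closedBall (0:ℂ) ‖x‖, ‖y‖ ≤ ‖x‖ := fun y hy => by simpa using hy
  have := (convex_closedBall (0:ℂ) ‖x‖).norm_image_sub_le_of_norm_fderiv_le (𝕜 := ℝ) (f := iteratedFDeriv ℝ n F) (C := C * ‖x‖ ^ k)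
    (fun y hy => hd y ((hin y hy).trans_lt hx))
    (fun y hy => by
      rw [norm_fderiv_iteratedFDeriv]
      refine (hb y ((hin y hy).trans_lt hx)).trans ?_
      have := hin y hy
      gcongr)
    (show (0:ℂ) ∈ _ by simp) (show x ∈ _ by simp)
  rw [h0, sub_zero, sub_zero] at this
  rw [pow_succ, ← mul_assoc]; exact this

lemma jet (U : Set ℂ) (hU : IsOpen U) (h0U : (0 : ℂ) ∈ U) (F : ℂ → ℂ)
    (hF : ContDiffOn ℝ (⊤ : ℕ∞) F U)
    (hders : ∀ k : ℕ, k ≤ 3 → iteratedFDerivWithin ℝ k F U 0 = 0) :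
    ∃ r C : ℝ, 0 < r ∧ 0 < C ∧ Metric.ball 0 r ⊆ U ∧ (∀ x, ‖x‖ < r → DifferentiableAt ℝ F x) ∧
      (∀ x, ‖x‖ < r → ‖F x‖ ≤ C * ‖x‖ ^ 4) ∧ (∀ x, ‖x‖ < r → ‖fderiv ℝ F x‖ ≤ C * ‖x‖ ^ 3) ∧
      (∀ x y m, m < r → ‖x‖ ≤ m → ‖y‖ ≤ m → ‖fderiv ℝ F x - fderiv ℝ F y‖ ≤ C * m ^ 2 * ‖x - y‖) := by
  obtain ⟨r1, hr1, hb1⟩ := Metric.isOpen_iff.1 hU 0 h0U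
  have hcd : ∀ x, ‖x‖ < r1 → ContDiffAt ℝ (⊤ : ℕ∞) F x := fun x hx =>
    hF.contDiffAt (hU.mem_nhds (hb1 (by simpa using hx)))
  have hdi : ∀ n : ℕ, ∀ x, ‖x‖ < r1 → DifferentiableAt ℝ (iteratedFDeriv ℝ n F) x := fun n x hx =>
    (hcd x hx).differentiableAt_iteratedFDeriv (by exact_mod_cast WithTop.coe_lt_top n)
  have hz : ∀ k : ℕ, k ≤ 3 → iteratedFDeriv ℝ k F 0 = 0 := by
    intro k hk
    rw [← iteratedFDerivWithin_of_isOpen k hU h0U]; exact hders k hk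
  obtain ⟨r2, hr2, hb2⟩ := Metric.continuousAt_iff.1 (hdi 4 0 (by simpa using hr1)).continuousAt 1 one_pos
  set C := ‖iteratedFDeriv ℝ 4 F 0‖ + 1 with hC
  have hC0 : 0 < C := by positivity
  have h4 : ∀ x, ‖x‖ < min r1 r2 → ‖iteratedFDeriv ℝ (3 + 1) F x‖ ≤ C * ‖x‖ ^ 0 := by
    intro x hx
    have := hb2 (x := x) (by rw [dist_zero_right]; exact hx.trans_le (min_le_right _ _))
    rw [dist_eq_norm] at this
    have h2 := norm_sub_norm_le (iteratedFDeriv ℝ 4 F x) (iteratedFDeriv ℝ 4 F 0)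
    rw [pow_zero, mul_one]
    change ‖iteratedFDeriv ℝ 4 F x‖ ≤ _
    linarith
  have hdm : ∀ n : ℕ, ∀ x, ‖x‖ < min r1 r2 → DifferentiableAt ℝ (iteratedFDeriv ℝ n F) x := fun n x hx =>
    hdi n x (hx.trans_le (min_le_left _ _))
  have h3 := jetstep F _ C 3 0 hC0.le (hz 3 (by norm_num)) (hdm 3) h4
  have h2 := jetstep F _ C 2 1 hC0.le (hz 2 (by norm_num)) (hdm 2) h3
  have h1 := jetstep F _ C 1 2 hC0.le (hz 1 (by norm_num)) (hdm 1) h2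
  have h0 := jetstep F _ C 0 3 hC0.le (hz 0 (by norm_num)) (hdm 0) h1
  refine ⟨min r1 r2, C, lt_min hr1 hr2, hC0, (Metric.ball_subset_ball (min_le_left _ _)).trans hb1, ?_, ?_, ?_, ?_⟩
  · intro x hx; exact (hcd x (hx.trans_le (min_le_left _ _))).differentiableAt (by simp)
  · intro x hx; have := h0 x hx; rwa [norm_iteratedFDeriv_zero] at this
  · intro x hx; have := h1 x hx; rwa [norm_iteratedFDeriv_one] at this
  · intro x y m hm hx hy
    have hin : ∀ y ∈ Metric.closedBall (0:ℂ) m, ‖y‖ ≤ m := fun y hy => by simpa using hy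
    have := (convex_closedBall (0:ℂ) m).norm_image_sub_le_of_norm_fderiv_le (𝕜 := ℝ) (f := fderiv ℝ F) (C := C * m ^ 2)
      (fun v hv => ((hcd v (((hin v hv).trans_lt hm).trans_le (min_le_left _ _))).fderiv_right (m := 1) (n := ((⊤ : ℕ∞) : WithTop ℕ∞)) (by rw [one_add_one_eq_two]; exact WithTop.coe_le_coe.2 (le_top (a := (2:ℕ∞))))).differentiableAt (by simp))
      (fun v hv => by
        rw [← norm_iteratedFDeriv_one, norm_iteratedFDeriv_fderiv]
        refine (h2 v ((hin v hv).trans_lt hm)).trans ?_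
        have := hin v hv
        gcongr)
      (show y ∈ _ by simpa using hy) (show x ∈ _ by simpa using hx)
    exact this

lemma cbrt_facts (u : ℂ) (hu : ‖u‖ ≤ 1/2) : ((1+u)^(1/3:ℂ))^3 = 1 + u ∧ ‖(1+u)^(1/3:ℂ) - 1‖ ≤ ‖u‖ ∧ 1 + u ∈ slitPlane := by
  have hre : 0 < (1+u).re := by
    have := abs_le.1 ((Complex.abs_re_le_norm u).trans hu)
    simp; linarith [this.1]
  have hne : 1 + u ≠ 0 := by intro h; rw [h] at hre; simp at hre
  have h3 : ((1+u)^(1/3:ℂ))^3 = 1 + u := by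
    have := Complex.cpow_nat_inv_pow (1+u) (n := 3) (by norm_num)
    rw [one_div]; exact_mod_cast this
  refine ⟨h3, ?_, Or.inl hre⟩
  have harg := abs_lt.1 (Complex.abs_arg_lt_pi_div_two_iff.2 (Or.inl hre))
  have hpi := Real.pi_pos
  set w := (1+u)^(1/3:ℂ) with hw
  have hwe : w = Complex.exp (Complex.log (1+u) * (1/3:ℂ)) := by rw [hw, Complex.cpow_def_of_ne_zero hne]
  have i1 : (Complex.log (1+u) * (1/3:ℂ)).im = arg (1+u) / 3 := by
    rw [show (1/3:ℂ) = ((1/3:ℝ):ℂ) by push_cast; ring, Complex.im_mul_ofReal, Complex.log_im]; ring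
  have w1 : 0 ≤ w.re := by
    rw [hwe, Complex.exp_re, i1]
    exact mul_nonneg (Real.exp_pos _).le (Real.cos_nonneg_of_mem_Icc ⟨by linarith, by linarith⟩)
  have w2 : 0 ≤ (w^2).re := by
    rw [hwe, ← Complex.exp_nat_mul, Complex.exp_re]
    refine mul_nonneg (Real.exp_pos _).le (Real.cos_nonneg_of_mem_Icc ?_)
    rw [show ((2:ℕ):ℂ) = ((2:ℝ):ℂ) by norm_num, Complex.im_ofReal_mul, i1]
    constructor <;> linarith
  have hge : 1 ≤ ‖w^2 + w + 1‖ := by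
    refine le_trans ?_ (Complex.re_le_norm _)
    simp only [add_re, one_re]; linarith
  have : (w - 1) * (w^2 + w + 1) = u := by linear_combination h3
  calc ‖w - 1‖ ≤ ‖w-1‖ * ‖w^2+w+1‖ := le_mul_of_one_le_right (norm_nonneg _) hge
    _ = ‖u‖ := by rw [← norm_mul, this]

noncomputable def hL (t : ℝ) : ℂ →L[ℝ] ℂ := ContinuousLinearMap.id ℝ ℂ + t • (Complex.conjCLE : ℂ →L[ℝ] ℂ)

lemma hL_apply (t : ℝ) (x : ℂ) : hL t x = x + t * conj x := by simp [hL]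

lemma hL_le (t : ℝ) (h0 : 0 < t) (h1 : t < 1) (x : ℂ) : ‖hL t x‖ ≤ 2 * ‖x‖ := by
  rw [hL_apply]
  refine (norm_add_le _ _).trans ?_
  rw [norm_mul, Complex.norm_real, Real.norm_of_nonneg h0.le, RCLike.norm_conj]
  nlinarith [norm_nonneg x]

lemma hL_ge (t : ℝ) (h0 : 0 < t) (x : ℂ) : (1-t) * ‖x‖ ≤ ‖hL t x‖ := by
  rw [hL_apply]
  have := norm_sub_le (x + t * conj x) (t * conj x)
  rw [add_sub_cancel_right, norm_mul, Complex.norm_real, Real.norm_of_nonneg h0.le, RCLike.norm_conj] at this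
  linarith

lemma hL_norm (t : ℝ) (h0 : 0 < t) (h1 : t < 1) : ‖hL t‖ ≤ 2 :=
  ContinuousLinearMap.opNorm_le_bound _ (by norm_num) (hL_le t h0 h1)

lemma Rexists (t : ℝ) (h0 : 0 < t) (h1 : t < 1) (F : ℂ → ℂ) (r C : ℝ) (hr : 0 < r) (hC : 0 < C)
    (hd : ∀ x, ‖x‖ < r → DifferentiableAt ℝ F x)
    (hF0 : ∀ x, ‖x‖ < r → ‖F x‖ ≤ C * ‖x‖ ^ 4) (hF1 : ∀ x, ‖x‖ < r → ‖fderiv ℝ F x‖ ≤ C * ‖x‖ ^ 3)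
    (hF2 : ∀ x y m, m < r → ‖x‖ ≤ m → ‖y‖ ≤ m → ‖fderiv ℝ F x - fderiv ℝ F y‖ ≤ C * m ^ 2 * ‖x - y‖) :
    ∃ (r' C' : ℝ) (R : ℂ → ℂ) (D : ℂ → ℂ →L[ℝ] ℂ), 0 < r' ∧ r' ≤ r ∧ 0 < C' ∧ R 0 = 0 ∧ D 0 = 0 ∧
      (∀ x, ‖x‖ < r' → HasFDerivAt R (D x) x) ∧
      (∀ x, ‖x‖ < r' → (hL t x + R x)^3 = (hL t x)^3 + 3 * t * F x) ∧
      (∀ x y, ‖x‖ < r' → ‖y‖ < r' → ‖D x - D y‖ ≤ C' * ‖x - y‖) := by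
  set c := 1 - t with hc
  have hc0 : 0 < c := by rw [hc]; linarith
  set r' := min r (c^3 / (6 * C)) with hr'
  have hr'0 : 0 < r' := lt_min hr (by positivity)
  set R : ℂ → ℂ := fun x => hL t x * ((1 + 3 * t * F x / (hL t x)^3)^(1/3:ℂ) - 1) with hR
  have hh : ∀ x, c * ‖x‖ ≤ ‖hL t x‖ := hL_ge t h0
  have hne : ∀ x, x ≠ 0 → hL t x ≠ 0 := by
    intro x hx h
    have := hh x; rw [h, norm_zero] at this
    have := norm_pos_iff.2 hx
    nlinarith
  have hu : ∀ x, ‖x‖ < r' → x ≠ 0 → ‖3 * t * F x / (hL t x)^3‖ ≤ 3 * C / c^3 * ‖x‖ := by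
    intro x hx hx0
    have hp := norm_pos_iff.2 hx0
    rw [norm_div, norm_pow, norm_mul, norm_mul, Complex.norm_real, Real.norm_of_nonneg h0.le]
    have e1 : (c * ‖x‖)^3 ≤ ‖hL t x‖^3 := by gcongr; exact hh x
    have e2 := hF0 x (hx.trans_le (min_le_left _ _))
    rw [div_le_iff₀ (by have := norm_pos_iff.2 (hne x hx0); positivity)]
    calc ‖(3:ℂ)‖ * t * ‖F x‖ ≤ 3 * 1 * (C * ‖x‖^4) := by
          rw [show ‖(3:ℂ)‖ = 3 by norm_num]; gcongr
      _ = 3 * C / c^3 * ‖x‖ * (c * ‖x‖)^3 := by field_simp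
      _ ≤ _ := by gcongr
  have hu2 : ∀ x, ‖x‖ < r' → x ≠ 0 → ‖3 * t * F x / (hL t x)^3‖ ≤ 1/2 := by
    intro x hx hx0
    refine (hu x hx hx0).trans ?_
    have := (hx.trans_le (min_le_right _ _)).le
    calc 3 * C / c^3 * ‖x‖ ≤ 3 * C / c^3 * (c^3 / (6 * C)) := by gcongr
      _ = 1/2 := by field_simp; norm_num
  have hR0 : R 0 = 0 := by simp [hR]
  have hcube : ∀ x, ‖x‖ < r' → (hL t x + R x)^3 = (hL t x)^3 + 3 * t * F x := by
    intro x hx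
    by_cases hx0 : x = 0
    · have := hF0 x (hx.trans_le (min_le_left _ _))
      rw [hx0] at this ⊢
      have hF00 : F 0 = 0 := by simpa using this
      rw [hR0, hF00]; simp
    · have := (cbrt_facts _ (hu2 x hx hx0)).1
      have hn := hne x hx0
      rw [show hL t x + R x = hL t x * (1 + 3 * t * F x / (hL t x)^3)^(1/3:ℂ) by rw [hR]; ring, mul_pow, this]
      field_simp
  set A := 6 * C / c^3 with hA
  have hA0 : 0 < A := by positivity
  have hRle : ∀ x, ‖x‖ < r' → ‖R x‖ ≤ A * ‖x‖^2 := by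
    intro x hx
    by_cases hx0 : x = 0
    · rw [hx0, hR0]; simp
    · have := (cbrt_facts _ (hu2 x hx hx0)).2.1
      calc ‖R x‖ = ‖hL t x‖ * _ := norm_mul _ _
        _ ≤ (2 * ‖x‖) * (3 * C / c^3 * ‖x‖) := by gcongr; exact hL_le t h0 h1 x; exact this.trans (hu x hx hx0)
        _ = _ := by rw [hA]; ring
  have hRle' : ∀ x, ‖x‖ < r' → ‖R x‖ ≤ 1 * ‖x‖ := by
    intro x hx
    refine (hRle x hx).trans ?_
    have := (hx.trans_le (min_le_right _ _)).le
    have : A * ‖x‖ ≤ 1 := by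
      calc A * ‖x‖ ≤ A * (c^3 / (6 * C)) := by gcongr
        _ = 1 := by rw [hA]; field_simp
    nlinarith [norm_nonneg x]
  have hWge : ∀ x, ‖x‖ < r' → c / 2 * ‖x‖ ≤ ‖hL t x + R x‖ := by
    intro x hx
    by_cases hx0 : x = 0
    · rw [hx0]; simp
    have hn := hne x hx0
    have e := hu2 x hx hx0
    rw [norm_div, div_le_iff₀ (norm_pos_iff.2 (pow_ne_zero 3 hn))] at e
    have e3 : ‖hL t x‖^3 / 2 ≤ ‖hL t x + R x‖^3 := by
      rw [← norm_pow, ← norm_pow, hcube x hx]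
      have := norm_sub_le ((hL t x)^3 + 3 * t * F x) (3 * t * F x)
      rw [add_sub_cancel_right] at this
      rw [norm_pow] at e this ⊢
      linarith
    have e4 : ‖hL t x‖ / 2 ≤ ‖hL t x + R x‖ := by
      refine le_of_pow_le_pow_left₀ (n := 3) (by norm_num) (norm_nonneg _) (le_trans ?_ e3)
      have : 0 ≤ ‖hL t x‖^3 := by positivity
      rw [div_pow]; linarith
    have := hh x
    linarith
  have hRd : ∀ x, ‖x‖ < r' → x ≠ 0 → DifferentiableAt ℝ R x := by
    intro x hx hx0
    have hFd := hd x (hx.trans_le (min_le_left _ _))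
    have hLd : DifferentiableAt ℝ (fun x => hL t x) x := (hL t).differentiableAt
    have hsl := (cbrt_facts _ (hu2 x hx hx0)).2.2
    have q : DifferentiableAt ℝ (fun x => 1 + 3 * t * F x / (hL t x)^3) x :=
      ((hFd.const_mul _).mul ((hLd.pow 3).inv (pow_ne_zero 3 (hne x hx0)))).const_add 1
    have p : DifferentiableAt ℂ (fun v : ℂ => v^(1/3:ℂ)) (1 + 3 * t * F x / (hL t x)^3) :=
      DifferentiableAt.cpow_const differentiableAt_id hsl
    exact hLd.mul (((p.restrictScalars ℝ).comp x q).sub_const 1)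
  have hR0d : HasFDerivAt R (0 : ℂ →L[ℝ] ℂ) 0 := by
    rw [hasFDerivAt_iff_isLittleO_nhds_zero]
    simp only [zero_add, hR0, sub_zero, zero_apply]
    have hO : R =O[nhds 0] fun x => ‖x‖^2 := by
      refine Asymptotics.IsBigO.of_bound A ?_
      filter_upwards [Metric.ball_mem_nhds (0:ℂ) hr'0] with x hx
      rw [norm_pow, norm_norm]
      exact hRle x (by simpa using hx)
    exact hO.trans_isLittleO (Asymptotics.isLittleO_norm_pow_id (by norm_num))
  have hder : ∀ x, ‖x‖ < r' → HasFDerivAt R (fderiv ℝ R x) x := by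
    intro x hx
    by_cases hx0 : x = 0
    · rw [hx0]; exact hR0d.differentiableAt.hasFDerivAt
    · exact (hRd x hx hx0).hasFDerivAt
  set N : ℂ → ℂ →L[ℝ] ℂ := fun x => (t:ℂ) • fderiv ℝ F x - (R x * (2 * hL t x + R x)) • hL t with hN
  have heq : ∀ x, ‖x‖ < r' → (hL t x + R x)^2 • fderiv ℝ R x = N x := by
    intro x hx
    have hLd : HasFDerivAt (fun x => hL t x) (hL t) x := (hL t).hasFDerivAt
    have l := (hLd.add (hder x hx)).pow 3
    have r := (hLd.pow 3).add (((hd x (hx.trans_le (min_le_left _ _))).hasFDerivAt).const_mul (3 * (t:ℂ)))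
    have hev : (fun x => ((hL t x)^3 + 3 * t * F x : ℂ)) =ᶠ[nhds x] fun x => (hL t x + R x)^3 := by
      filter_upwards [Metric.isOpen_ball.mem_nhds (show x ∈ Metric.ball (0:ℂ) r' by simpa using hx)] with y hy
      exact (hcube y (by simpa using hy)).symm
    have key := l.unique (r.congr_of_eventuallyEq hev.symm)
    ext v
    have kv := congrArg (fun L : ℂ →L[ℝ] ℂ => L v) key
    simp [hN] at kv ⊢
    linear_combination (1/3:ℂ) * kv
  have hF1' : ∀ x, ‖x‖ < r' → ‖fderiv ℝ F x‖ ≤ C * ‖x‖^3 := fun x hx => hF1 x (hx.trans_le (min_le_left _ _))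
  have hD0 : fderiv ℝ R 0 = 0 := hR0d.fderiv
  have hh2 := hL_norm t h0 h1
  set B := (C + A * 10) / (c/2)^2 with hB
  have hB0 : 0 < B := by positivity
  have hDle : ∀ x, ‖x‖ < r' → ‖fderiv ℝ R x‖ ≤ B * ‖x‖ := by
    intro x hx
    by_cases hx0 : x = 0
    · rw [hx0, hD0]; simp
    have hp := norm_pos_iff.2 hx0
    have e := congrArg norm (heq x hx)
    rw [norm_smul, norm_pow] at e
    have e1 : ‖N x‖ ≤ C * ‖x‖^3 + (A * ‖x‖^2 * (2 * (2 * ‖x‖) + 1 * ‖x‖)) * 2 := by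
      refine (norm_sub_le _ _).trans ?_
      rw [norm_smul, norm_smul, Complex.norm_real, Real.norm_of_nonneg h0.le, norm_mul]
      have e2 : ‖2 * hL t x + R x‖ ≤ 2 * (2 * ‖x‖) + 1 * ‖x‖ := by
        refine (norm_add_le _ _).trans ?_
        rw [norm_mul, show ‖(2:ℂ)‖ = 2 by norm_num]
        have := hL_le t h0 h1 x
        have := hRle' x hx
        linarith
      have e3 := hRle x hx
      have e4 : t * ‖fderiv ℝ F x‖ ≤ 1 * (C * ‖x‖^3) := by gcongr; exact hF1' x hx
      have e5 : ‖R x‖ * ‖2 * hL t x + R x‖ * ‖hL t‖ ≤ (A * ‖x‖^2 * (2 * (2 * ‖x‖) + 1 * ‖x‖)) * 2 := by gcongr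
      linarith
    have e6 : (c / 2 * ‖x‖)^2 ≤ ‖hL t x + R x‖^2 := by gcongr; exact hWge x hx
    have e7 : (c / 2 * ‖x‖)^2 * ‖fderiv ℝ R x‖ ≤ (C + A * 10) * ‖x‖^3 := by
      refine (mul_le_mul_of_nonneg_right e6 (norm_nonneg _)).trans ?_
      rw [e]; refine e1.trans (le_of_eq ?_); ring
    rw [← mul_le_mul_iff_right₀ (show 0 < (c/2*‖x‖)^2 by positivity)]
    refine e7.trans (le_of_eq ?_)
    rw [hB]; field_simp
  have hRlip : ∀ x y, ‖x‖ < r' → ‖y‖ ≤ ‖x‖ → ‖R x - R y‖ ≤ B * ‖x‖ * ‖x - y‖ := by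
    intro x y hx hy
    exact (convex_closedBall (0:ℂ) ‖x‖).norm_image_sub_le_of_norm_hasFDerivWithin_le (𝕜 := ℝ)
      (f' := fun v => fderiv ℝ R v)
      (fun v hv => (hder v (lt_of_le_of_lt (by simpa using hv) hx)).hasFDerivWithinAt)
      (fun v hv => by
        have hv' : ‖v‖ ≤ ‖x‖ := by simpa using hv
        refine (hDle v (hv'.trans_lt hx)).trans ?_
        gcongr) (show y ∈ _ by simpa using hy) (show x ∈ _ by simp)
  set G := (C + (B * 5 + A * (4 + B * r')) * 2 + B * 6 * (2 + B * r')) / (c/2)^2 with hG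
  have hG0 : 0 < G := by positivity
  have hmain : ∀ x y, ‖x‖ < r' → ‖y‖ ≤ ‖x‖ → ‖fderiv ℝ R x - fderiv ℝ R y‖ ≤ G * ‖x - y‖ := by
    intro x y hx hy
    by_cases hx0 : x = 0
    · have : y = 0 := by rw [hx0, norm_zero] at hy; exact norm_le_zero_iff.1 hy
      rw [hx0, this]; simp
    have hp := norm_pos_iff.2 hx0
    have hy' := hy.trans_lt hx
    have id : (hL t x + R x)^2 • (fderiv ℝ R x - fderiv ℝ R y) = (N x - N y) -
        ((hL t x + R x)^2 - (hL t y + R y)^2) • fderiv ℝ R y := by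
      rw [smul_sub, sub_smul, heq x hx, heq y hy']; abel
    have hlip := hRlip x y hx hy
    have hRx := hRle' x hx
    have hRy := hRle' y hy'
    have hRx2 := hRle y hy'
    have hhx := hL_le t h0 h1 x
    have hhy := hL_le t h0 h1 y
    have hhd : ‖hL t x - hL t y‖ ≤ 2 * ‖x - y‖ := by rw [← map_sub]; exact hL_le t h0 h1 _
    have dW : ‖(hL t x + R x) - (hL t y + R y)‖ ≤ (2 + B * r') * ‖x - y‖ := by
      rw [show (hL t x + R x) - (hL t y + R y) = (hL t x - hL t y) + (R x - R y) by ring]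
      refine (norm_add_le _ _).trans ?_
      have : B * ‖x‖ * ‖x-y‖ ≤ B * r' * ‖x - y‖ := by gcongr
      linarith
    have n1 : ‖(hL t x + R x)^2 - (hL t y + R y)^2‖ ≤ ((2 + B * r') * ‖x - y‖) * (6 * ‖x‖) := by
      rw [show (hL t x + R x)^2 - (hL t y + R y)^2 = ((hL t x + R x) - (hL t y + R y)) * (hL t x + R x + (hL t y + R y)) by ring, norm_mul]
      gcongr
      refine (norm_add_le _ _).trans ?_
      have := norm_add_le (hL t x) (R x)
      have := norm_add_le (hL t y) (R y)
      linarith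
    have n2 : ‖R x * (2 * hL t x + R x) - R y * (2 * hL t y + R y)‖ ≤ (B * 5 + A * (4 + B * r')) * ‖x‖^2 * ‖x - y‖ := by
      rw [show R x * (2 * hL t x + R x) - R y * (2 * hL t y + R y) = (R x - R y) * (2 * hL t x + R x) + R y * (2 * (hL t x - hL t y) + (R x - R y)) by ring]
      refine (norm_add_le _ _).trans ?_
      rw [norm_mul, norm_mul]
      have a1 : ‖2 * hL t x + R x‖ ≤ 5 * ‖x‖ := by
        refine (norm_add_le _ _).trans ?_
        rw [norm_mul, show ‖(2:ℂ)‖ = 2 by norm_num]; linarith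
      have a2 : ‖2 * (hL t x - hL t y) + (R x - R y)‖ ≤ (4 + B * r') * ‖x - y‖ := by
        refine (norm_add_le _ _).trans ?_
        rw [norm_mul, show ‖(2:ℂ)‖ = 2 by norm_num]
        have : B * ‖x‖ * ‖x-y‖ ≤ B * r' * ‖x - y‖ := by gcongr
        linarith
      have a3 : ‖R y‖ ≤ A * ‖x‖^2 := hRx2.trans (by gcongr)
      calc _ ≤ (B * ‖x‖ * ‖x - y‖) * (5 * ‖x‖) + (A * ‖x‖^2) * ((4 + B * r') * ‖x - y‖) := by gcongr
        _ = _ := by ring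
    have n3 : ‖N x - N y‖ ≤ C * ‖x‖^2 * ‖x-y‖ + ((B * 5 + A * (4 + B * r')) * ‖x‖^2 * ‖x - y‖) * 2 := by
      have : N x - N y = (t:ℂ) • (fderiv ℝ F x - fderiv ℝ F y) - (R x * (2 * hL t x + R x) - R y * (2 * hL t y + R y)) • hL t := by
        rw [hN]; ext v; simp; ring
      rw [this]
      refine (norm_sub_le _ _).trans ?_
      rw [norm_smul, norm_smul, Complex.norm_real, Real.norm_of_nonneg h0.le]
      have b1 := hF2 x y ‖x‖ (hx.trans_le (min_le_left _ _)) le_rfl hy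
      have b2 : t * ‖fderiv ℝ F x - fderiv ℝ F y‖ ≤ 1 * (C * ‖x‖^2 * ‖x-y‖) := by gcongr
      have b3 : ‖R x * (2 * hL t x + R x) - R y * (2 * hL t y + R y)‖ * ‖hL t‖ ≤ ((B * 5 + A * (4 + B * r')) * ‖x‖^2 * ‖x - y‖) * 2 := by gcongr
      linarith
    have n4 : ‖fderiv ℝ R y‖ ≤ B * ‖x‖ := (hDle y hy').trans (by gcongr)
    have e6 : (c / 2 * ‖x‖)^2 ≤ ‖hL t x + R x‖^2 := by have := hWge x hx; gcongr
    have e := congrArg norm id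
    rw [norm_smul, norm_pow] at e
    rw [← mul_le_mul_iff_right₀ (show 0 < (c/2*‖x‖)^2 by positivity)]
    refine (mul_le_mul_of_nonneg_right e6 (norm_nonneg _)).trans ?_
    rw [e]
    refine (norm_sub_le _ _).trans ?_
    rw [norm_smul]
    calc _ ≤ (C * ‖x‖^2 * ‖x-y‖ + ((B * 5 + A * (4 + B * r')) * ‖x‖^2 * ‖x - y‖) * 2) + (((2 + B * r') * ‖x - y‖) * (6 * ‖x‖)) * (B * ‖x‖) := by gcongr
      _ = _ := by rw [hG]; field_simp
  refine ⟨r', G, R, fderiv ℝ R, hr'0, min_le_left _ _, hG0, hR0, hD0, hder, hcube, ?_⟩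
  intro x y hx hy
  rcases le_total ‖y‖ ‖x‖ with h | h
  · exact hmain x y hx h
  · rw [norm_sub_rev, norm_sub_rev x y]; exact hmain y x hy h

lemma fourpt (R : ℂ → ℂ) (D : ℂ → ℂ →L[ℝ] ℂ) (r C : ℝ) (hr : 0 < r) (hC : 0 < C) (h0 : D 0 = 0)
    (hd : ∀ x, ‖x‖ < r → HasFDerivAt R (D x) x)
    (hl : ∀ x y, ‖x‖ < r → ‖y‖ < r → ‖D x - D y‖ ≤ C * ‖x - y‖)
    (a b c d : ℂ) (m m' : ℝ) (hm : m < r) (ha : ‖a‖ ≤ m) (hb : ‖b‖ ≤ m) (hc : ‖c‖ ≤ m) (hd' : ‖d‖ ≤ m)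
    (hac : ‖a - c‖ ≤ m') (hbd : ‖b - d‖ ≤ m') :
    ‖(R a - R c) - (R b - R d)‖ ≤ C * m * ‖(a - c) - (b - d)‖ + C * m' * ‖c - d‖ := by
  have seg : ∀ (x y : ℂ) (M : ℝ), ‖x‖ ≤ M → ‖y‖ ≤ M → ∀ τ ∈ Set.Icc (0:ℝ) 1, ‖y + τ * (x - y)‖ ≤ M := by
    intro x y M hx hy τ hτ
    have e : y + τ * (x - y) = (τ:ℂ) * x + ((1 - τ : ℝ):ℂ) * y := by push_cast; ring
    rw [e]
    refine (norm_add_le _ _).trans ?_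
    rw [norm_mul, norm_mul, Complex.norm_real, Complex.norm_real, Real.norm_of_nonneg hτ.1, Real.norm_of_nonneg (by linarith [hτ.2])]
    have := mul_le_mul_of_nonneg_left hx hτ.1
    have := mul_le_mul_of_nonneg_left hy (show 0 ≤ 1 - τ by linarith [hτ.2])
    linarith
  have path : ∀ (x y : ℂ), ‖x‖ ≤ m → ‖y‖ ≤ m → ∀ τ ∈ Set.Icc (0:ℝ) 1,
      HasDerivAt (fun τ : ℝ => R (y + τ * (x - y))) (D (y + τ * (x - y)) (x - y)) τ := by
    intro x y hx hy τ hτ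
    have h1 : HasDerivAt (fun τ : ℝ => y + (τ:ℂ) * (x - y)) (x - y) τ := by
      have := ((Complex.ofRealCLM.hasDerivAt (x := τ)).mul_const (x - y)).const_add y
      simpa using this
    exact (hd _ ((seg x y m hx hy τ hτ).trans_lt hm)).comp_hasDerivAt τ h1
  have key := (convex_Icc (0:ℝ) 1).norm_image_sub_le_of_norm_hasDerivWithin_le
    (f := fun τ : ℝ => R (b + τ * (a - b)) - R (d + τ * (c - d)))
    (f' := fun τ => D (b + τ * (a - b)) (a - b) - D (d + τ * (c - d)) (c - d))
    (C := C * m * ‖(a - c) - (b - d)‖ + C * m' * ‖c - d‖)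
    (fun τ hτ => ((path a b ha hb τ hτ).sub (path c d hc hd' τ hτ)).hasDerivWithinAt) ?_
    (show (0:ℝ) ∈ Set.Icc 0 1 by simp) (show (1:ℝ) ∈ Set.Icc 0 1 by simp)
  · simp only [ofReal_one, one_mul, ofReal_zero, zero_mul, add_zero, add_sub_cancel, sub_zero, norm_one, mul_one] at key
    rwa [show (R a - R c) - (R b - R d) = R a - R c - (R b - R d) by ring]
  · intro τ hτ
    have hp := seg a b m ha hb τ hτ
    have hq := seg c d m hc hd' τ hτ
    have hpq := seg (a-c) (b-d) m' hac hbd τ hτ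
    set p := b + τ * (a - b)
    set q := d + τ * (c - d)
    have e1 : D p (a - b) - D q (c - d) = D p ((a - c) - (b - d)) + (D p - D q) (c - d) := by
      rw [show (a - c) - (b - d) = (a - b) - (c - d) by ring, map_sub (D p) (a - b), sub_apply]; ring
    rw [e1]
    refine (norm_add_le _ _).trans (add_le_add ?_ ?_)
    · refine ((D p).le_opNorm _).trans ?_
      gcongr
      have := hl p 0 (hp.trans_lt hm) (by simpa using hr)
      rw [h0, sub_zero, sub_zero] at this
      exact this.trans (by gcongr)
    · refine ((D p - D q).le_opNorm _).trans ?_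
      gcongr
      refine (hl p q (hp.trans_lt hm) (hq.trans_lt hm)).trans ?_
      gcongr
      have : p - q = (b - d) + τ * ((a - c) - (b - d)) := by simp only [p, q]; ring
      rw [this]; exact hpq

lemma R_comp (R : ℂ → ℂ) (D : ℂ → ℂ →L[ℝ] ℂ) (r C : ℝ) (hr : 0 < r) (hC : 0 < C) (h0 : D 0 = 0)
    (hd : ∀ x, ‖x‖ < r → HasFDerivAt R (D x) x)
    (hl : ∀ x y, ‖x‖ < r → ‖y‖ < r → ‖D x - D y‖ ≤ C * ‖x - y‖)
    {g κ m M : ℝ} {A : Set ℂ} (hA : A ⊆ Pd) (hκ : 0 < κ) (hκ1 : κ ≤ 1) (hm : 0 ≤ m) (hM : 0 ≤ M) (hmr : 4 * m < r)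
    (f f' : ℂ → ℂ) (hf : Cl g A κ m f) (hf' : Cl g A κ m f') (hff : Cl g A κ M (fun z => f z - f' z)) :
    Cl g A (κ + κ) (4 * C * m * M) (fun z => R (f z) - R (f' z)) := by
  have h2κ : (2:ℝ)^κ ≤ 2 := by
    calc (2:ℝ)^κ ≤ 2^(1:ℝ) := Real.rpow_le_rpow_of_exponent_le (by norm_num) hκ1
      _ = 2 := by simp
  have hdd2 : ∀ z ∈ A, dd z ^ κ ≤ 2 := fun z hz =>
    (Real.rpow_le_rpow (norm_nonneg _) (dd_le_two (hA hz).1) hκ.le).trans h2κ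
  have hdn : ∀ z, 0 ≤ dd z ^ κ := fun z => Real.rpow_nonneg (norm_nonneg _) _
  constructor
  · intro z hz
    have hs : (m * dd z ^ κ) < r := by nlinarith [hdd2 z hz]
    have := fourpt R D r C hr hC h0 hd hl (f z) 0 (f' z) 0 (m * dd z ^ κ) (M * dd z ^ κ) hs (hf.sup z hz) (by have := hdn z; simp; positivity)
      (hf'.sup z hz) (by have := hdn z; simp; positivity) (hff.sup z hz) (by have := hdn z; simp; positivity)
    have e1 := hff.sup z hz
    have e2 := hf'.sup z hz
    simp only [sub_self, sub_zero] at this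
    have hn := hdn z
    rw [Real.rpow_add (Pd_pos (hA hz))]
    calc _ ≤ _ := this
      _ ≤ C * (m * dd z ^ κ) * (M * dd z ^ κ) + C * (M * dd z ^ κ) * (m * dd z ^ κ) := by gcongr
      _ ≤ 4 * C * m * M * (dd z ^ κ * dd z ^ κ) := by
        have : 0 ≤ C * m * M * (dd z ^ κ * dd z ^ κ) := by positivity
        linarith
  · intro z hz w hw hzw
    have hn := hdn z
    have hnear : dd w ^ κ ≤ 2 * dd z ^ κ := by
      refine (dd_near_rpow (hA hz) hzw κ).trans ?_
      rw [abs_of_pos hκ]; gcongr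
    have hs : (m * (2 * dd z ^ κ)) < r := by nlinarith [hdd2 z hz]
    have up : ∀ (u : ℂ → ℂ) (L : ℝ), 0 ≤ L → Cl g A κ L u → ‖u z‖ ≤ L * (2 * dd z ^ κ) ∧ ‖u w‖ ≤ L * (2 * dd z ^ κ) := by
      intro u L hL hu
      refine ⟨(hu.sup z hz).trans ?_, (hu.sup w hw).trans ?_⟩
      · gcongr; linarith
      · gcongr
    have := fourpt R D r C hr hC h0 hd hl (f z) (f w) (f' z) (f' w) (m * (2 * dd z ^ κ)) (M * (2 * dd z ^ κ)) hs
      (up f m hm hf).1 (up f m hm hf).2 (up f' m hm hf').1 (up f' m hm hf').2 (up _ M hM hff).1 (up _ M hM hff).2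
    have e1 := hff.hol z hz w hw hzw
    have e2 := hf'.hol z hz w hw hzw
    rw [show κ + κ - g = κ + (κ - g) by ring, Real.rpow_add (Pd_pos (hA hz))]
    have hn2 : 0 ≤ dd z ^ (κ - g) := Real.rpow_nonneg (norm_nonneg _) _
    have hn3 : 0 ≤ ‖z - w‖ ^ g := Real.rpow_nonneg (norm_nonneg _) _
    calc _ ≤ _ := this
      _ ≤ C * (m * (2 * dd z ^ κ)) * (M * dd z ^ (κ - g) * ‖z - w‖^g) + C * (M * (2 * dd z ^ κ)) * (m * dd z ^ (κ - g) * ‖z - w‖^g) := by gcongr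
      _ = _ := by ring

lemma Cl.M_nonneg {g p M : ℝ} {u : ℂ → ℂ} (h : Cl g Sc p M u) : 0 ≤ M := by
  have := h.sup 1 ⟨by simp, by intro h; have := congrArg Complex.re h; norm_num at this⟩
  have h2 : dd 1 = 2 := by simp [dd]; norm_num
  rw [h2] at this
  have h3 : 0 < (2:ℝ)^p := Real.rpow_pos_of_pos (by norm_num) _
  by_contra hc
  push Not at hc
  have := (norm_nonneg _).trans this
  nlinarith

lemma schOp (g p : ℝ) (hp : 0 < p) (hpg : p ≤ g) (hg : g < 1) :
    ∃ (C : ℝ) (S : (ℂ → ℝ) → ℂ → ℂ), 0 < C ∧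
      (∀ u M, Cl g Sc p M (fun z => (u z : ℂ)) → DifferentiableOn ℂ (S u) (Metric.ball 0 1) ∧ Cl g Pd p (C * M) (S u) ∧ S u (-1) = 0 ∧
        ∀ z ∈ Sc, (S u z).im = u z) ∧
      (∀ u u' M M1 M2, Cl g Sc p M1 (fun z => (u z : ℂ)) → Cl g Sc p M2 (fun z => (u' z : ℂ)) → Cl g Sc p M (fun z => ((u z - u' z : ℝ) : ℂ)) →
        Cl g Pd p (C * M) (fun z => S u z - S u' z)) := by
  obtain ⟨C, hC, h⟩ := schwarz g p hp hpg hg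
  have hg0 : 0 < g := hp.trans_le hpg
  classical
  have hex : ∀ u : ℂ → ℝ, ∃ a : ℂ → ℂ, (∃ M, Cl g Sc p M (fun z => (u z : ℂ))) →
      DifferentiableOn ℂ a (Metric.ball 0 1) ∧ (∃ M, Cl g Pd p M a) ∧ a (-1) = 0 ∧ ∀ z ∈ Sc, (a z).im = u z := by
    intro u
    by_cases hu : ∃ M, Cl g Sc p M (fun z => (u z : ℂ))
    · obtain ⟨M, hM⟩ := hu
      obtain ⟨a, h1, h2, h3, h4⟩ := h M u hM.M_nonneg hM
      exact ⟨a, fun _ => ⟨h1, ⟨_, h2⟩, h3, h4⟩⟩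
    · exact ⟨0, fun hh => absurd hh hu⟩
  choose S hS using hex
  have hdiff : ∀ u u' M M1 M2, Cl g Sc p M1 (fun z => (u z : ℂ)) → Cl g Sc p M2 (fun z => (u' z : ℂ)) → Cl g Sc p M (fun z => ((u z - u' z : ℝ) : ℂ)) →
        Cl g Pd p (C * M) (fun z => S u z - S u' z) := by
    intro u u' M M1 M2 h1 h2 h3
    obtain ⟨a, a1, a2, a3, a4⟩ := h M (fun z => u z - u' z) h3.M_nonneg h3
    obtain ⟨b1, ⟨L, b2⟩, b3, b4⟩ := hS u ⟨_, h1⟩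
    obtain ⟨c1, ⟨L', c2⟩, c3, c4⟩ := hS u' ⟨_, h2⟩
    have := sch_unique hg0 hp ((a2.sub b2).add c2) (by simp [a3, b3, c3]) ((a1.sub b1).add c1) (by
      intro z hz
      simp [a4 z hz, b4 z hz, c4 z hz])
    exact a2.congr (fun z hz => by linear_combination this z hz)
  refine ⟨C, S, hC, ?_, hdiff⟩
  intro u M hu
  obtain ⟨b1, b2, b3, b4⟩ := hS u ⟨_, hu⟩
  refine ⟨b1, ?_, b3, b4⟩
  obtain ⟨a, a1, a2, a3, a4⟩ := h M u hu.M_nonneg hu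
  obtain ⟨L, b2⟩ := b2
  have := sch_unique hg0 hp (a2.sub b2) (by simp [a3, b3]) (a1.sub b1) (by
      intro z hz
      simp [a4 z hz, b4 z hz])
  exact a2.congr (fun z hz => by linear_combination this z hz)

structure Frames (t g δ C0 C' : ℝ) (χ f0 f1 K0 K1 : ℂ → ℂ) : Prop where
  ht : 0 < t
  hδ : 0 < δ
  hδ1 : δ ≤ 1/60
  hg : 2/3 + 19 * δ ≤ g
  hg1 : g < 1
  hC0 : 0 < C0
  hC' : 0 < C'
  cf0 : Cl g Pd (9 * δ) C0 f0
  cK0 : Cl g Pd (9 * δ) C0 K0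
  cf1 : Cl g Pd (-2/3 - 11 * δ) C0 f1
  cK1 : Cl g Pd (-2/3 - 11 * δ) C0 K1
  df0 : DifferentiableOn ℂ f0 (Metric.ball 0 1)
  df1 : DifferentiableOn ℂ f1 (Metric.ball 0 1)
  dK0 : DifferentiableOn ℂ K0 (Metric.ball 0 1)
  dK1 : DifferentiableOn ℂ K1 (Metric.ball 0 1)
  zf0 : f0 (-1) = 0
  zK0 : K0 (-1) = 0
  r0 : ∀ z ∈ Sc, f0 z + t * conj (f0 z) = χ z * K0 z
  r1 : ∀ z ∈ Sc, f1 z + t * conj (f1 z) = χ z * K1 z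
  wr : ∀ z ∈ Sc, (f0 z * conj (f1 z)).im = C' * dd z ^ (-2/3:ℝ)
  hχ : ∀ z ∈ Sc, χ z ^ 3 = z

section
variable {t g δ C0 C' : ℝ} {χ f0 f1 K0 K1 : ℂ → ℂ}

/-- combination `S u * e0 + S' v * e1` bound -/
lemma comb_bound (H : Frames t g δ C0 C' χ f0 f1 K0 K1) (e0 e1 a b : ℂ → ℂ) (ce0 : Cl g Pd (9 * δ) C0 e0)
    (ce1 : Cl g Pd (-2/3 - 11 * δ) C0 e1) {A B : ℝ} (hA : 0 ≤ A) (hB : 0 ≤ B) (ha : Cl g Pd (5 * δ) A a) (hb : Cl g Pd (2/3 + 19 * δ) B b) :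
    Cl g Pd (8 * δ) (4 * (8 * (A * C0)) + 8 * (B * C0)) (fun z => a z * e0 z + b z * e1 z) := by
  have h1 := (ha.mul subset_rfl hA ce0)
  have h2 := (hb.mul subset_rfl hB ce1)
  have hδ := H.hδ
  have hδ1 := H.hδ1
  have hC0 := H.hC0
  have p1 : ∀ x : ℝ, |x| ≤ 1 → (1 + (2:ℝ)^|x|) ≤ 8 := by
    intro x hx
    have := Real.rpow_le_rpow_of_exponent_le (show (1:ℝ) ≤ 2 by norm_num) hx
    rw [Real.rpow_one] at this; linarith
  have h1' := (h1.mono_M (N := 8 * (A * C0)) (by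
    rw [mul_assoc]; gcongr; apply p1; rw [abs_le]; constructor <;> linarith)).lower subset_rfl (by positivity) (show 8 * δ ≤ 5 * δ + 9 * δ by linarith)
  have h1'' := h1'.mono_M (N := 4 * (8 * (A * C0))) (by
    gcongr
    calc (2:ℝ) ^ _ ≤ 2^(2:ℝ) := Real.rpow_le_rpow_of_exponent_le (by norm_num) (by linarith)
      _ = 4 := by norm_num)
  rw [show 2/3 + 19 * δ + (-2/3 - 11 * δ) = 8 * δ by ring] at h2
  exact h1''.add (h2.mono_M (by rw [mul_assoc]; gcongr; apply p1; rw [abs_le]; constructor <;> linarith))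

lemma alg_id (t : ℝ) (ht : t ≠ 0) (f0 f1 ρ : ℂ) (w : ℝ) (hw : (f0 * conj f1).im = w) (hw0 : w ≠ 0) :
    2 * I * t * (((ρ * f1).re / (2 * t * w) : ℝ) * conj f0 + (-(ρ * f0).re / (2 * t * w) : ℝ) * conj f1) = ρ := by
  have ht' : (t:ℂ) ≠ 0 := by exact_mod_cast ht
  have hw' : (w:ℂ) ≠ 0 := by exact_mod_cast hw0
  have : I * ((ρ * f1).re * conj f0 - (ρ * f0).re * conj f1) = ρ * w := by
    rw [← hw]
    apply Complex.ext <;> simp <;> ring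
  push_cast
  field_simp
  linear_combination this

lemma Nop (H : Frames t g δ C0 C' χ f0 f1 K0 K1) : ∃ (CN : ℝ) (N K : (ℂ → ℂ) → ℂ → ℂ), 0 < CN ∧
    (∀ ρ M, Cl g Sc (16 * δ) M ρ → DifferentiableOn ℂ (N ρ) (Metric.ball 0 1) ∧ DifferentiableOn ℂ (K ρ) (Metric.ball 0 1) ∧
      N ρ (-1) = 0 ∧ K ρ (-1) = 0 ∧ Cl g Pd (8 * δ) (CN * M) (N ρ) ∧ Cl g Pd (8 * δ) (CN * M) (K ρ) ∧
      ∀ z ∈ Sc, N ρ z + t * conj (N ρ z) + ρ z = χ z * K ρ z) ∧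
    (∀ ρ ρ' M M1 M2, Cl g Sc (16 * δ) M1 ρ → Cl g Sc (16 * δ) M2 ρ' → Cl g Sc (16 * δ) M (fun z => ρ z - ρ' z) →
      Cl g Pd (8 * δ) (CN * M) (fun z => N ρ z - N ρ' z) ∧ Cl g Pd (8 * δ) (CN * M) (fun z => K ρ z - K ρ' z)) := by
  have hδ := H.hδ
  have hδ1 := H.hδ1
  have hC0 := H.hC0
  have hC' := H.hC'
  have ht := H.ht
  have hg := H.hg
  have hg0 : 0 < g := by linarith
  obtain ⟨Ca, Sa, hCa, sa, da⟩ := schOp g (5 * δ) (by positivity) (by linarith) H.hg1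
  obtain ⟨Cb, Sb, hCb, sb, db⟩ := schOp g (2/3 + 19 * δ) (by positivity) hg H.hg1
  set ua : (ℂ → ℂ) → ℂ → ℝ := fun ρ z => (ρ z * f1 z).re * (dd z ^ (2/3:ℝ)) * (1 / (2 * t * C')) with hua
  set ub : (ℂ → ℂ) → ℂ → ℝ := fun ρ z => (ρ z * f0 z).re * (dd z ^ (2/3:ℝ)) * (-1 / (2 * t * C')) with hub
  have cdd := (Cl_dd hg0 H.hg1.le (2/3)).mono_set Sc_sub
  obtain ⟨L1, hL1, e1⟩ : ∃ L, 0 ≤ L ∧ ∀ ρ M, Cl g Sc (16 * δ) M ρ → Cl g Sc (5 * δ) (L * M) (fun z => (ua ρ z : ℂ)) := by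
    refine ⟨‖(((1 / (2 * t * C') : ℝ)) : ℂ)‖ * ((1 + 2 ^ |(2/3:ℝ)|) * ((1 + 2 ^ |(-2/3 - 11 * δ)|) * C0) * (1 + |(2/3:ℝ)| * 2 ^ |(2/3:ℝ) - 1|)), by positivity, ?_⟩
    intro ρ M hρ
    have hM := hρ.M_nonneg
    have q := (((hρ.mul Sc_sub hM (H.cf1.mono_set Sc_sub)).re).mul Sc_sub (by positivity) cdd).const_mul ((1 / (2 * t * C') : ℝ) : ℂ)
    rw [show 16 * δ + (-2/3 - 11 * δ) + 2/3 = 5 * δ by ring] at q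
    refine (q.congr ?_).mono_M (le_of_eq (by ring))
    intro z _; simp only [hua]; push_cast; ring
  obtain ⟨L2, hL2, e2⟩ : ∃ L, 0 ≤ L ∧ ∀ ρ M, Cl g Sc (16 * δ) M ρ → Cl g Sc (2/3 + 19 * δ) (L * M) (fun z => (ub ρ z : ℂ)) := by
    refine ⟨2 ^ (16 * δ + 9 * δ + 2/3 - (2/3 + 19 * δ)) * (‖(((-1 / (2 * t * C') : ℝ)) : ℂ)‖ * ((1 + 2 ^ |(2/3:ℝ)|) * ((1 + 2 ^ |9 * δ|) * C0) * (1 + |(2/3:ℝ)| * 2 ^ |(2/3:ℝ) - 1|))), by positivity, ?_⟩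
    intro ρ M hρ
    have hM := hρ.M_nonneg
    have q := ((((hρ.mul Sc_sub hM (H.cf0.mono_set Sc_sub)).re).mul Sc_sub (by positivity) cdd).const_mul ((-1 / (2 * t * C') : ℝ) : ℂ)).lower Sc_sub (by positivity)
      (show 2/3 + 19 * δ ≤ 16 * δ + 9 * δ + 2/3 by linarith)
    refine (q.congr ?_).mono_M (le_of_eq (by ring))
    intro z _; simp only [hub]; push_cast; ring
  have CNpos : 0 < 4 * (8 * ((Ca * L1) * C0)) + 8 * ((Cb * L2) * C0) + 1 := by positivity
  set CN := 4 * (8 * ((Ca * L1) * C0)) + 8 * ((Cb * L2) * C0) + 1 with hCN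
  have hCNle : ∀ M : ℝ, 0 ≤ M → 4 * (8 * ((Ca * (L1 * M)) * C0)) + 8 * ((Cb * (L2 * M)) * C0) ≤ CN * M := by
    intro M hM; rw [hCN]; nlinarith
  refine ⟨CN, fun ρ z => Sa (ua ρ) z * f0 z + Sb (ub ρ) z * f1 z, fun ρ z => Sa (ua ρ) z * K0 z + Sb (ub ρ) z * K1 z, CNpos, ?_, ?_⟩
  · intro ρ M hρ
    have hM := hρ.M_nonneg
    obtain ⟨a1, a2, a3, a4⟩ := sa _ _ (e1 ρ M hρ)
    obtain ⟨b1, b2, b3, b4⟩ := sb _ _ (e2 ρ M hρ)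
    refine ⟨(a1.mul H.df0).add (b1.mul H.df1), (a1.mul H.dK0).add (b1.mul H.dK1), by simp [a3, b3], by simp [a3, b3], ?_, ?_, ?_⟩
    · exact (comb_bound H f0 f1 _ _ H.cf0 H.cf1 (by positivity) (by positivity) a2 b2).mono_M (hCNle M hM)
    · exact (comb_bound H K0 K1 _ _ H.cK0 H.cK1 (by positivity) (by positivity) a2 b2).mono_M (hCNle M hM)
    · intro z hz
      have hd := Pd_pos (Sc_sub hz)
      have hdr : 0 < dd z ^ (-2/3:ℝ) := Real.rpow_pos_of_pos hd _
      have key := alg_id t ht.ne' (f0 z) (f1 z) (ρ z) _ (H.wr z hz) (by positivity)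
      have hinv : dd z ^ (2/3:ℝ) = (dd z ^ (-2/3:ℝ))⁻¹ := by rw [← Real.rpow_neg hd.le]; norm_num
      have i1 : (ρ z * f1 z).re / (2 * t * (C' * dd z ^ (-2/3:ℝ))) = (Sa (ua ρ) z).im := by
        rw [a4 z hz]; simp only [hua]; rw [hinv]; field_simp
      have i2 : -(ρ z * f0 z).re / (2 * t * (C' * dd z ^ (-2/3:ℝ))) = (Sb (ub ρ) z).im := by
        rw [b4 z hz]; simp only [hub]; rw [hinv]; field_simp
      rw [i1, i2] at key
      have r0 := H.r0 z hz
      have r1 := H.r1 z hz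
      have ca : conj (Sa (ua ρ) z) = Sa (ua ρ) z - 2 * I * (Sa (ua ρ) z).im := by
        apply Complex.ext <;> simp; ring
      have cb : conj (Sb (ub ρ) z) = Sb (ub ρ) z - 2 * I * (Sb (ub ρ) z).im := by
        apply Complex.ext <;> simp; ring
      simp only [map_add, map_mul]
      rw [ca, cb]
      linear_combination (-1:ℂ) * key + Sa (ua ρ) z * r0 + Sb (ub ρ) z * r1
  · intro ρ ρ' M M1 M2 h1 h2 h3
    have hM := h3.M_nonneg
    have a := da (ua ρ) (ua ρ') _ _ _ (e1 ρ _ h1) (e1 ρ' _ h2) ((e1 _ _ h3).congr (fun z _ => by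
      congr 1; simp only [hua, sub_mul, sub_re]))
    have b := db (ub ρ) (ub ρ') _ _ _ (e2 ρ _ h1) (e2 ρ' _ h2) ((e2 _ _ h3).congr (fun z _ => by
      congr 1; simp only [hub, sub_mul, sub_re]))
    refine ⟨((comb_bound H f0 f1 _ _ H.cf0 H.cf1 (by positivity) (by positivity) a b).mono_M (hCNle M hM)).congr ?_,
      ((comb_bound H K0 K1 _ _ H.cK0 H.cK1 (by positivity) (by positivity) a b).mono_M (hCNle M hM)).congr ?_⟩ <;>
    · intro z _; ring
end

lemma Cl.zero {g p : ℝ} {A : Set ℂ} {M : ℝ} (hM : 0 ≤ M) : Cl g A p M (fun _ => 0) := by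
  constructor
  · intro z _; rw [norm_zero]; exact mul_nonneg hM (Real.rpow_nonneg (norm_nonneg _) _)
  · intro z _ w _ _; rw [sub_zero, norm_zero]
    exact mul_nonneg (mul_nonneg hM (Real.rpow_nonneg (norm_nonneg _) _)) (Real.rpow_nonneg (norm_nonneg _) _)

lemma family {t g δ C0 C' : ℝ} {χ f0 f1 K0 K1 : ℂ → ℂ} (H : Frames t g δ C0 C' χ f0 f1 K0 K1)
    (R : ℂ → ℂ) (D : ℂ → ℂ →L[ℝ] ℂ) (r C : ℝ) (hr : 0 < r) (hC : 0 < C) (hR0 : R 0 = 0) (h0 : D 0 = 0)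
    (hd : ∀ x, ‖x‖ < r → HasFDerivAt R (D x) x)
    (hl : ∀ x y, ‖x‖ < r → ‖y‖ < r → ‖D x - D y‖ ≤ C * ‖x - y‖) (η : ℝ) (hη : 0 < η) :
    ∃ (s0 L : ℝ) (f K : ℝ → ℂ → ℂ), 0 < s0 ∧ ∀ s, 0 < s → s < s0 →
      DifferentiableOn ℂ (f s) (Metric.ball 0 1) ∧ DifferentiableOn ℂ (K s) (Metric.ball 0 1) ∧ f s (-1) = 0 ∧ K s (-1) = 0 ∧
      Cl g Pd (8 * δ) η (f s) ∧ Cl g Pd (8 * δ) L (K s) ∧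
      (∀ z ∈ Sc, f s z + t * conj (f s z) + R (f s z) = χ z * K s z) ∧
      Cl g Pd (8 * δ) (η * s) (fun z => f s z - s * f0 z) ∧
      (∀ s', 0 < s' → s' < s0 → Cl g Pd (8 * δ) (η * |s - s'|) (fun z => (f s z - s * f0 z) - (f s' z - s' * f0 z)) ∧
        Cl g Pd (8 * δ) (L * |s - s'|) (fun z => K s z - K s' z)) := by
  obtain ⟨CN, N, KK, hCN, hN, hNd⟩ := Nop H
  have hδ := H.hδ
  have hδ1 := H.hδ1
  have hC0 := H.hC0
  set L := (2:ℝ)^(9 * δ - 8 * δ) * C0 with hL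
  have hL0 : 0 < L := by positivity
  have cf0 : Cl g Pd (8 * δ) L f0 := H.cf0.lower subset_rfl hC0.le (by linarith)
  have cK0 : Cl g Pd (8 * δ) L K0 := H.cK0.lower subset_rfl hC0.le (by linarith)
  obtain ⟨m, hm, m1, m2, m3, m4⟩ : ∃ m : ℝ, 0 < m ∧ 4 * m < r ∧ CN * (4 * C * m) ≤ 1/2 ∧ CN * (4 * C * m) * (2 * L) ≤ η ∧ m ≤ η := by
    refine ⟨min (min (r/8) η) (min (1/(8 * CN * C)) (η / (8 * CN * C * L))), by positivity, ?_, ?_, ?_, ?_⟩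
    · have := (min_le_left (min (r/8) η) (min (1/(8 * CN * C)) (η / (8 * CN * C * L)))).trans (min_le_left _ _)
      linarith
    · have := (min_le_right (min (r/8) η) (min (1/(8 * CN * C)) (η / (8 * CN * C * L)))).trans (min_le_left _ _)
      calc _ ≤ CN * (4 * C * (1/(8 * CN * C))) := by gcongr
        _ = 1/2 := by field_simp; norm_num
    · have := (min_le_right (min (r/8) η) (min (1/(8 * CN * C)) (η / (8 * CN * C * L)))).trans (min_le_right _ _)
      calc _ ≤ CN * (4 * C * (η / (8 * CN * C * L))) * (2 * L) := by gcongr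
        _ = η := by field_simp; norm_num
    · exact (min_le_left _ _).trans (min_le_right _ _)
  have Rc : ∀ f f' M, 0 ≤ M → Cl g Pd (8 * δ) m f → Cl g Pd (8 * δ) m f' → Cl g Pd (8 * δ) M (fun z => f z - f' z) →
      Cl g Sc (16 * δ) (4 * C * m * M) (fun z => R (f z) - R (f' z)) := by
    intro f f' M hM hf hf' hff
    have := R_comp R D r C hr hC h0 hd hl Sc_sub (show 0 < 8 * δ by linarith) (by linarith) hm.le hM m1 f f' (hf.mono_set Sc_sub) (hf'.mono_set Sc_sub) (hff.mono_set Sc_sub)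
    rwa [show 8 * δ + 8 * δ = 16 * δ by ring] at this
  have Rc0 : ∀ f M, 0 ≤ M → M ≤ m → Cl g Pd (8 * δ) M f → Cl g Sc (16 * δ) (4 * C * m * M) (fun z => R (f z)) := by
    intro f M hM hMm hf
    have := Rc f (fun _ => 0) M hM (hf.mono_M hMm) (Cl.zero hm.le) (by simpa using hf)
    simpa [hR0] using this
  have Nc : ∀ f f' M, 0 ≤ M → Cl g Pd (8 * δ) m f → Cl g Pd (8 * δ) m f' → Cl g Pd (8 * δ) M (fun z => f z - f' z) →
      Cl g Pd (8 * δ) (CN * (4 * C * m) * M) (fun z => N (fun z => R (f z)) z - N (fun z => R (f' z)) z) ∧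
      Cl g Pd (8 * δ) (CN * (4 * C * m) * M) (fun z => KK (fun z => R (f z)) z - KK (fun z => R (f' z)) z) := by
    intro f f' M hM hf hf' hff
    have := hNd _ _ _ _ _ (Rc0 f m hm.le le_rfl hf) (Rc0 f' m hm.le le_rfl hf') (Rc f f' M hM hf hf' hff)
    rwa [mul_assoc CN]
  set q : ℝ → ℕ → ℂ → ℂ := fun s n => Nat.rec (fun _ => 0) (fun _ f => fun z => s * f0 z + N (fun z => R (f z)) z) n with hq
  have q0 : ∀ s, q s 0 = fun _ => 0 := fun s => rfl
  have q1 : ∀ s n, q s (n+1) = fun z => s * f0 z + N (fun z => R (q s n z)) z := fun s n => rfl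
  set s0 := m / (2 * L) with hs0
  have hs00 : 0 < s0 := by positivity
  have sL : ∀ s, 0 < s → s < s0 → s * L ≤ m / 2 := by
    intro s _ h
    rw [hs0, lt_div_iff₀ (by positivity)] at h; linarith
  have csf0 : ∀ s : ℝ, Cl g Pd (8 * δ) (|s| * L) (fun z => s * f0 z) := by
    intro s; simpa using cf0.const_mul (s:ℂ)
  have csK0 : ∀ s : ℝ, Cl g Pd (8 * δ) (|s| * L) (fun z => s * K0 z) := by
    intro s; simpa using cK0.const_mul (s:ℂ)
  have qb' : ∀ s, 0 < s → s < s0 → ∀ n, Cl g Pd (8 * δ) (2 * (s * L)) (q s n) := by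
    intro s hs hss n
    have hsl := sL s hs hss
    have hsL0 : 0 < s * L := by positivity
    induction n with
    | zero => rw [q0]; exact Cl.zero (by positivity)
    | succ n ih =>
      rw [q1]
      have h1 := (hN _ _ (Rc0 _ _ (by positivity) (by linarith) ih)).2.2.2.2.1
      refine ((csf0 s).add h1).mono_M ?_
      rw [abs_of_pos hs]
      have : CN * (4 * C * m * (2 * (s * L))) = CN * (4 * C * m) * (2 * (s * L)) := by ring
      rw [this]; nlinarith
  have qb : ∀ s, 0 < s → s < s0 → ∀ n, Cl g Pd (8 * δ) m (q s n) := fun s hs hss n =>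
    (qb' s hs hss n).mono_M (by linarith [sL s hs hss])
  have qd : ∀ s, 0 < s → s < s0 → ∀ n, Cl g Pd (8 * δ) (m * (1/2)^n) (fun z => q s (n+1) z - q s n z) := by
    intro s hs hss n
    induction n with
    | zero => simpa [q0] using qb s hs hss 1
    | succ n ih =>
      have h1 := (Nc _ _ _ (by positivity) (qb s hs hss (n+1)) (qb s hs hss n) ih).1
      refine (h1.congr ?_).mono_M ?_
      · intro z _; rw [q1 s (n+1), q1 s n]; ring
      · have : 0 ≤ m * (1/2)^n := by positivity
        rw [pow_succ]; nlinarith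
  have qs : ∀ s s', 0 < s → s < s0 → 0 < s' → s' < s0 → ∀ n, Cl g Pd (8 * δ) (2 * L * |s - s'|) (fun z => q s n z - q s' n z) := by
    intro s s' hs hss hs' hss' n
    induction n with
    | zero => simpa [q0] using Cl.zero (g := g) (p := 8 * δ) (A := Pd) (show 0 ≤ 2 * L * |s - s'| by positivity)
    | succ n ih =>
      have h1 := (Nc _ _ _ (by positivity) (qb s hs hss n) (qb s' hs' hss' n) ih).1
      refine (((csf0 (s - s')).add h1).congr ?_).mono_M ?_
      · intro z _; rw [q1, q1]; push_cast; ring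
      · have : 0 ≤ L * |s - s'| := by positivity
        nlinarith
  have hdd2 : ∀ z ∈ Pd, dd z ^ (8 * δ) ≤ 2 := by
    intro z hz
    calc dd z ^ (8 * δ) ≤ 2 ^ (8 * δ) := Real.rpow_le_rpow (norm_nonneg _) (dd_le_two hz.1) (by positivity)
      _ ≤ 2^(1:ℝ) := Real.rpow_le_rpow_of_exponent_le (by norm_num) (by linarith)
      _ = 2 := by simp
  have hlim : ∀ s, 0 < s → s < s0 → ∀ z ∈ Pd, ∃ l, Filter.Tendsto (fun n => q s n z) Filter.atTop (nhds l) := by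
    intro s hs hss z hz
    refine cauchySeq_tendsto_of_complete (cauchySeq_of_le_geometric (1/2) (m * 2) (by norm_num) ?_)
    intro n
    rw [dist_comm, dist_eq_norm]
    refine ((qd s hs hss n).sup z hz).trans ?_
    have := hdd2 z hz
    have h2 : 0 ≤ m * (1/2:ℝ)^n := by positivity
    nlinarith
  classical
  set F : ℝ → ℂ → ℂ := fun s z => if h : ∃ l, Filter.Tendsto (fun n => q s n z) Filter.atTop (nhds l) then h.choose else 0 with hF
  have Fl : ∀ s, 0 < s → s < s0 → ∀ z ∈ Pd, Filter.Tendsto (fun n => q s n z) Filter.atTop (nhds (F s z)) := by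
    intro s hs hss z hz
    have h := hlim s hs hss z hz
    simp only [hF, dif_pos h]; exact h.choose_spec
  have Fb' : ∀ s, 0 < s → s < s0 → Cl g Pd (8 * δ) (2 * (s * L)) (F s) := fun s hs hss => Cl.lim _ (qb' s hs hss) (Fl s hs hss)
  have Fb : ∀ s, 0 < s → s < s0 → Cl g Pd (8 * δ) m (F s) := fun s hs hss => Cl.lim _ (qb s hs hss) (Fl s hs hss)
  have Fs : ∀ s s', 0 < s → s < s0 → 0 < s' → s' < s0 → Cl g Pd (8 * δ) (2 * L * |s - s'|) (fun z => F s z - F s' z) :=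
    fun s s' hs hss hs' hss' => Cl.lim _ (qs s s' hs hss hs' hss') (fun z hz => (Fl s hs hss z hz).sub (Fl s' hs' hss' z hz))
  have Fq : ∀ s, 0 < s → s < s0 → ∀ n, Cl g Pd (8 * δ) (2 * m * (1/2)^n) (fun z => F s z - q s n z) := by
    intro s hs hss n
    have hk : ∀ k, Cl g Pd (8 * δ) (2 * m * (1/2)^n - 2 * m * (1/2)^(n+k)) (fun z => q s (n+k) z - q s n z) := by
      intro k
      induction k with
      | zero => simpa using Cl.zero (g := g) (p := 8 * δ) (A := Pd) (le_refl (0:ℝ))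
      | succ k ih =>
        refine ((ih.add (qd s hs hss (n+k))).congr ?_).mono_M (le_of_eq ?_)
        · intro z _; rw [← add_assoc]; ring
        · rw [← add_assoc, pow_succ _ (n+k)]; ring
    refine Cl.lim _ (fun k => (hk k).mono_M (by have : 0 ≤ 2 * m * (1/2:ℝ)^(n+k) := by positivity
                                                linarith)) ?_
    intro z hz
    refine ((Fl s hs hss z hz).comp (Filter.tendsto_add_atTop_nat n)).sub_const _ |>.congr ?_
    intro k; simp [add_comm]
  set f : ℝ → ℂ → ℂ := fun s z => s * f0 z + N (fun z => R (F s z)) z with hf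
  have fF : ∀ s, 0 < s → s < s0 → ∀ z ∈ Pd, f s z = F s z := by
    intro s hs hss z hz
    refine tendsto_nhds_unique (f := fun n => q s (n+1) z) (l := Filter.atTop) ?_ ((Fl s hs hss z hz).comp (Filter.tendsto_add_atTop_nat 1))
    rw [tendsto_iff_norm_sub_tendsto_zero]
    refine squeeze_zero (fun _ => norm_nonneg _) (g := fun n => (CN * (4 * C * m) * (2 * m * (1/2)^n)) * 2) ?_ ?_
    · intro n
      have h1 := (Nc _ _ _ (by positivity) (Fb s hs hss) (qb s hs hss n) (Fq s hs hss n)).1.sup z hz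
      rw [norm_sub_rev, show f s z - q s (n+1) z = N (fun z => R (F s z)) z - N (fun z => R (q s n z)) z by rw [q1]; simp only [hf]; ring]
      refine h1.trans ?_
      have := hdd2 z hz
      gcongr
    · have := (tendsto_pow_atTop_nhds_zero_of_lt_one (show (0:ℝ) ≤ 1/2 by norm_num) (by norm_num)).const_mul (CN * (4 * C * m) * (2 * m) * 2)
      rw [mul_zero] at this
      refine this.congr (fun n => by ring)
  refine ⟨s0, L * s0 + CN * (4 * C * m * m) + (L + CN * (4 * C * m) * (2 * L)), f, fun s z => s * K0 z + KK (fun z => R (F s z)) z, hs00, ?_⟩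
  intro s hs hss
  obtain ⟨n1, n2, n3, n4, n5, n6, n7⟩ := hN _ _ (Rc0 _ m hm.le le_rfl (Fb s hs hss))
  have n5' := (hN _ _ (Rc0 _ _ (by positivity) (by linarith [sL s hs hss]) (Fb' s hs hss))).2.2.2.2.1
  refine ⟨(H.df0.const_mul _).add n1, (H.dK0.const_mul _).add n2, by simp [hf, H.zf0, n3], by simp [H.zK0, n4], ?_, ?_, ?_, ?_, ?_⟩
  · exact ((Fb s hs hss).congr (fun z hz => (fF s hs hss z hz).symm)).mono_M m4
  · refine ((csK0 s).add n6).mono_M ?_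
    rw [abs_of_pos hs]
    have : s * L ≤ L * s0 := by rw [mul_comm]; gcongr
    have : 0 ≤ L + CN * (4 * C * m) * (2 * L) := by positivity
    linarith
  · intro z hz
    have e := n7 z hz
    have e0 := H.r0 z hz
    rw [show R (f s z) = R (F s z) by rw [fF s hs hss z (Sc_sub hz)]]
    simp only [hf, map_add, map_mul, conj_ofReal]
    linear_combination e + s * e0
  · refine (n5'.congr ?_).mono_M ?_
    · intro z _; simp only [hf]; ring
    · have : CN * (4 * C * m * (2 * (s * L))) = s * (CN * (4 * C * m) * (2 * L)) := by ring
      rw [this]; nlinarith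
  · intro s' hs' hss'
    obtain ⟨a, b⟩ := Nc _ _ _ (by positivity) (Fb s hs hss) (Fb s' hs' hss') (Fs s s' hs hss hs' hss')
    constructor
    · refine (a.congr ?_).mono_M ?_
      · intro z _; simp only [hf]; ring
      · have := abs_nonneg (s - s'); nlinarith
    · refine (((csK0 (s - s')).add b).congr ?_).mono_M ?_
      · intro z _; push_cast; ring
      · have := abs_nonneg (s - s')
        have : 0 ≤ L * s0 + CN * (4 * C * m * m) := by positivity
        nlinarith

lemma eval_diff (a b : ℂ → ℂ) (A : Set ℂ) (ha : DifferentiableOn ℂ a A) (hb : DifferentiableOn ℂ b A) (p : MvPolynomial (Fin 2) ℂ) :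
    DifferentiableOn ℂ (fun z => MvPolynomial.eval (fun i : Fin 2 => if i = 0 then a z else b z) p) A := by
  induction p using MvPolynomial.induction_on with
  | C c => simp
  | add p q hp hq => simp only [map_add]; exact hp.add hq
  | mul_X p i hp =>
    simp only [map_mul, MvPolynomial.eval_X]
    refine hp.mul ?_
    split_ifs
    · exact ha
    · exact hb

lemma eval_cont (a b : ℂ → ℂ) (A : Set ℂ) (ha : ContinuousOn a A) (hb : ContinuousOn b A) (p : MvPolynomial (Fin 2) ℂ) :
    ContinuousOn (fun z => MvPolynomial.eval (fun i : Fin 2 => if i = 0 then a z else b z) p) A := by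
  induction p using MvPolynomial.induction_on with
  | C c => simpa using continuousOn_const
  | add p q hp hq => simp only [map_add]; exact hp.add hq
  | mul_X p i hp =>
    simp only [map_mul, MvPolynomial.eval_X]
    refine hp.mul ?_
    split_ifs
    · exact ha
    · exact hb

lemma eval_cont2 (p : MvPolynomial (Fin 2) ℂ) :
    Continuous (fun w : ℂ × ℂ => MvPolynomial.eval (fun i : Fin 2 => if i = 0 then w.1 else w.2) p) := by
  induction p using MvPolynomial.induction_on with
  | C c => simpa using continuous_const
  | add p q hp hq => simp only [map_add]; exact hp.add hq
  | mul_X p i hp =>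
    simp only [map_mul, MvPolynomial.eval_X]
    refine hp.mul ?_
    split_ifs
    · exact continuous_fst
    · exact continuous_snd

lemma hull_mem (Kset : Set (ℂ × ℂ)) (δ : ℝ) (hδ : 0 < δ) (hK : Kset ⊆ eClosedBall δ) (a b : ℂ → ℂ)
    (ha : DifferentiableOn ℂ a (Metric.ball 0 1)) (hb : DifferentiableOn ℂ b (Metric.ball 0 1))
    (ca : ContinuousOn a (Metric.closedBall 0 1)) (cb : ContinuousOn b (Metric.closedBall 0 1))
    (hbd : ∀ z : ℂ, ‖z‖ = 1 → (a z, b z) ∈ Kset) : ∀ z ∈ Metric.closedBall (0:ℂ) 1, (a z, b z) ∈ polyHull2 Kset := by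
  intro z hz p
  have hbdd : BddAbove ((fun w : ℂ × ℂ => ‖MvPolynomial.eval (fun i : Fin 2 => if i = 0 then w.1 else w.2) p‖) '' Kset) := by
    have hc := (isCompact_closedBall (0 : ℂ × ℂ) δ).bddAbove_image (eval_cont2 p).norm.continuousOn
    refine hc.mono (Set.image_mono ?_)
    intro w hw
    have := hK hw
    simp only [eClosedBall, Set.mem_ofPred_eq] at this
    rw [mem_closedBall_zero_iff, Prod.norm_def]
    refine max_le ?_ ?_
    · exact abs_le_of_sq_le_sq' (by nlinarith [sq_nonneg ‖w.2‖]) hδ.le |>.2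
    · exact abs_le_of_sq_le_sq' (by nlinarith [sq_nonneg ‖w.1‖]) hδ.le |>.2
  have hcl : closure (Metric.ball (0:ℂ) 1) = Metric.closedBall 0 1 := closure_ball _ one_ne_zero
  have hd : DiffContOnCl ℂ (fun z => MvPolynomial.eval (fun i : Fin 2 => if i = 0 then a z else b z) p) (Metric.ball 0 1) :=
    ⟨eval_diff a b _ ha hb p, by rw [hcl]; exact eval_cont a b _ ca cb p⟩
  refine Complex.norm_le_of_forall_mem_frontier_norm_le Metric.isBounded_ball hd ?_ (by rw [hcl]; exact hz)
  intro w hw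
  rw [frontier_ball _ one_ne_zero, mem_sphere_zero_iff_norm] at hw
  exact le_csSup hbdd ⟨_, hbd w hw, rfl⟩

set_option maxHeartbeats 400000 in
lemma final_of_frames (t : ℝ) (ht0 : 0 < t) (ht1 : t < 1) {g δ' C0 C' : ℝ} {χ f0 f1 K0 K1 : ℂ → ℂ} (H : Frames t g δ' C0 C' χ f0 f1 K0 K1)
    (U : Set ℂ) (hU : IsOpen U) (h0U : (0 : ℂ) ∈ U) (F : ℂ → ℂ)
    (hF : ContDiffOn ℝ (⊤ : ℕ∞) F U)
    (hders : ∀ k : ℕ, k ≤ 3 → iteratedFDerivWithin ℝ k F U 0 = 0)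
    (δ : ℝ) (hδ : 0 < δ) :
    ∃ G : ℝ × ℂ → ℂ × ℂ,
      ContinuousOn G (Set.Ioo (0 : ℝ) 1 ×ˢ Metric.closedBall (0 : ℂ) 1) ∧
      (∀ s ∈ Set.Ioo (0 : ℝ) 1,
        DifferentiableOn ℂ (fun ζ => G (s, ζ)) (Metric.ball (0 : ℂ) 1) ∧
        (¬ ∀ ζ₁ ∈ Metric.closedBall (0 : ℂ) 1, ∀ ζ₂ ∈ Metric.closedBall (0 : ℂ) 1,
            G (s, ζ₁) = G (s, ζ₂)) ∧
        (∀ ζ : ℂ, ‖ζ‖ = 1 → G (s, ζ) ∈ Mset t U F ∩ eClosedBall δ) ∧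
        (∃ ζ ∈ Metric.closedBall (0 : ℂ) 1, G (s, ζ) = 0) ∧
        (∀ ζ ∈ Metric.closedBall (0 : ℂ) 1, G (s, ζ) ∈ polyHull2 (Mset t U F ∩ eClosedBall δ))) ∧
      (∀ s₁ ∈ Set.Ioo (0 : ℝ) 1, ∀ s₂ ∈ Set.Ioo (0 : ℝ) 1, s₁ ≠ s₂ →
        (fun ζ => G (s₁, ζ)) '' Metric.closedBall (0 : ℂ) 1 ≠
          (fun ζ => G (s₂, ζ)) '' Metric.closedBall (0 : ℂ) 1) := by
  obtain ⟨r1, C, hr1, hC, hrU, Fd, F0, F1, F2⟩ := jet U hU h0U F hF hders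
  obtain ⟨r, CR, R, D, hr, hrr, hCR, R0, D0, Rd, R3, Dl⟩ := Rexists t ht0 ht1 F r1 C hr1 hC Fd F0 F1 F2
  have h1S : (1:ℂ) ∈ Sc := ⟨by simp, by intro h; have := congrArg Complex.re h; norm_num at this⟩
  have ha : f0 1 ≠ 0 := by
    intro h
    have := H.wr 1 h1S
    rw [h, zero_mul, zero_im] at this
    have h2 : 0 < C' * dd 1 ^ (-2/3:ℝ) := mul_pos H.hC' (Real.rpow_pos_of_pos (Pd_pos (Sc_sub h1S)) _)
    linarith
  set a := ‖f0 1‖ with hadef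
  have ha0 : 0 < a := norm_pos_iff.2 ha
  obtain ⟨η, hη, e1, e2, e3, e4⟩ : ∃ η : ℝ, 0 < η ∧ 2 * η < r ∧ 2 * η ≤ 1 ∧ 6 * η < a ∧ 2 * η * (4 + C) ≤ δ := by
    refine ⟨min (min (r/4) (1/4)) (min (a/12) (δ / (4 * (4 + C)))), by positivity, ?_, ?_, ?_, ?_⟩
    · have := (min_le_left (min (r/4) (1/4)) (min (a/12) (δ / (4 * (4 + C))))).trans (min_le_left _ _); linarith
    · have := (min_le_left (min (r/4) (1/4)) (min (a/12) (δ / (4 * (4 + C))))).trans (min_le_right _ _); linarith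
    · have := (min_le_right (min (r/4) (1/4)) (min (a/12) (δ / (4 * (4 + C))))).trans (min_le_left _ _); linarith
    · have := (min_le_right (min (r/4) (1/4)) (min (a/12) (δ / (4 * (4 + C))))).trans (min_le_right _ _)
      rw [le_div_iff₀ (by positivity)] at this; linarith
  obtain ⟨s0, L, f, K, hs0, fam⟩ := family H R D r CR hr hCR R0 D0 Rd Dl η hη
  have hδ' := H.hδ
  have hδ1 := H.hδ1
  have hg0 : 0 < g := by have := H.hg; linarith
  have hdd2 : ∀ z ∈ Pd, ∀ p : ℝ, 0 < p → p ≤ 1 → dd z ^ p ≤ 2 := by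
    intro z hz p hp hp1
    calc dd z ^ p ≤ 2 ^ p := Real.rpow_le_rpow (norm_nonneg _) (dd_le_two hz.1) hp.le
      _ ≤ 2^(1:ℝ) := Real.rpow_le_rpow_of_exponent_le (by norm_num) hp1
      _ = 2 := by simp
  have sup2 : ∀ u M p, 0 ≤ M → 0 < p → p ≤ 1 → Cl g Pd p M u → ∀ z ∈ Pd, ‖u z‖ ≤ 2 * M := by
    intro u M p hM hp hp1 hu z hz
    refine (hu.sup z hz).trans ?_
    rw [mul_comm]; have := hdd2 z hz p hp hp1; gcongr
  have hins : ∀ z ∈ Metric.closedBall (0:ℂ) 1, z = -1 ∨ z ∈ Pd := by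
    intro z hz
    by_cases h : z = -1
    · exact Or.inl h
    · exact Or.inr ⟨by simpa using hz, h⟩
  have hm1 : (-1:ℂ) ∈ Metric.closedBall (0:ℂ) 1 := by simp
  have h11 : (1:ℂ) ∈ Metric.closedBall (0:ℂ) 1 := by simp
  have hcont : ∀ u M, Cl g Pd (8 * δ') M u → u (-1) = 0 → ContinuousOn u (Metric.closedBall 0 1) := by
    intro u M hu h0
    exact (hu.cont subset_rfl hg0 (by positivity) h0).mono (fun z hz => hins z hz)
  have hss : ∀ s ∈ Set.Ioo (0:ℝ) 1, 0 < s * s0 ∧ s * s0 < s0 := fun s hs => ⟨mul_pos hs.1 hs0, by nlinarith [hs.2]⟩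
  have hT : (3 * (t:ℂ)) ≠ 0 := by
    have : (t:ℂ) ≠ 0 := by exact_mod_cast ht0.ne'
    simpa using this
  set w : ℝ → ℂ → ℂ := fun s ζ => (ζ * (K s ζ)^3 - (f s ζ)^3) / (3 * t) with hw
  have dw : ∀ s, 0 < s → s < s0 → DifferentiableOn ℂ (w s) (Metric.ball 0 1) := by
    intro s h1 h2
    exact ((differentiableOn_id.mul ((fam s h1 h2).2.1.pow 3)).sub ((fam s h1 h2).1.pow 3)).div_const _
  have cf : ∀ s, 0 < s → s < s0 → ContinuousOn (f s) (Metric.closedBall 0 1) := fun s h1 h2 =>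
    hcont _ _ (fam s h1 h2).2.2.2.2.1 (fam s h1 h2).2.2.1
  have cK : ∀ s, 0 < s → s < s0 → ContinuousOn (K s) (Metric.closedBall 0 1) := fun s h1 h2 =>
    hcont _ _ (fam s h1 h2).2.2.2.2.2.1 (fam s h1 h2).2.2.2.1
  have cw : ∀ s, 0 < s → s < s0 → ContinuousOn (w s) (Metric.closedBall 0 1) := by
    intro s h1 h2
    exact ((continuousOn_id.mul ((cK s h1 h2).pow 3)).sub ((cf s h1 h2).pow 3)).div_const _
  have hF00 : F 0 = 0 := by simpa using F0 0 (by simpa using hr1)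
  have fm1 : ∀ s, 0 < s → s < s0 → f s (-1) = 0 ∧ w s (-1) = 0 := by
    intro s h1 h2
    have e1 := (fam s h1 h2).2.2.1
    have e2 := (fam s h1 h2).2.2.2.1
    exact ⟨e1, by simp [hw, e1, e2]⟩
  have hbd : ∀ s, 0 < s → s < s0 → ∀ ζ : ℂ, ‖ζ‖ = 1 → (f s ζ, w s ζ) ∈ Mset t U F ∩ eClosedBall δ := by
    intro s h1 h2 ζ hζ
    by_cases hm : ζ = -1
    · rw [hm, (fm1 s h1 h2).1, (fm1 s h1 h2).2]
      exact ⟨⟨0, h0U, by simp [hF00]⟩, by simp [eClosedBall]; positivity⟩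
    have hS : ζ ∈ Sc := ⟨hζ, hm⟩
    obtain ⟨-, -, -, -, b1, -, b2, -, -⟩ := fam s h1 h2
    have hx := sup2 _ _ _ hη.le (by positivity) (by linarith) b1 ζ (Sc_sub hS)
    have eq := b2 ζ hS
    set z := f s ζ with hz
    have e3 := R3 z (hx.trans_lt e1)
    rw [hL_apply] at e3
    have hwz : w s ζ = z ^ 2 * conj z + (t : ℂ) * z * (conj z) ^ 2 + ((t : ℂ) ^ 2 / 3) * (conj z) ^ 3 + F z := by
      simp only [hw]
      rw [← hz]
      have : ζ * K s ζ ^ 3 = (z + t * conj z)^3 + 3 * t * F z := by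
        rw [← e3, eq, mul_pow, H.hχ ζ hS]
      rw [this, div_eq_iff hT]; ring
    refine ⟨⟨z, hrU (by simpa using (hx.trans_lt e1).trans_le hrr), by rw [hwz]⟩, ?_⟩
    simp only [eClosedBall, Set.mem_ofPred_eq]
    have hFz := F0 z ((hx.trans_lt e1).trans_le hrr)
    have hx0 := norm_nonneg z
    have hx1 : ‖z‖ ≤ 1 := hx.trans e2
    have hn : ‖w s ζ‖ ≤ (3 + C) * ‖z‖ := by
      rw [hwz]
      refine (norm_add_le _ _).trans ?_
      have n1 : ‖z ^ 2 * conj z + (t : ℂ) * z * (conj z) ^ 2 + ((t : ℂ) ^ 2 / 3) * (conj z) ^ 3‖ ≤ 3 * ‖z‖^3 := by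
        refine (norm_add₃_le).trans ?_
        simp only [norm_mul, norm_pow, norm_div, Complex.norm_conj, Complex.norm_real, Real.norm_of_nonneg ht0.le]
        have t2 : t^2 ≤ 1 := by nlinarith
        have x3 : 0 ≤ ‖z‖^3 := by positivity
        have : ‖(3:ℂ)‖ = 3 := by norm_num
        rw [this]
        have u1 : t * ‖z‖^3 ≤ 1 * ‖z‖^3 := by gcongr
        have u2 : t^2/3 * ‖z‖^3 ≤ 1 * ‖z‖^3 := by gcongr; linarith
        calc _ = ‖z‖^3 + t * ‖z‖^3 + t^2/3*‖z‖^3 := by ring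
          _ ≤ _ := by linarith
      have p3 : ‖z‖^3 ≤ ‖z‖ := by simpa using pow_le_pow_of_le_one hx0 hx1 (show 1 ≤ 3 by norm_num)
      have p4 : ‖z‖^4 ≤ ‖z‖ := by simpa using pow_le_pow_of_le_one hx0 hx1 (show 1 ≤ 4 by norm_num)
      have : C * ‖z‖^4 ≤ C * ‖z‖ := by gcongr
      linarith
    have hn2 : ‖w s ζ‖^2 ≤ ((3 + C) * ‖z‖)^2 := by gcongr
    have hn3 : (‖z‖ * (4 + C))^2 ≤ δ^2 := by
      gcongr
      exact (mul_le_mul_of_nonneg_right hx (by positivity)).trans e4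
    have : 0 ≤ ‖z‖^2 * (6 + 2 * C) := by positivity
    nlinarith
  have f1ge : ∀ s, 0 < s → s < s0 → s * (a - 2 * η) ≤ ‖f s 1‖ := by
    intro s h1 h2
    have b := (fam s h1 h2).2.2.2.2.2.2.2.1
    have := sup2 _ _ _ (by positivity) (by positivity) (by linarith) b 1 (Sc_sub h1S)
    have n := norm_sub_norm_le ((s:ℂ) * f0 1) (f s 1)
    rw [norm_sub_rev, norm_mul, Complex.norm_real, Real.norm_of_nonneg h1.le, ← hadef] at n
    linarith
  have hdist : ∀ s s', 0 < s → s < s' → s' < s0 →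
      f s '' Metric.closedBall (0:ℂ) 1 ≠ f s' '' Metric.closedBall (0:ℂ) 1 := by
    intro s s' h1 h2 h3 heq
    have h1' := h1.trans h2
    have h2' := h2.trans h3
    obtain ⟨z, hz, hmax⟩ := (isCompact_closedBall (0:ℂ) 1).exists_isMaxOn ⟨1, h11⟩ (cf s h1 h2').norm
    have hA1 : ‖f s 1‖ ≤ ‖f s z‖ := hmax h11
    have hge := f1ge s h1 h2'
    have hzP : z ∈ Pd := by
      rcases hins z hz with h | h
      · exfalso
        rw [h, (fm1 s h1 h2').1, norm_zero] at hA1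
        nlinarith
      · exact h
    have b := (fam s h1 h2').2.2.2.2.2.2.2.1
    have b1 := sup2 _ _ _ (by positivity) (by positivity) (by linarith) b z hzP
    have c := ((fam s' h1' h3).2.2.2.2.2.2.2.2 s h1 h2').1
    have c1 := sup2 _ _ _ (by positivity) (by positivity) (by linarith) c z hzP
    rw [abs_of_pos (by linarith)] at c1
    obtain ⟨ζ, hζ, hζe⟩ : f s' z ∈ f s '' Metric.closedBall (0:ℂ) 1 := by rw [heq]; exact ⟨z, hz, rfl⟩
    have hle : ‖f s' z‖ ≤ ‖f s z‖ := by rw [← hζe]; exact hmax hζ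
    have hsne : (s:ℂ) ≠ 0 := by exact_mod_cast h1.ne'
    have id : ((s'/s : ℝ):ℂ) * f s z = f s' z - ((f s' z - s' * f0 z) - (f s z - s * f0 z)) + (((s'-s)/s : ℝ) : ℂ) * (f s z - s * f0 z) := by
      push_cast; field_simp; ring
    have n := congrArg norm id
    have n2 : ‖f s' z - ((f s' z - s' * f0 z) - (f s z - s * f0 z)) + (((s'-s)/s : ℝ) : ℂ) * (f s z - s * f0 z)‖ ≤ ‖f s' z‖ + ‖((f s' z - s' * f0 z) - (f s z - s * f0 z))‖ + ‖(((s'-s)/s : ℝ) : ℂ) * (f s z - s * f0 z)‖ :=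
      (norm_add_le _ _).trans (by gcongr; exact norm_sub_le _ _)
    have hq : 0 < (s'-s)/s := div_pos (by linarith) h1
    rw [← n, norm_mul, norm_mul, Complex.norm_real, Complex.norm_real, Real.norm_of_nonneg (by positivity), Real.norm_of_nonneg hq.le] at n2
    have n3 : (s'-s)/s * ‖f s z - s * f0 z‖ ≤ (s'-s)/s * (2 * (η * s)) := by gcongr
    have n4 : (s'-s)/s * (2 * (η * s)) = 2 * η * (s'-s) := by field_simp
    have n5 : s'/s * ‖f s z‖ = ‖f s z‖ + (s'-s)/s * ‖f s z‖ := by field_simp; ring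
    have n6 : (s'-s)/s * (s * (a - 2 * η)) ≤ (s'-s)/s * ‖f s z‖ := by gcongr; linarith
    have n7 : (s'-s)/s * (s * (a - 2 * η)) = (s'-s) * (a - 2 * η) := by field_simp
    have : 0 < (s' - s) * (a - 6 * η) := mul_pos (by linarith) (by linarith)
    nlinarith
  have lipf : ∀ z ∈ Metric.closedBall (0:ℂ) 1, ∀ s s', 0 < s → s < s0 → 0 < s' → s' < s0 → ‖f s z - f s' z‖ ≤ (2 * η + 2 * C0) * |s - s'| := by
    intro z hz s s' h1 h2 h3 h4
    rcases hins z hz with h | h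
    · rw [h, (fm1 s h1 h2).1, (fm1 s' h3 h4).1, sub_zero, norm_zero]
      have := H.hC0; positivity
    · have c := ((fam s h1 h2).2.2.2.2.2.2.2.2 s' h3 h4).1
      have c1 := sup2 _ _ _ (by positivity) (by positivity) (by linarith) c z h
      have c2 := sup2 _ _ _ H.hC0.le (by positivity) (by linarith) H.cf0 z h
      rw [show f s z - f s' z = ((f s z - s * f0 z) - (f s' z - s' * f0 z)) + ((s - s' : ℝ) : ℂ) * f0 z by push_cast; ring]
      refine (norm_add_le _ _).trans ?_
      rw [norm_mul, Complex.norm_real, Real.norm_eq_abs]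
      have := mul_le_mul_of_nonneg_left c2 (abs_nonneg (s - s'))
      linarith
  have hLn : 0 ≤ L := ((fam (s0/2) (by linarith) (by linarith)).2.2.2.2.2.1.mono_set Sc_sub).M_nonneg
  have lipK : ∀ z ∈ Metric.closedBall (0:ℂ) 1, ∀ s s', 0 < s → s < s0 → 0 < s' → s' < s0 → ‖K s z - K s' z‖ ≤ (2 * L) * |s - s'| := by
    intro z hz s s' h1 h2 h3 h4
    rcases hins z hz with h | h
    · rw [h, (fam s h1 h2).2.2.2.1, (fam s' h3 h4).2.2.2.1, sub_zero, norm_zero]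
      positivity
    · have c := ((fam s h1 h2).2.2.2.2.2.2.2.2 s' h3 h4).2
      have c1 := sup2 _ _ _ (by positivity) (by positivity) (by linarith) c z h
      linarith
  have jc : ∀ (u : ℝ → ℂ → ℂ) (M : ℝ), 0 ≤ M → (∀ s, 0 < s → s < s0 → ContinuousOn (u s) (Metric.closedBall 0 1)) →
      (∀ z ∈ Metric.closedBall (0:ℂ) 1, ∀ s s', 0 < s → s < s0 → 0 < s' → s' < s0 → ‖u s z - u s' z‖ ≤ M * |s - s'|) →
      ContinuousOn (fun x : ℝ × ℂ => u (x.1 * s0) x.2) (Set.Ioo (0 : ℝ) 1 ×ˢ Metric.closedBall (0 : ℂ) 1) := by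
    intro u M hM h1 h2
    refine continuousOn_prod_of_continuousOn_lipschitzOnWith _ (M * s0).toNNReal ?_ ?_
    · intro s hs; exact h1 _ (hss s hs).1 (hss s hs).2
    · intro z hz
      refine LipschitzOnWith.of_dist_le_mul ?_
      intro s hs s' hs'
      rw [dist_eq_norm, Real.dist_eq]
      refine (h2 z hz _ _ (hss s hs).1 (hss s hs).2 (hss s' hs').1 (hss s' hs').2).trans (le_of_eq ?_)
      rw [← sub_mul, abs_mul, abs_of_pos hs0]
      rw [Real.coe_toNNReal _ (by positivity)]; ring
  have jf := jc f _ (by have := H.hC0; positivity) cf lipf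
  have jK := jc K _ (by positivity) cK lipK
  refine ⟨fun x => (f (x.1 * s0) x.2, w (x.1 * s0) x.2), ?_, ?_, ?_⟩
  · refine jf.prodMk ?_
    exact (((continuousOn_snd).mul (jK.pow 3)).sub (jf.pow 3)).div_const _
  · intro s hs
    obtain ⟨h1, h2⟩ := hss s hs
    have d1 : DifferentiableOn ℂ (fun ζ => (f (s * s0) ζ, w (s * s0) ζ)) (Metric.ball 0 1) :=
      DifferentiableOn.prodMk (fam _ h1 h2).1 (dw _ h1 h2)
    refine ⟨d1, ?_, hbd _ h1 h2, ⟨-1, hm1, ?_⟩, ?_⟩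
    · intro hall
      have := congrArg Prod.fst (hall 1 h11 (-1) hm1)
      simp only [(fm1 _ h1 h2).1] at this
      have hge := f1ge _ h1 h2
      rw [this, norm_zero] at hge
      nlinarith
    · simp only [(fm1 _ h1 h2).1, (fm1 _ h1 h2).2]; rfl
    · exact hull_mem (Mset t U F ∩ eClosedBall δ) δ hδ Set.inter_subset_right (f (s * s0)) (w (s * s0)) (fam (s * s0) h1 h2).1 (dw (s * s0) h1 h2)
        (cf (s * s0) h1 h2) (cw (s * s0) h1 h2) (hbd (s * s0) h1 h2)
  · intro s₁ hs₁ s₂ hs₂ hne heq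
    have himg : f (s₁ * s0) '' Metric.closedBall (0:ℂ) 1 = f (s₂ * s0) '' Metric.closedBall (0:ℂ) 1 := by
      have := congrArg (fun A => Prod.fst '' A) heq
      simpa only [Set.image_image] using this
    rcases lt_or_gt_of_ne hne with h | h
    · exact hdist _ _ (hss s₁ hs₁).1 (mul_lt_mul_of_pos_right h hs0) (hss s₂ hs₂).2 himg
    · exact hdist _ _ (hss s₂ hs₂).1 (mul_lt_mul_of_pos_right h hs0) (hss s₁ hs₁).2 himg.symm

lemma w_int (ν a : ℝ) (ha : 0 < a) (hν : ν < 1) :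
    MeasureTheory.IntegrableOn (fun s : ℝ => s^(a-1) * (1-s)^(-ν)) (Set.Ioo 0 1) := by
  have h := Complex.betaIntegral_convergent (u := (a:ℂ)) (v := ((1-ν:ℝ):ℂ)) (by simpa using ha) (by simpa using hν)
  rw [intervalIntegrable_iff_integrableOn_Ioo_of_le zero_le_one] at h
  have hn : MeasureTheory.IntegrableOn (fun s : ℝ => ‖(s:ℂ)^((a:ℂ)-1) * (1 - (s:ℂ))^(((1-ν:ℝ):ℂ)-1)‖) (Set.Ioo 0 1) := h.norm
  refine MeasureTheory.IntegrableOn.congr_fun hn ?_ measurableSet_Ioo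
  intro s hs
  have h1 : 0 < 1 - s := by linarith [hs.2]
  simp only [norm_mul]
  rw [show ((a:ℂ) - 1) = ((a - 1 : ℝ) : ℂ) by push_cast; ring, show (((1-ν:ℝ):ℂ) - 1) = ((-ν : ℝ) : ℂ) by push_cast; ring,
    show (1 - (s:ℂ)) = ((1 - s : ℝ):ℂ) by push_cast; ring, Complex.norm_cpow_real, Complex.norm_cpow_real, Complex.norm_real, Complex.norm_real,
    Real.norm_of_nonneg hs.1.le, Real.norm_of_nonneg h1.le]

noncomputable def Eu (ν a b : ℝ) (z : ℂ) : ℂ :=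
  ∫ s in Set.Ioo (0:ℝ) 1, ((s^(a-1) * (1-s)^(-ν) : ℝ) : ℂ) * (1 + s * z)^((-b : ℝ):ℂ)

lemma sl_mem {z : ℂ} (hz : 1 + z ∈ slitPlane) {s : ℝ} (hs : s ∈ Set.Icc (0:ℝ) 1) : 1 + s * z ∈ slitPlane := by
  rcases hz with h | h
  · left
    simp at h ⊢
    rcases eq_or_lt_of_le hs.1 with h0 | h0
    · rw [← h0]; simp
    · nlinarith [hs.2]
  · simp at h
    rcases eq_or_lt_of_le hs.1 with h0 | h0
    · left; rw [← h0]; simp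
    · right; simp; exact ⟨h0.ne', h⟩

lemma sl_lower {z : ℂ} (hz : 1 + z ∈ slitPlane) : ∃ c > 0, ∀ y, ‖y - z‖ < c → 1 + y ∈ slitPlane ∧ ∀ s ∈ Set.Icc (0:ℝ) 1, c ≤ ‖1 + s * y‖ := by
  obtain ⟨s0, hs0, hmin⟩ := (isCompact_Icc (a := (0:ℝ)) (b := 1)).exists_isMinOn ⟨0, by simp⟩
    (f := fun s : ℝ => ‖1 + s * z‖) (by fun_prop)
  have hpos : 0 < ‖1 + s0 * z‖ := norm_pos_iff.2 (slitPlane_ne_zero (sl_mem hz hs0))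
  have hop : IsOpen {y : ℂ | 1 + y ∈ slitPlane} := isOpen_slitPlane.preimage (by fun_prop)
  obtain ⟨r, hr, hb⟩ := Metric.isOpen_iff.1 hop z hz
  refine ⟨min r (‖1 + s0 * z‖/2), by positivity, ?_⟩
  intro y hy
  refine ⟨hb (by rw [mem_ball_iff_norm]; exact hy.trans_le (min_le_left _ _)), ?_⟩
  intro s hs
  have h1 : ‖1 + s0 * z‖ ≤ ‖1 + s * z‖ := hmin hs
  have h2 := norm_sub_norm_le (1 + s * z) (1 + s * y)
  have h3 : ‖(1 + s * z) - (1 + s * y)‖ ≤ ‖y - z‖ := by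
    rw [show (1 + s * z) - (1 + s * y) = -((s:ℂ) * (y - z)) by ring, norm_neg, norm_mul, Complex.norm_real, Real.norm_of_nonneg hs.1]
    exact mul_le_of_le_one_left (norm_nonneg _) hs.2
  have h4 := hy.trans_le (min_le_right _ _)
  have h5 := min_le_right r (‖1 + s0 * z‖/2)
  linarith

lemma w_nonneg (ν a : ℝ) {s : ℝ} (hs : s ∈ Set.Ioo (0:ℝ) 1) : 0 ≤ s^(a-1) * (1-s)^(-ν) :=
  mul_nonneg (Real.rpow_nonneg hs.1.le _) (Real.rpow_nonneg (by linarith [hs.2]) _)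

lemma Eu_meas (ν a b : ℝ) {z : ℂ} (hz : 1 + z ∈ slitPlane) :
    MeasureTheory.AEStronglyMeasurable (fun s : ℝ => ((s^(a-1) * (1-s)^(-ν) : ℝ) : ℂ) * (1 + s * z)^((-b : ℝ):ℂ))
      (MeasureTheory.volume.restrict (Set.Ioo (0:ℝ) 1)) := by
  refine ContinuousOn.aestronglyMeasurable ?_ measurableSet_Ioo
  refine ContinuousOn.mul ?_ ?_
  · refine Complex.continuous_ofReal.comp_continuousOn (ContinuousOn.mul ?_ ?_)
    · exact ContinuousOn.rpow_const continuousOn_id (fun s hs => Or.inl hs.1.ne')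
    · exact ContinuousOn.rpow_const (by fun_prop) (fun s hs => Or.inl (by have := hs.2; intro h; linarith))
  · exact ContinuousOn.cpow_const (by fun_prop) (fun s hs => sl_mem hz ⟨hs.1.le, hs.2.le⟩)

lemma Eu_int (ν a b : ℝ) (ha : 0 < a) (hν : ν < 1) (hb : 0 ≤ b) {z : ℂ} (hz : 1 + z ∈ slitPlane) :
    MeasureTheory.IntegrableOn (fun s : ℝ => ((s^(a-1) * (1-s)^(-ν) : ℝ) : ℂ) * (1 + s * z)^((-b : ℝ):ℂ)) (Set.Ioo (0:ℝ) 1) := by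
  obtain ⟨c, hc, h⟩ := sl_lower hz
  refine MeasureTheory.Integrable.mono' ((w_int ν a ha hν).mul_const (c^(-b))) (Eu_meas ν a b hz) ?_
  refine (MeasureTheory.ae_restrict_iff' measurableSet_Ioo).2 (Filter.Eventually.of_forall ?_)
  intro s hs
  rw [norm_mul, Complex.norm_real, Real.norm_of_nonneg (w_nonneg ν a hs), Complex.norm_cpow_real]
  have := w_nonneg ν a hs
  exact mul_le_mul_of_nonneg_left (Real.rpow_le_rpow_of_nonpos hc ((h z (by simpa using hc)).2 s ⟨hs.1.le, hs.2.le⟩) (by linarith)) this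

lemma Eu_deriv (ν a b : ℝ) (ha : 0 < a) (hν : ν < 1) (hb : 0 ≤ b) {z : ℂ} (hz : 1 + z ∈ slitPlane) :
    HasDerivAt (Eu ν a b) (-b * Eu ν (a+1) (b+1) z) z := by
  obtain ⟨c, hc, h⟩ := sl_lower hz
  have key := hasDerivAt_integral_of_dominated_loc_of_deriv_le (μ := MeasureTheory.volume.restrict (Set.Ioo (0:ℝ) 1)) (𝕜 := ℂ)
    (F := fun z (s:ℝ) => ((s^(a-1) * (1-s)^(-ν) : ℝ) : ℂ) * (1 + s * z)^((-b : ℝ):ℂ))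
    (F' := fun z (s:ℝ) => -b * (((s^(a+1-1) * (1-s)^(-ν) : ℝ) : ℂ) * (1 + s * z)^((-(b+1) : ℝ):ℂ)))
    (x₀ := z) (s := Metric.ball z c) (bound := fun s => b * ((s^(a+1-1) * (1-s)^(-ν)) * c^(-(b+1)))) (Metric.ball_mem_nhds z hc)
    ?_ (Eu_int ν a b ha hν hb hz) ((Eu_meas ν (a+1) (b+1) hz).const_mul _) ?_ ?_ ?_
  · have := key.2
    rw [MeasureTheory.integral_const_mul] at this
    exact this
  · filter_upwards [Metric.ball_mem_nhds z hc] with y hy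
    exact Eu_meas ν a b (h y (by simpa [dist_eq_norm] using hy)).1
  · refine (MeasureTheory.ae_restrict_iff' measurableSet_Ioo).2 (Filter.Eventually.of_forall ?_)
    intro s hs y hy
    rw [norm_mul, norm_mul, norm_neg, Complex.norm_real, Complex.norm_real, Real.norm_of_nonneg (w_nonneg ν _ hs), Real.norm_of_nonneg hb, Complex.norm_cpow_real]
    have := w_nonneg ν (a+1) hs
    exact mul_le_mul_of_nonneg_left (mul_le_mul_of_nonneg_left (Real.rpow_le_rpow_of_nonpos hc ((h y (by simpa [dist_eq_norm] using hy)).2 s ⟨hs.1.le, hs.2.le⟩) (by linarith)) this) hb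
  · exact ((w_int ν (a+1) (by linarith) hν).mul_const _).const_mul _
  · refine (MeasureTheory.ae_restrict_iff' measurableSet_Ioo).2 (Filter.Eventually.of_forall ?_)
    intro s hs y hy
    have hsl := sl_mem (h y (by simpa [dist_eq_norm] using hy)).1 ⟨hs.1.le, hs.2.le⟩
    have h1 : HasDerivAt (fun y : ℂ => 1 + s * y) s y := by
      simpa using ((hasDerivAt_id y).const_mul (s:ℂ)).const_add 1
    have h2 := (h1.cpow_const (c := ((-b:ℝ):ℂ)) hsl).const_mul ((s^(a-1) * (1-s)^(-ν) : ℝ) : ℂ)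
    refine h2.congr_deriv ?_
    have e1 : s^(a+1-1) = s^(a-1) * s := by rw [← Real.rpow_add_one hs.1.ne']; congr 1; ring
    rw [e1, show ((-b:ℝ):ℂ) - 1 = ((-(b+1):ℝ):ℂ) by push_cast; ring]
    push_cast; ring

lemma dd_lower {z : ℂ} (hz : ‖z‖ ≤ 1) {s : ℝ} (hs : s ∈ Set.Ioo (0:ℝ) 1) : dd z / 2 ≤ ‖1 + s * z‖ ∧ 1 - s ≤ ‖1 + s * z‖ := by
  have h1 : 1 - s ≤ ‖1 + s * z‖ := by
    have := norm_sub_le (1 + s * z) (s * z)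
    rw [add_sub_cancel_right, norm_one, norm_mul, Complex.norm_real, Real.norm_of_nonneg hs.1.le] at this
    nlinarith [hs.1]
  refine ⟨?_, h1⟩
  have h2 := norm_add_le (1 + s * z) (((1 - s : ℝ):ℂ) * z)
  rw [show (1 + s * z) + ((1 - s : ℝ):ℂ) * z = 1 + z by push_cast; ring, norm_mul, Complex.norm_real, Real.norm_of_nonneg (by linarith [hs.2])] at h2
  have h3 : (1 - s) * ‖z‖ ≤ 1 - s := mul_le_of_le_one_right (by linarith [hs.2]) hz
  unfold dd
  linarith

lemma Pd_sl {z : ℂ} (hz : z ∈ Pd) : 1 + z ∈ slitPlane := by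
  have h := hz.1
  have h2 := abs_le.1 ((Complex.abs_re_le_norm z).trans h)
  by_cases him : z.im = 0
  · left
    rcases eq_or_lt_of_le h2.1 with h3 | h3
    · exfalso; apply hz.2; apply Complex.ext <;> simp [him, ← h3]
    · simp; linarith
  · right; simpa using him

lemma Eu_bound (ν a b p : ℝ) (ha : 0 < a) (hp : 0 ≤ p) (hνp : ν + p < 1) (hpb : p ≤ b) :
    ∃ C : ℝ, 0 < C ∧ ∀ z ∈ Pd, ‖Eu ν a b z‖ ≤ C * dd z ^ (-(b - p)) := by
  have hI := w_int (ν + p) a ha hνp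
  have hnn : 0 ≤ ∫ s in Set.Ioo (0:ℝ) 1, s^(a-1) * (1-s)^(-(ν+p)) :=
    MeasureTheory.setIntegral_nonneg measurableSet_Ioo (fun s hs => w_nonneg _ _ hs)
  refine ⟨(∫ s in Set.Ioo (0:ℝ) 1, s^(a-1) * (1-s)^(-(ν+p))) * 2^(b-p) + 1, by positivity, ?_⟩
  intro z hz
  have hd := Pd_pos hz
  have hdn : 0 ≤ dd z ^ (-(b - p)) := Real.rpow_nonneg hd.le _
  have hb1 : ‖Eu ν a b z‖ ≤ ∫ s in Set.Ioo (0:ℝ) 1, (s^(a-1) * (1-s)^(-(ν+p))) * (2^(b-p) * dd z ^ (-(b-p))) := by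
    refine MeasureTheory.norm_integral_le_of_norm_le (hI.mul_const _) ?_
    refine (MeasureTheory.ae_restrict_iff' measurableSet_Ioo).2 (Filter.Eventually.of_forall ?_)
    intro s hs
    have h1s : 0 < 1 - s := by linarith [hs.2]
    obtain ⟨l1, l2⟩ := dd_lower hz.1 hs
    have hpos : 0 < ‖1 + s * z‖ := h1s.trans_le l2
    rw [norm_mul, Complex.norm_real, Real.norm_of_nonneg (w_nonneg ν _ hs), Complex.norm_cpow_real]
    have e1 : ‖1 + s * z‖ ^ (-b) = ‖1 + s * z‖^(-p) * ‖1 + s * z‖^(-(b-p)) := by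
      rw [← Real.rpow_add hpos]; congr 1; ring
    have e2 : ‖1 + s * z‖^(-p) ≤ (1-s)^(-p) := Real.rpow_le_rpow_of_nonpos h1s l2 (by linarith)
    have e3 : ‖1 + s * z‖^(-(b-p)) ≤ 2^(b-p) * dd z ^ (-(b-p)) := by
      refine (Real.rpow_le_rpow_of_nonpos (by linarith) l1 (by linarith)).trans (le_of_eq ?_)
      rw [Real.div_rpow hd.le (by norm_num), Real.rpow_neg (by norm_num : (0:ℝ) ≤ 2)]
      field_simp
    have e4 : (1-s)^(-(ν+p)) = (1-s)^(-ν) * (1-s)^(-p) := by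
      rw [← Real.rpow_add h1s]; congr 1; ring
    rw [e1, e4]
    have q1 : 0 ≤ s^(a-1) := Real.rpow_nonneg hs.1.le _
    have q2 : 0 ≤ (1-s)^(-ν) := Real.rpow_nonneg h1s.le _
    calc _ ≤ s^(a-1) * (1-s)^(-ν) * ((1-s)^(-p) * (2^(b-p) * dd z ^ (-(b-p)))) := by gcongr
      _ = _ := by ring
  rw [MeasureTheory.integral_mul_const] at hb1
  refine hb1.trans ?_
  nlinarith

lemma Eu_conj (ν a b : ℝ) {z : ℂ} (hz : 1 + z ∈ slitPlane) : Eu ν a b (conj z) = conj (Eu ν a b z) := by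
  unfold Eu
  rw [← integral_conj]
  refine MeasureTheory.setIntegral_congr_fun measurableSet_Ioo ?_
  intro s hs
  have := sl_mem hz (⟨hs.1.le, hs.2.le⟩ : s ∈ Set.Icc (0:ℝ) 1)
  simp only [map_mul, conj_ofReal]
  congr 1
  rw [show 1 + (s:ℂ) * conj z = conj (1 + s * z) by simp, Complex.conj_cpow _ _ (slitPlane_arg_ne_pi this), conj_ofReal]

lemma Eu_real (ν a b : ℝ) {y : ℝ} (hy : 0 ≤ y) :
    Eu ν a b y = ((∫ s in Set.Ioo (0:ℝ) 1, s^(a-1) * (1-s)^(-ν) * (1+s*y)^(-b) : ℝ) : ℂ) := by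
  unfold Eu
  rw [← integral_complex_ofReal]
  refine MeasureTheory.setIntegral_congr_fun measurableSet_Ioo ?_
  intro s hs
  have : 0 ≤ 1 + s * y := by have := mul_nonneg hs.1.le hy; linarith
  simp only
  rw [show (1 + (s:ℂ) * y) = ((1 + s * y : ℝ):ℂ) by push_cast; ring, ← Complex.ofReal_cpow this]
  push_cast; ring

lemma Er_int (ν a b : ℝ) (ha : 0 < a) (hν : ν < 1) (hb : 0 ≤ b) {y : ℝ} (hy : 0 ≤ y) :
    MeasureTheory.IntegrableOn (fun s : ℝ => s^(a-1) * (1-s)^(-ν) * (1+s*y)^(-b)) (Set.Ioo (0:ℝ) 1) := by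
  have hn : MeasureTheory.IntegrableOn (fun s : ℝ => ‖((s^(a-1) * (1-s)^(-ν) : ℝ) : ℂ) * (1 + s * (y:ℂ))^((-b : ℝ):ℂ)‖) (Set.Ioo 0 1) :=
    (Eu_int ν a b ha hν hb (z := (y:ℂ)) (by left; simp; linarith)).norm
  refine MeasureTheory.IntegrableOn.congr_fun hn ?_ measurableSet_Ioo
  intro s hs
  have h1 : 0 ≤ 1 + s * y := by have := mul_nonneg hs.1.le hy; linarith
  simp only
  rw [norm_mul, Complex.norm_real, Real.norm_of_nonneg (w_nonneg ν a hs), Complex.norm_cpow_real,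
    show (1 + (s:ℂ) * y) = ((1 + s * y : ℝ):ℂ) by push_cast; ring, Complex.norm_real, Real.norm_of_nonneg h1]

lemma Er_pos (ν a b : ℝ) (ha : 0 < a) (hν : ν < 1) (hb : 0 ≤ b) {y : ℝ} (hy : 0 ≤ y) :
    0 < ∫ s in Set.Ioo (0:ℝ) 1, s^(a-1) * (1-s)^(-ν) * (1+s*y)^(-b) := by
  have hpos : ∀ s ∈ Set.Ioo (0:ℝ) 1, 0 < s^(a-1) * (1-s)^(-ν) * (1+s*y)^(-b) := by
    intro s hs
    have h1 : 0 < 1 + s * y := by have := mul_nonneg hs.1.le hy; linarith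
    have h2 : 0 < 1 - s := by linarith [hs.2]
    have h3 := hs.1
    positivity
  rw [MeasureTheory.setIntegral_pos_iff_support_of_nonneg_ae]
  · have : Set.Ioo (0:ℝ) 1 ⊆ Function.support (fun s : ℝ => s^(a-1) * (1-s)^(-ν) * (1+s*y)^(-b)) ∩ Set.Ioo 0 1 :=
      fun s hs => ⟨(hpos s hs).ne', hs⟩
    refine lt_of_lt_of_le ?_ (MeasureTheory.measure_mono this)
    simp
  · exact (MeasureTheory.ae_restrict_iff' measurableSet_Ioo).2 (Filter.Eventually.of_forall (fun s hs => (hpos s hs).le))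
  · exact Er_int ν a b ha hν hb hy

lemma upper_int (g : ℂ → ℂ) (hd : DifferentiableOn ℂ g {z | 0 < z.im}) (C r T0 : ℝ) (hC : 0 ≤ C) (hr : r < -1)
    (hb : ∀ z : ℂ, 0 < z.im → T0 ≤ ‖z‖ → ‖g z‖ ≤ C * ‖z‖^r) (ε : ℝ) (hε : 0 < ε)
    (hint : MeasureTheory.Integrable (fun x : ℝ => g (x + ε * I))) : ∫ x : ℝ, g (x + ε * I) = 0 := by
  have h1 := MeasureTheory.intervalIntegral_tendsto_integral hint (Filter.tendsto_neg_atTop_atBot) (Filter.tendsto_id (α := ℝ) (x := Filter.atTop))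
  refine tendsto_nhds_unique h1 ?_
  have h2 : Filter.Tendsto (fun T : ℝ => 4 * C * T^(-(-(r+1)))) Filter.atTop (nhds (4 * C * 0)) :=
    (tendsto_rpow_neg_atTop (by linarith)).const_mul _
  rw [mul_zero] at h2
  refine squeeze_zero_norm' ?_ h2
  filter_upwards [Filter.eventually_ge_atTop T0, Filter.eventually_gt_atTop ε] with T hT hTε
  have hT0 : 0 < T := hε.trans hTε
  have hg : ∀ z : ℂ, 0 < z.im → T ≤ ‖z‖ → ‖g z‖ ≤ C * T^r := fun z hz hzT =>
    (hb z hz (hT.trans hzT)).trans (mul_le_mul_of_nonneg_left (Real.rpow_le_rpow_of_nonpos hT0 hzT (by linarith)) hC)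
  have hrect := Complex.integral_boundary_rect_eq_zero_of_differentiableOn g (⟨-T, ε⟩) (⟨T, T⟩) (hd.mono (by
    rintro z ⟨_, hz⟩
    simp only [Set.mem_preimage, Set.uIcc_of_le hTε.le] at hz
    exact hε.trans_le hz.1))
  simp only at hrect
  have b1 : ‖∫ x : ℝ in (-T)..T, g (x + T * I)‖ ≤ C * T^r * |T - (-T)| := by
    refine intervalIntegral.norm_integral_le_of_norm_le_const (fun x _ => hg _ (by simpa using hT0) ?_)
    have := Complex.abs_im_le_norm (x + T * I)
    simpa [abs_of_pos hT0] using this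
  have b2 : ‖∫ y : ℝ in ε..T, g (T + y * I)‖ ≤ C * T^r * |T - ε| := by
    refine intervalIntegral.norm_integral_le_of_norm_le_const (fun x hx => hg _ ?_ ?_)
    · rw [Set.uIoc_of_le hTε.le] at hx; simpa using hε.trans hx.1
    · have := Complex.abs_re_le_norm (T + x * I)
      simpa [abs_of_pos hT0] using this
  have b3 : ‖∫ y : ℝ in ε..T, g ((-T:ℝ) + y * I)‖ ≤ C * T^r * |T - ε| := by
    refine intervalIntegral.norm_integral_le_of_norm_le_const (fun x hx => hg _ ?_ ?_)
    · rw [Set.uIoc_of_le hTε.le] at hx; simpa using hε.trans hx.1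
    · have := Complex.abs_re_le_norm ((-T:ℝ) + x * I)
      simpa [abs_of_pos hT0] using this
  have heq : (∫ x : ℝ in (-T)..T, g (x + ε * I)) = (∫ x : ℝ in (-T)..T, g (x + T * I)) - I • (∫ y : ℝ in ε..T, g (T + y * I)) + I • (∫ y : ℝ in ε..T, g ((-T:ℝ) + y * I)) := by
    linear_combination hrect
  show ‖∫ x : ℝ in (-T)..T, g (x + ε * I)‖ ≤ _
  rw [heq]
  refine (norm_add_le _ _).trans ?_
  refine (add_le_add_left (norm_sub_le _ _) _).trans ?_
  rw [norm_smul, norm_smul, Complex.norm_I, one_mul, one_mul]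
  have e1 : T^(-(-(r+1))) = T^r * T := by rw [neg_neg, Real.rpow_add_one hT0.ne']
  rw [e1]
  rw [abs_of_pos (by linarith)] at b1 b2 b3
  have hCT : 0 ≤ C * T^r := by positivity
  nlinarith

lemma limU (x r : ℝ) (hx : x ≠ 0) : Filter.Tendsto (fun ε : ℝ => ((x:ℂ) + ε * I)^(r:ℂ)) (nhdsWithin 0 (Set.Ioi 0)) (nhds ((x:ℂ)^(r:ℂ))) := by
  have hlim : Filter.Tendsto (fun ε : ℝ => ((x:ℂ) + ε * I)) (nhdsWithin 0 (Set.Ioi 0)) (nhdsWithin (x:ℂ) {z | 0 ≤ z.im}) := by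
    refine tendsto_nhdsWithin_iff.2 ⟨?_, ?_⟩
    · have : Continuous (fun ε : ℝ => ((x:ℂ) + ε * I)) := by fun_prop
      have := this.tendsto 0
      simp only [ofReal_zero, zero_mul, add_zero] at this
      exact this.mono_left nhdsWithin_le_nhds
    · filter_upwards [self_mem_nhdsWithin] with ε hε
      simpa using (le_of_lt hε)
  rcases lt_or_gt_of_ne hx with h | h
  · have hl := (Complex.continuousWithinAt_log_of_re_neg_of_im_zero (z := (x:ℂ)) (by simpa using h) (by simp)).tendsto.comp hlim
    have h2 := (Complex.continuous_exp.tendsto _).comp (hl.mul_const (r:ℂ))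
    rw [Complex.cpow_def_of_ne_zero (by exact_mod_cast hx)]
    refine h2.congr' ?_
    filter_upwards [self_mem_nhdsWithin] with ε hε
    rw [Complex.cpow_def_of_ne_zero]
    · rfl
    · intro h0
      have := congrArg Complex.im h0
      simp at this
      exact (ne_of_gt hε) this
  · have : ContinuousAt (fun z : ℂ => z^(r:ℂ)) (x:ℂ) := continuousAt_cpow_const (Or.inl (by simpa using h))
    exact this.tendsto.comp (hlim.mono_right nhdsWithin_le_nhds)

lemma limL (x r : ℝ) (hx : x ≠ 0) : Filter.Tendsto (fun ε : ℝ => ((x:ℂ) - ε * I)^(r:ℂ)) (nhdsWithin 0 (Set.Ioi 0)) (nhds (conj ((x:ℂ)^(r:ℂ)))) := by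
  refine ((Complex.continuous_conj.tendsto _).comp (limU x r hx)).congr' ?_
  filter_upwards [self_mem_nhdsWithin] with ε hε
  have hε' : 0 < ε := hε
  have h : (x + ε * I : ℂ) ∈ slitPlane := by right; simpa using hε'.ne'
  have h2 := Complex.conj_cpow (x + ε * I : ℂ) (r:ℂ) (slitPlane_arg_ne_pi h)
  rw [conj_ofReal] at h2
  simp only [Function.comp]
  rw [← h2]
  simp [sub_eq_add_neg]

lemma nb (x y r : ℝ) (hx : x ≠ 0) (hr : r ≤ 0) : ‖((x:ℂ) + y * I)^(r:ℂ)‖ ≤ |x|^r := by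
  rw [Complex.norm_cpow_real]
  refine Real.rpow_le_rpow_of_nonpos (abs_pos.2 hx) ?_ hr
  simpa using Complex.abs_re_le_norm ((x:ℂ) + y * I)

lemma neg_cpow' (x r : ℝ) (hx : x < 0) : (x:ℂ)^(r:ℂ) = exp (Real.pi * r * I) * ((|x|^r : ℝ) : ℂ) := by
  rw [Complex.ofReal_cpow_of_nonpos hx.le, mul_comm, abs_of_neg hx, Complex.ofReal_cpow (by linarith)]
  push_cast; congr 2; ring

lemma pos_cpow' (x r : ℝ) (hx : 0 < x) : (x:ℂ)^(r:ℂ) = ((|x|^r : ℝ) : ℂ) := by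
  rw [abs_of_pos hx, Complex.ofReal_cpow hx.le]

lemma piece (G h f f' : ℝ → ℝ) (c : ℝ) (S : Set ℝ) (hf : ∀ s ∈ Set.Ioo (0:ℝ) 1, HasDerivAt f (f' s) s)
    (hinj : Set.InjOn f (Set.Ioo 0 1)) (him : f '' (Set.Ioo 0 1) = S)
    (heq : ∀ s ∈ Set.Ioo (0:ℝ) 1, |f' s| * G (f s) = c * h s) (hh : MeasureTheory.IntegrableOn h (Set.Ioo 0 1)) :
    MeasureTheory.IntegrableOn G S ∧ ∫ x in S, G x = c * ∫ s in Set.Ioo (0:ℝ) 1, h s := by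
  rw [← him]
  constructor
  · rw [MeasureTheory.integrableOn_image_iff_integrableOn_abs_deriv_smul measurableSet_Ioo (fun s hs => (hf s hs).hasDerivWithinAt) hinj]
    exact MeasureTheory.IntegrableOn.congr_fun (hh.const_mul c) (fun s hs => (heq s hs).symm) measurableSet_Ioo
  · rw [MeasureTheory.integral_image_eq_integral_abs_deriv_smul measurableSet_Ioo (fun s hs => (hf s hs).hasDerivWithinAt) hinj,
      ← MeasureTheory.integral_const_mul]
    exact MeasureTheory.setIntegral_congr_fun measurableSet_Ioo heq

noncomputable def Gf (ν y x : ℝ) : ℝ := |x|^(ν-1/3-1) * |1-x|^(-ν) * |1+x*y|^(-ν)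

noncomputable def Er (ν a y : ℝ) : ℝ := ∫ s in Set.Ioo (0:ℝ) 1, s^(a-1) * (1-s)^(-ν) * (1+s*y)^(-ν)


lemma Gp1 (ν y : ℝ) (hν : 1/3 < ν) (hν1 : ν < 1) (hy : 0 < y) : MeasureTheory.IntegrableOn (Gf ν y) (Set.Ioo 0 1) ∧ ∫ x in Set.Ioo 0 1, Gf ν y x = Er ν (ν-1/3) y := by
  have := piece (Gf ν y) (fun s => s^(ν-1/3-1) * (1-s)^(-ν) * (1+s*y)^(-ν)) id (fun _ => 1) 1 (Set.Ioo 0 1)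
    (fun s _ => hasDerivAt_id s) (Set.injOn_id _) (Set.image_id _) ?_ (Er_int ν _ ν (by linarith) hν1 (by linarith) hy.le)
  · simpa [Er] using this
  · intro s hs
    have h1 : 0 < 1 - s := by linarith [hs.2]
    have h2 : 0 < 1 + s * y := by have := mul_pos hs.1 hy; linarith
    simp only [Gf, id, abs_one, abs_of_pos hs.1, abs_of_pos h1, abs_of_pos h2]

lemma Gp2 (ν y : ℝ) (hν : 1/3 < ν) (hν1 : ν < 1) (hy : 0 < y) : MeasureTheory.IntegrableOn (Gf ν y) (Set.Ioi 1) := by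
  refine (piece (Gf ν y) (fun s => s^(ν-1/3+2/3-1) * (1-s)^(-ν) * (1+s*(1/y))^(-ν)) (fun s => s⁻¹) (fun s => -(s^2)⁻¹) (y^(-ν)) (Set.Ioi 1)
    (fun s hs => hasDerivAt_inv hs.1.ne') (inv_injective.injOn) ?_ ?_ (Er_int ν _ ν (by linarith) hν1 (by linarith) (by positivity))).1
  · ext x
    constructor
    · rintro ⟨s, hs, rfl⟩
      exact (one_lt_inv₀ hs.1).2 hs.2
    · intro hx
      have hx1 : 1 < x := hx
      exact ⟨x⁻¹, ⟨by positivity, inv_lt_one_of_one_lt₀ hx1⟩, inv_inv x⟩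
  · intro s hs
    have h0 := hs.1
    have h1 : 0 < 1 - s := by linarith [hs.2]
    have h2 : 0 < 1 + s * (1/y) := by positivity
    have e1 : |1 - s⁻¹| = (1 - s) / s := by
      rw [abs_of_neg]; · field_simp; ring
      have := (one_lt_inv₀ h0).2 hs.2
      linarith
    have e2 : |1 + s⁻¹ * y| = y * (1 + s * (1/y)) / s := by
      rw [abs_of_pos (by positivity)]; field_simp; ring
    have e3 : |s⁻¹| = s⁻¹ := abs_of_pos (by positivity)
    have e4 : |-(s^2)⁻¹| = s^(-2:ℝ) := by
      rw [abs_neg, abs_of_pos (by positivity), Real.rpow_neg h0.le]; norm_cast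
    simp only [Gf]
    rw [e1, e2, e3, e4, Real.div_rpow h1.le h0.le, Real.div_rpow (by positivity) h0.le, Real.mul_rpow hy.le h2.le, Real.inv_rpow h0.le]
    have e5 : s^(ν-1/3+2/3-1) = s^(-2:ℝ) * (s^(ν-1/3-1))⁻¹ * (s^(-ν))⁻¹ * (s^(-ν))⁻¹ := by
      rw [← Real.rpow_neg h0.le, ← Real.rpow_neg h0.le, ← Real.rpow_add h0, ← Real.rpow_add h0, ← Real.rpow_add h0]; congr 1; ring
    rw [e5]
    field_simp

lemma Gp3 (ν y : ℝ) (hν : 1/3 < ν) (hν1 : ν < 1) (hy : 0 < y) : MeasureTheory.IntegrableOn (Gf ν y) (Set.Ioo (-(1/y)) 0) ∧ ∫ x in Set.Ioo (-(1/y)) 0, Gf ν y x = y^(-(ν-1/3)) * Er ν (ν-1/3) (1/y) := by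
  refine (piece (Gf ν y) (fun s => s^(ν-1/3-1) * (1-s)^(-ν) * (1+s*(1/y))^(-ν)) (fun s => -(s * (1/y))) (fun s => -(1/y)) (y^(-(ν-1/3))) (Set.Ioo (-(1/y)) 0)
    (fun s hs => (((hasDerivAt_id s).mul_const (1/y)).neg).congr_deriv (by simp)) ?_ ?_ ?_ (Er_int ν _ ν (by linarith) hν1 (by linarith) (by positivity)))
  · intro a _ b _ hab
    have hy' := hy.ne'
    simp only at hab
    field_simp at hab
    linarith
  · ext x
    constructor
    · rintro ⟨s, hs, rfl⟩
      have h0 := hs.1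
      have h1 : 0 < 1 / y := by positivity
      have h2 : s * (1/y) < 1 * (1/y) := by gcongr; exact hs.2
      have h3 : 0 < s * (1/y) := by positivity
      constructor <;> simp only <;> linarith
    · intro hx
      refine ⟨-(x * y), ⟨?_, ?_⟩, ?_⟩
      · have := mul_pos_of_neg_of_neg hx.2 (neg_lt_zero.2 hy); linarith
      · have h4 := mul_lt_mul_of_pos_right hx.1 hy
        have : -(1/y) * y = -1 := by field_simp
        linarith
      · simp only; field_simp
  · intro s hs
    have h0 := hs.1
    have h1 : 0 < 1 - s := by linarith [hs.2]
    have e0 : |-(s * (1/y))| = s / y := by rw [abs_neg, abs_of_pos (by positivity)]; ring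
    have e1 : |1 - -(s * (1/y))| = 1 + s * (1/y) := by
      rw [sub_neg_eq_add, abs_of_pos (by positivity)]
    have e2 : |1 + -(s*(1/y)) * y| = 1 - s := by
      rw [show 1 + -(s*(1/y)) * y = 1 - s by field_simp; ring, abs_of_pos h1]
    have e4 : |-(1/y)| = y^(-1:ℝ) := by
      rw [abs_neg, abs_of_pos (by positivity), Real.rpow_neg_one, one_div]
    simp only [Gf]
    rw [e0, e1, e2, e4, Real.div_rpow h0.le hy.le]
    have e5 : y^(-(ν-1/3)) = y^(-1:ℝ) * (y^(ν-1/3-1))⁻¹ := by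
      rw [← Real.rpow_neg hy.le, ← Real.rpow_add hy]; congr 1; ring
    rw [e5]
    field_simp

lemma Gp4 (ν y : ℝ) (hν : 1/3 < ν) (hν1 : ν < 1) (hy : 0 < y) : MeasureTheory.IntegrableOn (Gf ν y) (Set.Iio (-(1/y))) ∧ ∫ x in Set.Iio (-(1/y)), Gf ν y x = y^(1/3:ℝ) * Er ν (ν-1/3+2/3) y := by
  refine (piece (Gf ν y) (fun s => s^(ν-1/3+2/3-1) * (1-s)^(-ν) * (1+s*y)^(-ν)) (fun s => -(s⁻¹ * (1/y))) (fun s => -(-(s^2)⁻¹ * (1/y))) (y^(1/3:ℝ)) (Set.Iio (-(1/y)))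
    (fun s hs => ((hasDerivAt_inv hs.1.ne').mul_const (1/y)).neg) ?_ ?_ ?_ (Er_int ν _ ν (by linarith) hν1 (by linarith) hy.le))
  · intro a ha b hb hab
    have hy' := hy.ne'
    have := ha.1.ne'
    have := hb.1.ne'
    simp only at hab
    field_simp at hab
    linarith
  · ext x
    constructor
    · rintro ⟨s, hs, rfl⟩
      have h0 := hs.1
      have h1 : 0 < 1 / y := by positivity
      have h2 : 1 * (1/y) < s⁻¹ * (1/y) := by gcongr; exact (one_lt_inv₀ hs.1).2 hs.2
      show -(s⁻¹ * (1/y)) < -(1/y)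
      linarith
    · intro hx
      have hx : x < -(1/y) := hx
      have h4 := mul_lt_mul_of_pos_right hx hy
      have h5 : -(1/y) * y = -1 := by field_simp
      have h6 : 1 < -(x * y) := by linarith
      refine ⟨(-(x * y))⁻¹, ⟨by positivity, inv_lt_one_of_one_lt₀ h6⟩, ?_⟩
      simp only [inv_inv]; field_simp
  · intro s hs
    have h0 := hs.1
    have h1 : 0 < 1 - s := by linarith [hs.2]
    have hi := (one_lt_inv₀ hs.1).2 hs.2
    have e0 : |-(s⁻¹ * (1/y))| = (s * y)⁻¹ := by rw [abs_neg, abs_of_pos (by positivity)]; field_simp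
    have e1 : |1 - -(s⁻¹ * (1/y))| = (1 + s * y) / (s * y) := by
      rw [sub_neg_eq_add, abs_of_pos (by positivity)]; field_simp; ring
    have e2 : |1 + -(s⁻¹*(1/y)) * y| = (1 - s) / s := by
      rw [show 1 + -(s⁻¹*(1/y)) * y = 1 - s⁻¹ by field_simp; ring, abs_of_neg (by linarith)]; field_simp; ring
    have e4 : |-(-(s^2)⁻¹ * (1/y))| = s^(-2:ℝ) * y^(-1:ℝ) := by
      rw [neg_mul, neg_neg, abs_of_pos (by positivity), Real.rpow_neg_one, one_div, Real.rpow_neg h0.le]; norm_cast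
    simp only [Gf]
    rw [e0, e1, e2, e4, Real.div_rpow h1.le h0.le, Real.div_rpow (by positivity) (by positivity), Real.inv_rpow (by positivity),
      Real.mul_rpow h0.le hy.le, Real.mul_rpow h0.le hy.le]
    have e5 : s^(ν-1/3+2/3-1) = s^(-2:ℝ) * (s^(ν-1/3-1))⁻¹ * (s^(-ν))⁻¹ * (s^(-ν))⁻¹ := by
      rw [← Real.rpow_neg h0.le, ← Real.rpow_neg h0.le, ← Real.rpow_add h0, ← Real.rpow_add h0, ← Real.rpow_add h0]; congr 1; ring
    have e6 : y^(1/3:ℝ) = y^(-1:ℝ) * (y^(ν-1/3-1))⁻¹ * (y^(-ν))⁻¹ := by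
      rw [← Real.rpow_neg hy.le, ← Real.rpow_neg hy.le, ← Real.rpow_add hy, ← Real.rpow_add hy]; congr 1; ring
    rw [e5, e6]
    field_simp

lemma split4 {E : Type*} [NormedAddCommGroup E] [NormedSpace ℝ E] (f : ℝ → E) (a : ℝ) (ha : a < 0) (h1 : MeasureTheory.IntegrableOn f (Set.Iio a)) (h2 : MeasureTheory.IntegrableOn f (Set.Ioo a 0))
    (h3 : MeasureTheory.IntegrableOn f (Set.Ioo 0 1)) (h4 : MeasureTheory.IntegrableOn f (Set.Ioi 1)) :
    MeasureTheory.Integrable f ∧ ∫ x, f x = (∫ x in Set.Iio a, f x) + (∫ x in Set.Ioo a 0, f x) + (∫ x in Set.Ioo 0 1, f x) + ∫ x in Set.Ioi 1, f x := by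
  rw [← integrableOn_Iic_iff_integrableOn_Iio] at h1
  rw [← integrableOn_Ioc_iff_integrableOn_Ioo] at h2 h3
  have u1 : Set.Iic a ∪ Set.Ioc a 0 = Set.Iic 0 := Set.Iic_union_Ioc_eq_Iic ha.le
  have u2 : Set.Iic (0:ℝ) ∪ Set.Ioc 0 1 = Set.Iic 1 := Set.Iic_union_Ioc_eq_Iic zero_le_one
  have u3 : Set.Iic (1:ℝ) ∪ Set.Ioi 1 = Set.univ := Set.Iic_union_Ioi
  have i1 : MeasureTheory.IntegrableOn f (Set.Iic 0) := u1 ▸ h1.union h2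
  have i2 : MeasureTheory.IntegrableOn f (Set.Iic 1) := u2 ▸ i1.union h3
  have i3 : MeasureTheory.IntegrableOn f Set.univ := u3 ▸ i2.union h4
  refine ⟨MeasureTheory.integrableOn_univ.1 i3, ?_⟩
  rw [← MeasureTheory.setIntegral_univ, ← u3, MeasureTheory.setIntegral_union (Set.Iic_disjoint_Ioi le_rfl) measurableSet_Ioi i2 h4,
    ← u2, MeasureTheory.setIntegral_union (Set.Iic_disjoint_Ioc le_rfl) measurableSet_Ioc i1 h3, ← u1,
    MeasureTheory.setIntegral_union (Set.Iic_disjoint_Ioc le_rfl) measurableSet_Ioc h1 h2,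
    MeasureTheory.integral_Iic_eq_integral_Iio, MeasureTheory.integral_Ioc_eq_integral_Ioo, MeasureTheory.integral_Ioc_eq_integral_Ioo]

noncomputable def gc (ν y : ℝ) (z : ℂ) : ℂ := z^((ν-1/3-1:ℝ):ℂ) * (1-z)^((-ν:ℝ):ℂ) * (1+z*y)^((-ν:ℝ):ℂ)
noncomputable def g0 (ν y : ℝ) (x : ℝ) : ℂ := (x:ℂ)^((ν-1/3-1:ℝ):ℂ) * conj (((1-x:ℝ):ℂ)^((-ν:ℝ):ℂ)) * ((1+x*y:ℝ):ℂ)^((-ν:ℝ):ℂ)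

lemma gc_diff (ν y : ℝ) (hy : 0 < y) : DifferentiableOn ℂ (gc ν y) {z | 0 < z.im} := by
  intro z hz
  have hz : 0 < z.im := hz
  refine DifferentiableAt.differentiableWithinAt ?_
  unfold gc
  refine DifferentiableAt.mul (DifferentiableAt.mul ?_ ?_) ?_
  · exact differentiableAt_id.cpow_const (Or.inr hz.ne')
  · exact DifferentiableAt.cpow_const (by fun_prop) (Or.inr (by simpa using hz.ne'))
  · exact DifferentiableAt.cpow_const (by fun_prop) (Or.inr (by simpa using ⟨hz.ne', hy.ne'⟩))

lemma gc_bound (ν y : ℝ) (hν : 1/3 < ν) (hy : 0 < y) (z : ℂ) (hT : max 2 (2/y) ≤ ‖z‖) :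
    ‖gc ν y z‖ ≤ ((1/2)^(-ν) * (y/2)^(-ν)) * ‖z‖^(-4/3-ν) := by
  have h1 : 2 ≤ ‖z‖ := (le_max_left _ _).trans hT
  have h2 : 2/y ≤ ‖z‖ := (le_max_right _ _).trans hT
  have h2' : 2 ≤ ‖z‖ * y := by rwa [div_le_iff₀ hy] at h2
  have hz : 0 < ‖z‖ := by linarith
  have b1 : 1/2 * ‖z‖ ≤ ‖1 - z‖ := by
    have := norm_sub_norm_le z 1
    rw [norm_one, norm_sub_rev] at this; linarith
  have b2 : y/2 * ‖z‖ ≤ ‖1 + z * y‖ := by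
    have := norm_sub_le (1 + z * y) 1
    rw [norm_one, add_sub_cancel_left, norm_mul, Complex.norm_real, Real.norm_of_nonneg hy.le] at this
    linarith
  unfold gc
  rw [norm_mul, norm_mul, Complex.norm_cpow_real, Complex.norm_cpow_real, Complex.norm_cpow_real]
  have c1 := Real.rpow_le_rpow_of_nonpos (z := -ν) (by positivity) b1 (by linarith)
  have c2 := Real.rpow_le_rpow_of_nonpos (z := -ν) (by positivity) b2 (by linarith)
  rw [Real.mul_rpow (by norm_num) hz.le] at c1
  rw [Real.mul_rpow (by positivity) hz.le] at c2
  have e : ‖z‖^(-4/3-ν) = ‖z‖^(ν-1/3-1) * ‖z‖^(-ν) * ‖z‖^(-ν) := by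
    rw [← Real.rpow_add hz, ← Real.rpow_add hz]; congr 1; ring
  rw [e]
  have n1 : 0 ≤ ‖z‖^(ν-1/3-1) := by positivity
  calc _ ≤ ‖z‖^(ν-1/3-1) * ((1/2)^(-ν) * ‖z‖^(-ν)) * ((y/2)^(-ν) * ‖z‖^(-ν)) := by
        refine mul_le_mul (mul_le_mul_of_nonneg_left c1 n1) c2 (by positivity) (by positivity)
    _ = _ := by ring

lemma gc_le (ν y : ℝ) (hν : 1/3 < ν) (hν1 : ν < 1) (hy : 0 < y) (ε x : ℝ) (h0 : x ≠ 0) (h1 : x ≠ 1) (h2 : x ≠ -(1/y)) :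
    ‖gc ν y (x + ε * I)‖ ≤ Gf ν y x := by
  have h2' : 1 + x * y ≠ 0 := by
    intro h; apply h2; field_simp; linarith
  unfold gc Gf
  rw [norm_mul, norm_mul]
  have c1 := nb x ε (ν-1/3-1) h0 (by linarith)
  have c2 := nb (1-x) (-ε) (-ν) (sub_ne_zero.2 h1.symm) (by linarith)
  have c3 := nb (1+x*y) (ε*y) (-ν) h2' (by linarith)
  rw [show ((1-x:ℝ):ℂ) + ((-ε:ℝ):ℂ) * I = 1 - (x + ε * I) by push_cast; ring] at c2
  rw [show ((1+x*y:ℝ):ℂ) + ((ε*y:ℝ):ℂ) * I = 1 + (x + ε * I) * y by push_cast; ring] at c3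
  gcongr

lemma gc_lim (ν y : ℝ) (hy : 0 < y) (x : ℝ) (h0 : x ≠ 0) (h1 : x ≠ 1) (h2 : x ≠ -(1/y)) :
    Filter.Tendsto (fun ε : ℝ => gc ν y (x + ε * I)) (nhdsWithin 0 (Set.Ioi 0)) (nhds (g0 ν y x)) := by
  have h2' : 1 + x * y ≠ 0 := by
    intro h; apply h2; field_simp; linarith
  unfold gc g0
  refine ((limU x _ h0).mul ?_).mul ?_
  · refine (limL (1-x) (-ν) (sub_ne_zero.2 h1.symm)).congr ?_
    intro ε; congr 1; push_cast; ring
  · have hm : Filter.Tendsto (fun ε : ℝ => ε * y) (nhdsWithin 0 (Set.Ioi 0)) (nhdsWithin 0 (Set.Ioi 0)) := by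
      refine tendsto_nhdsWithin_iff.2 ⟨?_, ?_⟩
      · have : Continuous (fun ε : ℝ => ε * y) := by fun_prop
        have := this.tendsto 0
        simp only [zero_mul] at this
        exact this.mono_left nhdsWithin_le_nhds
      · filter_upwards [self_mem_nhdsWithin] with ε hε
        exact mul_pos hε hy
    refine ((limU (1+x*y) (-ν) h2').comp hm).congr ?_
    intro ε; simp only [Function.comp]; congr 1; push_cast; ring

lemma Gf_int (ν y : ℝ) (hν : 1/3 < ν) (hν1 : ν < 1) (hy : 0 < y) : MeasureTheory.Integrable (Gf ν y) :=
  (split4 (Gf ν y) (-(1/y)) (by have : 0 < 1/y := by positivity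
                                linarith) (Gp4 ν y hν hν1 hy).1 (Gp3 ν y hν hν1 hy).1 (Gp1 ν y hν hν1 hy).1 (Gp2 ν y hν hν1 hy)).1

lemma ae_ne3 (a b c : ℝ) : ∀ᵐ x : ℝ, x ≠ a ∧ x ≠ b ∧ x ≠ c := by
  have h (a : ℝ) : ∀ᵐ x : ℝ, x ≠ a := by
    simp [MeasureTheory.ae_iff]
  filter_upwards [h a, h b, h c] with x h1 h2 h3
  exact ⟨h1, h2, h3⟩

lemma g0_zero (ν y : ℝ) (hν : 1/3 < ν) (hν1 : ν < 1) (hy : 0 < y) : ∫ x, g0 ν y x = 0 := by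
  have hcont : ∀ ε : ℝ, 0 < ε → Continuous (fun x : ℝ => gc ν y (x + ε * I)) := by
    intro ε hε
    exact (gc_diff ν y hy).continuousOn.comp_continuous (by fun_prop) (fun x => by simpa using hε)
  have hle : ∀ ε : ℝ, ∀ᵐ x : ℝ, ‖gc ν y (x + ε * I)‖ ≤ Gf ν y x := by
    intro ε
    filter_upwards [ae_ne3 0 1 (-(1/y))] with x hx
    exact gc_le ν y hν hν1 hy ε x hx.1 hx.2.1 hx.2.2
  have hz : ∀ ε : ℝ, 0 < ε → ∫ x : ℝ, gc ν y (x + ε * I) = 0 := by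
    intro ε hε
    refine upper_int (gc ν y) (gc_diff ν y hy) _ (-4/3-ν) (max 2 (2/y)) (by positivity) (by linarith) (fun z _ hz => gc_bound ν y hν hy z hz) ε hε ?_
    exact (Gf_int ν y hν hν1 hy).mono' (hcont ε hε).aestronglyMeasurable (hle ε)
  have hlim := MeasureTheory.tendsto_integral_filter_of_dominated_convergence (μ := MeasureTheory.volume) (l := nhdsWithin (0:ℝ) (Set.Ioi 0))
    (F := fun (ε x : ℝ) => gc ν y (x + ε * I)) (f := g0 ν y) (Gf ν y)
    (by filter_upwards [self_mem_nhdsWithin] with ε hε using (hcont ε hε).aestronglyMeasurable)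
    (Filter.Eventually.of_forall hle) (Gf_int ν y hν hν1 hy)
    (by filter_upwards [ae_ne3 0 1 (-(1/y))] with x hx using gc_lim ν y hy x hx.1 hx.2.1 hx.2.2)
  refine tendsto_nhds_unique hlim (tendsto_const_nhds.congr' ?_)
  filter_upwards [self_mem_nhdsWithin] with ε hε
  exact (hz ε hε).symm

lemma phase_piece (f : ℝ → ℂ) (G : ℝ → ℝ) (S : Set ℝ) (hS : MeasurableSet S) (c : ℂ) (h : ∀ x ∈ S, f x = c * (G x : ℂ))
    (hG : MeasureTheory.IntegrableOn G S) : MeasureTheory.IntegrableOn f S ∧ ∫ x in S, f x = c * ((∫ x in S, G x : ℝ) : ℂ) := by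
  constructor
  · have : MeasureTheory.IntegrableOn (fun x => c * (G x : ℂ)) S := MeasureTheory.Integrable.const_mul (hG.ofReal) c
    exact MeasureTheory.IntegrableOn.congr_fun this (fun x hx => (h x hx).symm) hS
  · rw [MeasureTheory.setIntegral_congr_fun hS h, MeasureTheory.integral_const_mul, integral_complex_ofReal]

lemma connect (ν y : ℝ) (hν : 1/3 < ν) (hν1 : ν < 1) (hy : 0 < y) :
    Real.sin (Real.pi * ν) * Er ν (ν-1/3) y = (Real.sqrt 3 / 2) * (y^(-(ν-1/3)) * Er ν (ν-1/3) (1/y))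
      + Real.sin (2*Real.pi/3 - Real.pi * ν) * (y^(1/3:ℝ) * Er ν (ν-1/3+2/3) y) := by
  have hy1 : 0 < 1/y := by positivity
  have hyy : -(1/y) * y = -1 := by field_simp
  have ha : -(1/y) < 0 := by linarith
  have q4 := phase_piece (g0 ν y) (Gf ν y) (Set.Iio (-(1/y))) measurableSet_Iio (exp (Real.pi * (ν-1/3-1:ℝ) * I) * exp (Real.pi * (-ν:ℝ) * I)) (by
    intro x hx
    have hx : x < -(1/y) := hx
    have h3 : 1 + x * y < 0 := by
      have := mul_lt_mul_of_pos_right hx hy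
      linarith
    unfold g0 Gf
    rw [neg_cpow' x _ (by linarith), pos_cpow' (1-x) _ (by linarith), neg_cpow' (1+x*y) _ h3, conj_ofReal]
    push_cast; ring) (Gp4 ν y hν hν1 hy).1
  have q3 := phase_piece (g0 ν y) (Gf ν y) (Set.Ioo (-(1/y)) 0) measurableSet_Ioo (exp (Real.pi * (ν-1/3-1:ℝ) * I)) (by
    intro x hx
    have h3 : 0 < 1 + x * y := by
      have := mul_lt_mul_of_pos_right hx.1 hy
      linarith
    unfold g0 Gf
    rw [neg_cpow' x _ hx.2, pos_cpow' (1-x) _ (by linarith [hx.2]), pos_cpow' (1+x*y) _ h3, conj_ofReal]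
    push_cast; ring) (Gp3 ν y hν hν1 hy).1
  have q1 := phase_piece (g0 ν y) (Gf ν y) (Set.Ioo 0 1) measurableSet_Ioo 1 (by
    intro x hx
    have h3 : 0 < 1 + x * y := by
      have := mul_pos hx.1 hy
      linarith
    unfold g0 Gf
    rw [pos_cpow' x _ hx.1, pos_cpow' (1-x) _ (by linarith [hx.2]), pos_cpow' (1+x*y) _ h3, conj_ofReal]
    push_cast; ring) (Gp1 ν y hν hν1 hy).1
  have q2 := phase_piece (g0 ν y) (Gf ν y) (Set.Ioi 1) measurableSet_Ioi (exp (Real.pi * ν * I)) (by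
    intro x hx
    have hx : 1 < x := hx
    have h3 : 0 < 1 + x * y := by
      have := mul_pos (by linarith : 0 < x) hy
      linarith
    unfold g0 Gf
    rw [pos_cpow' x _ (by linarith), neg_cpow' (1-x) _ (by linarith), pos_cpow' (1+x*y) _ h3, map_mul, conj_ofReal, ← Complex.exp_conj]
    simp only [map_mul, conj_ofReal, conj_I]
    rw [show (Real.pi:ℂ) * ((-ν:ℝ):ℂ) * -I = Real.pi * ν * I by push_cast; ring]
    push_cast; ring) (Gp2 ν y hν hν1 hy)
  have hs := (split4 (g0 ν y) (-(1/y)) ha q4.1 q3.1 q1.1 q2.1).2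
  rw [g0_zero ν y hν hν1 hy, q4.2, q3.2, q1.2, q2.2, (Gp4 ν y hν hν1 hy).2, (Gp3 ν y hν hν1 hy).2, (Gp1 ν y hν hν1 hy).2] at hs
  generalize (∫ x in Set.Ioi 1, Gf ν y x) = J2 at hs
  generalize y^(1/3:ℝ) * Er ν (ν-1/3+2/3) y = J4 at hs ⊢
  generalize y^(-(ν-1/3)) * Er ν (ν-1/3) (1/y) = J3 at hs ⊢
  generalize Er ν (ν-1/3) y = J1 at hs ⊢
  have hm := congrArg (fun w : ℂ => (exp ((-(Real.pi * ν):ℝ) * I) * w)) hs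
  have hm2 : (0:ℂ) = exp ((-(4*Real.pi/3) - Real.pi*ν :ℝ) * I) * (J4:ℂ) + exp ((-(4*Real.pi/3):ℝ) * I) * (J3:ℂ) + exp ((-(Real.pi * ν):ℝ) * I) * (J1:ℂ) + (J2:ℂ) := by
    have e1 : exp ((-(4*Real.pi/3) - Real.pi*ν :ℝ) * I) = exp ((-(Real.pi * ν):ℝ) * I) * (exp (Real.pi * (ν-1/3-1:ℝ) * I) * exp (Real.pi * (-ν:ℝ) * I)) := by
      rw [← Complex.exp_add, ← Complex.exp_add]; congr 1; push_cast; ring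
    have e2 : exp ((-(4*Real.pi/3):ℝ) * I) = exp ((-(Real.pi * ν):ℝ) * I) * exp (Real.pi * (ν-1/3-1:ℝ) * I) := by
      rw [← Complex.exp_add]; congr 1; push_cast; ring
    have e3 : exp ((-(Real.pi * ν):ℝ) * I) * exp (Real.pi * ν * I) = 1 := by
      rw [← Complex.exp_add, ← Complex.exp_zero]; congr 1; push_cast; ring
    rw [e1, e2]
    simp only [mul_zero] at hm
    linear_combination hm + J2 * e3
  have him := congrArg Complex.im hm2
  simp only [Complex.add_im, Complex.im_mul_ofReal, Complex.exp_ofReal_mul_I_im, Complex.ofReal_im, Complex.zero_im] at him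
  have s1 : Real.sin (-(4*Real.pi/3)) = Real.sqrt 3 / 2 := by
    rw [show -(4*Real.pi/3) = (Real.pi - Real.pi/3) - 2 * Real.pi by ring, Real.sin_sub_two_pi, Real.sin_pi_sub, Real.sin_pi_div_three]
  have s2 : Real.sin (-(4*Real.pi/3) - Real.pi*ν) = Real.sin (2*Real.pi/3 - Real.pi * ν) := by
    rw [show -(4*Real.pi/3) - Real.pi*ν = (2*Real.pi/3 - Real.pi * ν) - 2 * Real.pi by ring, Real.sin_sub_two_pi]
  rw [s1, s2, Real.sin_neg] at him
  linarith

lemma sl_add {z : ℂ} (hz : z ∈ slitPlane) : 1 + z ∈ slitPlane := by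
  rcases hz with h | h
  · left; simp; linarith
  · right; simpa using h

lemma sl_inv {z : ℂ} (hz : z ∈ slitPlane) : z⁻¹ ∈ slitPlane := by
  have h0 : 0 < normSq z := normSq_pos.2 (slitPlane_ne_zero hz)
  rcases hz with h | h
  · left; rw [inv_re]; positivity
  · right; rw [inv_im]; exact div_ne_zero (neg_ne_zero.2 h) h0.ne'

lemma Sc_sl {z : ℂ} (hz : z ∈ Sc) : z ∈ slitPlane := by
  by_cases h : z.im = 0
  · left
    have h1 := hz.1
    have h2 := Complex.sq_norm z
    rw [h1, normSq_apply, h] at h2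
    have h3 : (z.re - 1) * (z.re + 1) = 0 := by nlinarith
    rcases mul_eq_zero.1 h3 with h4 | h4
    · linarith
    · exfalso; apply hz.2; apply Complex.ext <;> simp [h]; linarith
  · right; exact h

lemma Sc_inv {z : ℂ} (hz : z ∈ Sc) : z⁻¹ = conj z := by
  rw [Complex.inv_def, normSq_eq_norm_sq, hz.1]; simp

/- derivative of the H function -/
lemma H_deriv (ν μ t C : ℝ) (hμ : 0 < μ) (hν0 : 0 < ν) (hν1 : ν < 1) {z : ℂ} (hz : z ∈ slitPlane) :
    HasDerivAt (fun z => Eu ν μ ν z - t * (z^((-μ:ℝ):ℂ) * Eu ν μ ν z⁻¹) - C * (z^((1/3:ℝ):ℂ) * Eu ν (μ+2/3) ν z))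
      (-ν * Eu ν (μ+1) (ν+1) z - t * (((-μ:ℝ):ℂ) * z^(((-μ:ℝ):ℂ)-1) * Eu ν μ ν z⁻¹ + z^((-μ:ℝ):ℂ) * ((-ν * Eu ν (μ+1) (ν+1) z⁻¹) * (-(z^2)⁻¹)))
        - C * (((1/3:ℝ):ℂ) * z^(((1/3:ℝ):ℂ)-1) * Eu ν (μ+2/3) ν z + z^((1/3:ℝ):ℂ) * (-ν * Eu ν (μ+2/3+1) (ν+1) z))) z := by
  have he := Eu_deriv ν μ ν hμ hν1 hν0.le (sl_add hz)
  have hei := Eu_deriv ν μ ν hμ hν1 hν0.le (sl_add (sl_inv hz))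
  have hk := Eu_deriv ν (μ+2/3) ν (by linarith) hν1 hν0.le (sl_add hz)
  have hei2 := hei.comp z (hasDerivAt_inv (slitPlane_ne_zero hz))
  have hp1 : HasDerivAt (fun z : ℂ => z^((-μ:ℝ):ℂ)) (((-μ:ℝ):ℂ) * z^(((-μ:ℝ):ℂ)-1)) z := by
    simpa using (hasDerivAt_id z).cpow_const (c := ((-μ:ℝ):ℂ)) hz
  have hp2 : HasDerivAt (fun z : ℂ => z^((1/3:ℝ):ℂ)) (((1/3:ℝ):ℂ) * z^(((1/3:ℝ):ℂ)-1)) z :=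
    ((hasDerivAt_id z).cpow_const (c := ((1/3:ℝ):ℂ)) hz).congr_deriv (by simp)
  exact (he.sub ((hp1.mul hei2).const_mul (t:ℂ))).sub ((hp2.mul hk).const_mul (C:ℂ))

lemma H_zero (ν μ t C : ℝ) (hμ : 0 < μ) (hνμ : μ = ν - 1/3) (hν1 : ν < 1) (hs : 0 < Real.sin (Real.pi * ν))
    (ht : t * Real.sin (Real.pi * ν) = Real.sqrt 3 / 2) (hC : C * Real.sin (Real.pi * ν) = Real.sin (2*Real.pi/3 - Real.pi * ν))
    {z : ℂ} (hz : z ∈ slitPlane) :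
    Eu ν μ ν z - t * (z^((-μ:ℝ):ℂ) * Eu ν μ ν z⁻¹) - C * (z^((1/3:ℝ):ℂ) * Eu ν (μ+2/3) ν z) = 0 := by
  have hd : DifferentiableOn ℂ (fun z => Eu ν μ ν z - t * (z^((-μ:ℝ):ℂ) * Eu ν μ ν z⁻¹) - C * (z^((1/3:ℝ):ℂ) * Eu ν (μ+2/3) ν z)) slitPlane :=
    fun w hw => (H_deriv ν μ t C hμ (by linarith) hν1 hw).differentiableAt.differentiableWithinAt
  have han := hd.analyticOnNhd isOpen_slitPlane
  have hpc : IsPreconnected slitPlane := (starConvex_one_slitPlane).isPathConnected one_mem_slitPlane |>.isConnected.isPreconnected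
  have hreal : ∀ y : ℝ, 0 < y → Eu ν μ ν y - t * ((y:ℂ)^((-μ:ℝ):ℂ) * Eu ν μ ν (y:ℂ)⁻¹) - C * ((y:ℂ)^((1/3:ℝ):ℂ) * Eu ν (μ+2/3) ν y) = 0 := by
    intro y hy
    have hc := connect ν y (by linarith) hν1 hy
    rw [← hνμ, ← ht, ← hC] at hc
    rw [show (y:ℂ)⁻¹ = ((1/y:ℝ):ℂ) by push_cast; rw [one_div], Eu_real ν μ ν hy.le, Eu_real ν (μ+2/3) ν hy.le, Eu_real ν μ ν (y := 1/y) (by positivity),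
      ← Complex.ofReal_cpow hy.le, ← Complex.ofReal_cpow hy.le]
    have hc' : Er ν μ y - t * (y^(-μ) * Er ν μ (1/y)) - C * (y^(1/3:ℝ) * Er ν (μ+2/3) y) = 0 := by
      have : Real.sin (Real.pi * ν) * (Er ν μ y - t * (y^(-μ) * Er ν μ (1/y)) - C * (y^(1/3:ℝ) * Er ν (μ+2/3) y)) = 0 := by
        linear_combination hc
      exact (mul_eq_zero.1 this).resolve_left hs.ne'
    have := congrArg (fun r : ℝ => (r:ℂ)) hc'
    push_cast at this
    simpa [Er] using this
  have hfreq : ∃ᶠ w in nhdsWithin (1:ℂ) {1}ᶜ, (fun z => Eu ν μ ν z - t * (z^((-μ:ℝ):ℂ) * Eu ν μ ν z⁻¹) - C * (z^((1/3:ℝ):ℂ) * Eu ν (μ+2/3) ν z)) w = 0 := by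
    have hseq : Filter.Tendsto (fun n : ℕ => ((1 + 1/((n:ℝ)+1) : ℝ):ℂ)) Filter.atTop (nhdsWithin (1:ℂ) {1}ᶜ) := by
      refine tendsto_nhdsWithin_iff.2 ⟨?_, Filter.Eventually.of_forall ?_⟩
      · have h1 := (tendsto_one_div_add_atTop_nhds_zero_nat (𝕜 := ℝ)).const_add 1
        have h2 := (Complex.continuous_ofReal.tendsto _).comp h1
        simp only [add_zero, ofReal_one] at h2
        exact h2
      · intro n h
        have h : ((1 + 1/((n:ℝ)+1) : ℝ):ℂ) = 1 := h
        have h' : (1 + 1/((n:ℝ)+1) : ℝ) = 1 := by exact_mod_cast h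
        have : 0 < 1/((n:ℝ)+1) := by positivity
        linarith
    refine hseq.frequently (Filter.Frequently.of_forall ?_)
    intro n
    exact hreal _ (by positivity)
  exact han.eqOn_zero_of_preconnected_of_frequently_eq_zero hpc one_mem_slitPlane hfreq hz

lemma R0c (ν μ t C : ℝ) (hμ : 0 < μ) (hνμ : μ = ν - 1/3) (hν1 : ν < 1) (hs : 0 < Real.sin (Real.pi * ν))
    (ht : t * Real.sin (Real.pi * ν) = Real.sqrt 3 / 2) (hC : C * Real.sin (Real.pi * ν) = Real.sin (2*Real.pi/3 - Real.pi * ν))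
    {z : ℂ} (hz : z ∈ Sc) :
    Eu ν μ ν z - t * z^((-μ:ℝ):ℂ) * conj (Eu ν μ ν z) = C * z^((1/3:ℝ):ℂ) * Eu ν (μ+2/3) ν z := by
  have h := H_zero ν μ t C hμ hνμ hν1 hs ht hC (Sc_sl hz)
  rw [Sc_inv hz, Eu_conj ν μ ν (sl_add (Sc_sl hz))] at h
  linear_combination h

lemma R1c (ν μ t C : ℝ) (hμ : 0 < μ) (hνμ : μ = ν - 1/3) (hν1 : ν < 1) (hs : 0 < Real.sin (Real.pi * ν))
    (ht : t * Real.sin (Real.pi * ν) = Real.sqrt 3 / 2) (hC : C * Real.sin (Real.pi * ν) = Real.sin (2*Real.pi/3 - Real.pi * ν))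
    {z : ℂ} (hz : z ∈ Sc) :
    (z * (-ν * Eu ν (μ+1) (ν+1) z) + (μ/2) * Eu ν μ ν z) + t * z^((-μ:ℝ):ℂ) * conj (z * (-ν * Eu ν (μ+1) (ν+1) z) + (μ/2) * Eu ν μ ν z)
      = C * z^((1/3:ℝ):ℂ) * (z * (-ν * Eu ν (μ+2/3+1) (ν+1) z) + (μ/2 + 1/3) * Eu ν (μ+2/3) ν z) := by
  have hsl := Sc_sl hz
  have h0 := R0c ν μ t C hμ hνμ hν1 hs ht hC hz
  have hd := H_deriv ν μ t C hμ (by linarith) hν1 hsl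
  have hd0 : HasDerivAt (fun z => Eu ν μ ν z - t * (z^((-μ:ℝ):ℂ) * Eu ν μ ν z⁻¹) - C * (z^((1/3:ℝ):ℂ) * Eu ν (μ+2/3) ν z)) 0 z := by
    refine (hasDerivAt_const z (0:ℂ)).congr_of_eventuallyEq ?_
    filter_upwards [isOpen_slitPlane.mem_nhds hsl] with w hw
    exact H_zero ν μ t C hμ hνμ hν1 hs ht hC hw
  have hu := hd.unique hd0
  have hz0 := slitPlane_ne_zero hsl
  rw [Complex.cpow_sub _ _ hz0, Complex.cpow_sub _ _ hz0, Complex.cpow_one, Sc_inv hz, Eu_conj ν μ ν (sl_add hsl), Eu_conj ν (μ+1) (ν+1) (sl_add hsl)] at hu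
  have hcz : conj z * z = 1 := by rw [← Sc_inv hz]; exact inv_mul_cancel₀ hz0
  have hzz : (z^2)⁻¹ = (conj z)^2 := by rw [← Sc_inv hz, inv_pow]
  have hdiv : ∀ w : ℂ, w / z = w * conj z := fun w => by rw [div_eq_mul_inv, Sc_inv hz]
  rw [hzz, hdiv, hdiv] at hu
  simp only [map_add, map_mul, map_neg, conj_ofReal, map_div₀, Complex.conj_ofNat]
  push_cast at hu h0 ⊢
  generalize z^(-(μ:ℂ)) = A at *
  generalize z^((1:ℂ)/3) = B at *
  generalize Eu ν μ ν z = e at *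
  generalize Eu ν (μ+1) (ν+1) z = e' at *
  generalize Eu ν (μ+2/3) ν z = k at *
  generalize Eu ν (μ+2/3+1) (ν+1) z = k' at *
  generalize conj e' = e'c at *
  generalize conj e = ec at *
  generalize conj z = zc at *
  linear_combination z * hu + (μ/2) * h0 + (C*B*k/3 - t * μ * A * ec + t * ν * A * e'c * zc) * hcz

/-- power-type bound on the punctured disc -/
def Bdd' (q : ℝ) (u : ℂ → ℂ) : Prop := ∃ C : ℝ, 0 ≤ C ∧ ∀ z ∈ Pd, ‖u z‖ ≤ C * dd z ^ q

lemma Bdd'.mul {q r : ℝ} {u v : ℂ → ℂ} (hu : Bdd' q u) (hv : Bdd' r v) : Bdd' (q + r) (fun z => u z * v z) := by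
  obtain ⟨C, hC, h⟩ := hu
  obtain ⟨D, hD, h'⟩ := hv
  refine ⟨C * D, by positivity, fun z hz => ?_⟩
  have hd := Pd_pos hz
  rw [norm_mul, Real.rpow_add hd]
  calc _ ≤ (C * dd z ^ q) * (D * dd z ^ r) := mul_le_mul (h z hz) (h' z hz) (norm_nonneg _) (by positivity)
    _ = _ := by ring

lemma Bdd'.add {q : ℝ} {u v : ℂ → ℂ} (hu : Bdd' q u) (hv : Bdd' q v) : Bdd' q (fun z => u z + v z) := by
  obtain ⟨C, hC, h⟩ := hu
  obtain ⟨D, hD, h'⟩ := hv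
  refine ⟨C + D, by positivity, fun z hz => ?_⟩
  rw [add_mul]
  exact (norm_add_le _ _).trans (add_le_add (h z hz) (h' z hz))

lemma Bdd'.cmul {q : ℝ} {u : ℂ → ℂ} (c : ℂ) (hu : Bdd' q u) : Bdd' q (fun z => c * u z) := by
  obtain ⟨C, hC, h⟩ := hu
  refine ⟨‖c‖ * C, by positivity, fun z hz => ?_⟩
  rw [norm_mul, mul_assoc]
  exact mul_le_mul_of_nonneg_left (h z hz) (norm_nonneg _)

lemma Bdd'.mono {q r : ℝ} {u : ℂ → ℂ} (hu : Bdd' q u) (hqr : r ≤ q) : Bdd' r u := by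
  obtain ⟨C, hC, h⟩ := hu
  refine ⟨C * 2^(q-r), by positivity, fun z hz => (h z hz).trans ?_⟩
  have hd := Pd_pos hz
  have h2 : dd z ≤ 2 := dd_le_two hz.1
  have e : dd z ^ q = dd z ^ (q-r) * dd z ^ r := by rw [← Real.rpow_add hd]; congr 1; ring
  have e2 : dd z ^ (q-r) ≤ 2^(q-r) := Real.rpow_le_rpow hd.le h2 (by linarith)
  rw [e, mul_assoc]
  gcongr

lemma Bdd'.zmul {q : ℝ} {u : ℂ → ℂ} (hu : Bdd' q u) : Bdd' q (fun z => z * u z) := by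
  obtain ⟨C, hC, h⟩ := hu
  refine ⟨C, hC, fun z hz => ?_⟩
  rw [norm_mul]
  exact (mul_le_of_le_one_left (norm_nonneg _) hz.1).trans (h z hz)

lemma Bdd'.pow (q : ℝ) : Bdd' q (fun z => (1+z)^(q:ℂ)) :=
  ⟨1, zero_le_one, fun z hz => by rw [Complex.norm_cpow_real, one_mul]; rfl⟩

lemma Bdd'.cl {g q : ℝ} {u u' : ℂ → ℂ} (hg0 : 0 < g) (hg : g ≤ 1) (hu : Bdd' q u) (hu' : Bdd' (q-1) u')
    (hd : ∀ z ∈ Pd, HasDerivAt u (u' z) z) : ∃ C, 0 ≤ C ∧ Cl g Pd q C u := by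
  obtain ⟨C, hC, h⟩ := hu
  obtain ⟨D, hD, h'⟩ := hu'
  exact ⟨_, by positivity, Cl.of_deriv hg0 hg hC hD u' hd h h'⟩

noncomputable def Pw (μ : ℝ) (z : ℂ) : ℂ := (1+z)^(μ:ℂ)

lemma Pw_deriv (μ : ℝ) {z : ℂ} (hz : 1 + z ∈ slitPlane) : HasDerivAt (Pw μ) (μ * (1+z)^((μ-1:ℝ):ℂ)) z := by
  have h1 : HasDerivAt (fun z : ℂ => 1 + z) 1 z := (hasDerivAt_id z).const_add 1
  refine (h1.cpow_const (c := (μ:ℂ)) hz).congr_deriv ?_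
  push_cast; ring

noncomputable def F0 (ν μ a : ℝ) (z : ℂ) : ℂ := Pw μ z * Eu ν a ν z
noncomputable def E1 (ν a c : ℝ) (z : ℂ) : ℂ := z * (-ν * Eu ν (a+1) (ν+1) z) + c * Eu ν a ν z
noncomputable def F1 (ν μ a c : ℝ) (z : ℂ) : ℂ := Pw μ z * E1 ν a c z

lemma Eu0_b (ν δ a : ℝ) (ha : 0 < a) (hν : ν ≤ 1/2) (hδ : 0 < δ) (hδν : δ ≤ ν) : Bdd' (-δ) (Eu ν a ν) := by
  obtain ⟨C, hC, h⟩ := Eu_bound ν a ν (ν-δ) ha (by linarith) (by linarith) (by linarith)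
  exact ⟨C, hC.le, fun z hz => by simpa using h z hz⟩

lemma Eu1_b (ν δ a : ℝ) (ha : 0 < a) (hν0 : 0 < ν) (hν : ν ≤ 1/2) (hδ : 0 < δ) (hδν : δ ≤ 1/2) : Bdd' (-2*ν-δ) (Eu ν a (ν+1)) := by
  obtain ⟨C, hC, h⟩ := Eu_bound ν a (ν+1) (1-ν-δ) ha (by linarith) (by linarith) (by linarith)
  exact ⟨C, hC.le, fun z hz => by have := h z hz; rwa [show -(ν + 1 - (1 - ν - δ)) = -2*ν-δ by ring] at this⟩

lemma Eu2_b (ν δ a : ℝ) (ha : 0 < a) (hν0 : 0 < ν) (hν : ν ≤ 1/2) (hδ : 0 < δ) (hδν : δ ≤ 1/2) : Bdd' (-2*ν-1-δ) (Eu ν a (ν+1+1)) := by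
  obtain ⟨C, hC, h⟩ := Eu_bound ν a (ν+1+1) (1-ν-δ) ha (by linarith) (by linarith) (by linarith)
  exact ⟨C, hC.le, fun z hz => by have := h z hz; rwa [show -(ν + 1 + 1 - (1 - ν - δ)) = -2*ν-1-δ by ring] at this⟩

lemma F0_d (ν μ a : ℝ) (ha : 0 < a) (hν0 : 0 < ν) (hν1 : ν < 1) {z : ℂ} (hz : 1 + z ∈ slitPlane) :
    HasDerivAt (F0 ν μ a) (μ * (1+z)^((μ-1:ℝ):ℂ) * Eu ν a ν z + Pw μ z * (-ν * Eu ν (a+1) (ν+1) z)) z :=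
  (Pw_deriv μ hz).mul (Eu_deriv ν a ν ha hν1 hν0.le hz)

lemma E1_d (ν a c : ℝ) (ha : 0 < a) (hν0 : 0 < ν) (hν1 : ν < 1) {z : ℂ} (hz : 1 + z ∈ slitPlane) :
    HasDerivAt (E1 ν a c) (-ν * (1 + c) * Eu ν (a+1) (ν+1) z + ν * (ν+1) * (z * Eu ν (a+1+1) (ν+1+1) z)) z := by
  have h1 := Eu_deriv ν a ν ha hν1 hν0.le hz
  have h2 := Eu_deriv ν (a+1) (ν+1) (by linarith) hν1 (by linarith) hz
  refine (((hasDerivAt_id z).mul (h2.const_mul (-(ν:ℂ)))).add (h1.const_mul (c:ℂ))).congr_deriv ?_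
  simp only [id]; push_cast; ring

lemma F1_d (ν μ a c : ℝ) (ha : 0 < a) (hν0 : 0 < ν) (hν1 : ν < 1) {z : ℂ} (hz : 1 + z ∈ slitPlane) :
    HasDerivAt (F1 ν μ a c) (μ * (1+z)^((μ-1:ℝ):ℂ) * E1 ν a c z + Pw μ z * (-ν * (1 + c) * Eu ν (a+1) (ν+1) z + ν * (ν+1) * (z * Eu ν (a+1+1) (ν+1+1) z))) z :=
  (Pw_deriv μ hz).mul (E1_d ν a c ha hν0 hν1 hz)

lemma E1_b (ν δ a c : ℝ) (ha : 0 < a) (hν0 : 1/3 < ν) (hν : ν ≤ 1/2) (hδ : 0 < δ) (hδν : δ ≤ 1/60) : Bdd' (-2*ν-δ) (E1 ν a c) := by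
  have h1 := Eu0_b ν δ a ha hν hδ (by linarith)
  have h2 := Eu1_b ν δ (a+1) (by linarith) (by linarith) hν hδ (by linarith)
  exact (Bdd'.zmul (h2.cmul (-(ν:ℂ)))).add ((h1.mono (by linarith)).cmul c)

lemma F0_cl (ν μ δ g a : ℝ) (ha : 0 < a) (hνμ : μ = ν - 1/3) (hμ : μ = 10 * δ) (hδ : 0 < δ) (hδν : δ ≤ 1/60) (hg0 : 0 < g) (hg : g ≤ 1) :
    ∃ C, 0 ≤ C ∧ Cl g Pd (9 * δ) C (F0 ν μ a) := by
  have h1 := Eu0_b ν δ a ha (by linarith) hδ (by linarith)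
  have h2 := Eu1_b ν δ (a+1) (by linarith) (by linarith) (by linarith) hδ (by linarith)
  refine Bdd'.cl hg0 hg (u' := fun z => (μ * (1+z)^((μ-1:ℝ):ℂ) * Eu ν a ν z + Pw μ z * (-ν * Eu ν (a+1) (ν+1) z))) ?_ ?_ (fun z hz => F0_d ν μ a ha (by linarith) (by linarith) (Pd_sl hz))
  · exact ((Bdd'.pow μ).mul h1).mono (by linarith)
  · exact ((((Bdd'.pow (μ-1)).cmul (μ:ℂ)).mul h1).mono (by linarith)).add (((Bdd'.pow μ).mul (h2.cmul (-(ν:ℂ)))).mono (by linarith))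

lemma F1_cl (ν μ δ g a c : ℝ) (ha : 0 < a) (hνμ : μ = ν - 1/3) (hμ : μ = 10 * δ) (hδ : 0 < δ) (hδν : δ ≤ 1/60) (hg0 : 0 < g) (hg : g ≤ 1) :
    ∃ C, 0 ≤ C ∧ Cl g Pd (-2/3 - 11 * δ) C (F1 ν μ a c) := by
  have h1 := E1_b ν δ a c ha (by linarith) (by linarith) hδ (by linarith)
  have h2 := Eu1_b ν δ (a+1) (by linarith) (by linarith) (by linarith) hδ (by linarith)
  have h3 := Eu2_b ν δ (a+1+1) (by linarith) (by linarith) (by linarith) hδ (by linarith)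
  refine Bdd'.cl hg0 hg (u' := fun z => (μ * (1+z)^((μ-1:ℝ):ℂ) * E1 ν a c z + Pw μ z * (-ν * (1 + c) * Eu ν (a+1) (ν+1) z + ν * (ν+1) * (z * Eu ν (a+1+1) (ν+1+1) z)))) ?_ ?_
    (fun z hz => F1_d ν μ a c ha (by linarith) (by linarith) (Pd_sl hz))
  · exact ((Bdd'.pow μ).mul h1).mono (by linarith)
  · exact ((((Bdd'.pow (μ-1)).cmul (μ:ℂ)).mul h1).mono (by linarith)).add
      (((Bdd'.pow μ).mul (((h2.mono (by linarith)).cmul (-ν * (1+c) : ℂ)).add ((h3.zmul).cmul (ν * (ν+1) : ℂ)))).mono (by linarith))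

lemma Sc_log {z : ℂ} (hz : z ∈ Sc) : log z = log (1+z) - conj (log (1+z)) := by
  have hre : 0 < (1+z).re := by
    have h2 := abs_le.1 ((Complex.abs_re_le_norm z).trans hz.1.le)
    rcases eq_or_lt_of_le h2.1 with h3 | h3
    · exfalso
      have h4 := Complex.sq_norm z
      rw [hz.1, normSq_apply, ← h3] at h4
      have : z.im = 0 := by nlinarith
      exact hz.2 (Complex.ext (by simp [← h3]) (by simp [this]))
    · simp; linarith
  have hne : 1 + z ≠ 0 := by intro h; rw [h] at hre; simp at hre
  have hne' : conj (1 + z) ≠ 0 := (map_ne_zero _).2 hne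
  have harg : |(1+z).arg| < Real.pi / 2 := Complex.abs_arg_lt_pi_div_two_iff.2 (Or.inl hre)
  have harg' := abs_lt.1 harg
  have hexp : exp (log (1+z) - conj (log (1+z))) = z := by
    rw [Complex.exp_sub, Complex.exp_conj, Complex.exp_log hne, div_eq_iff hne']
    have hz1 : z * conj z = 1 := by rw [← Sc_inv hz]; exact mul_inv_cancel₀ (slitPlane_ne_zero (Sc_sl hz))
    rw [map_add, map_one]; linear_combination -hz1
  conv_lhs => rw [← hexp]
  rw [Complex.log_exp] <;> simp [Complex.log_im] <;> linarith

lemma Pw_conj (μ : ℝ) {z : ℂ} (hz : z ∈ Sc) : conj (Pw μ z) = z^((-μ:ℝ):ℂ) * Pw μ z := by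
  have hne := slitPlane_ne_zero (sl_add (Sc_sl hz))
  unfold Pw
  rw [Complex.cpow_def_of_ne_zero hne, Complex.cpow_def_of_ne_zero (slitPlane_ne_zero (Sc_sl hz)), Sc_log hz, ← Complex.exp_add, ← Complex.exp_conj, map_mul, conj_ofReal]
  congr 1; push_cast; ring

lemma Pw_23 {z : ℂ} (hz : z ∈ Sc) : Pw (2/3) z = ((dd z ^ (2/3:ℝ) : ℝ) : ℂ) * z^((1/3:ℝ):ℂ) := by
  have hne := slitPlane_ne_zero (sl_add (Sc_sl hz))
  have hd : (log (1+z)).re = Real.log (dd z) := Complex.log_re _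
  have hdp : 0 < dd z := Pd_pos (Sc_sub hz)
  have h2 : log (1+z) + conj (log (1+z)) = 2 * (Real.log (dd z) : ℂ) := by rw [Complex.add_conj, hd]; push_cast; ring
  unfold Pw
  rw [Complex.cpow_def_of_ne_zero hne, Complex.cpow_def_of_ne_zero (slitPlane_ne_zero (Sc_sl hz)), Sc_log hz, Real.rpow_def_of_pos hdp, Complex.ofReal_exp, ← Complex.exp_add]
  congr 1; push_cast; linear_combination (1/3:ℂ) * h2

lemma const_of_real (L : ℂ → ℂ) (hL : ∀ z, 1 + z ∈ slitPlane → DifferentiableAt ℂ L z) (hb : Bdd' (-1) L)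
    (him : ∀ z ∈ Sc, (L z).im = 0) (h0 : (L 0).im = 0) : ∀ z ∈ Pd, L z = L 0 := by
  have hop : IsOpen {y : ℂ | 1 + y ∈ slitPlane} := isOpen_slitPlane.preimage (by fun_prop)
  have h0m : (0:ℂ) ∈ {y : ℂ | 1 + y ∈ slitPlane} := by simp
  have hd : DifferentiableOn ℂ (dslope L 0) {y : ℂ | 1 + y ∈ slitPlane} :=
    (differentiableOn_dslope (hop.mem_nhds h0m)).2 (fun z hz => (hL z hz).differentiableWithinAt)
  have hds : ∀ z : ℂ, z ≠ 0 → dslope L 0 z = (L z - L 0) / z := by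
    intro z hz
    rw [dslope_of_ne _ hz, slope_def_field, sub_zero]
  have hball : Metric.ball (0:ℂ) 1 ⊆ {y : ℂ | 1 + y ∈ slitPlane} := by
    intro z hz
    have hz' : ‖z‖ < 1 := by simpa using hz
    exact Pd_sl ⟨hz'.le, ball_ne hz'⟩
  set h : ℂ → ℂ := fun z => (1+z)^2 * dslope L 0 z with hh
  have hm1 : h (-1) = 0 := by simp [hh]
  obtain ⟨C, hC, hCb⟩ := hb
  have hdiff : DifferentiableOn ℂ h {y : ℂ | 1 + y ∈ slitPlane} := DifferentiableOn.mul (by fun_prop) hd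
  have hcont : ContinuousOn h (Metric.closedBall 0 1) := by
    intro z hz
    have hz' : ‖z‖ ≤ 1 := by simpa using hz
    by_cases hz1 : z = -1
    · subst hz1
      unfold ContinuousWithinAt
      rw [hm1]
      have hlim : Filter.Tendsto (fun z : ℂ => 2 * (C + ‖L 0‖ * 2) * dd z) (nhdsWithin (-1) (Metric.closedBall 0 1)) (nhds 0) := by
        have hc : Continuous (fun z : ℂ => 2 * (C + ‖L 0‖ * 2) * dd z) := by unfold dd; fun_prop
        have := hc.tendsto (-1)
        simp only [dd, add_neg_cancel, norm_zero, mul_zero] at this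
        exact this.mono_left nhdsWithin_le_nhds
      refine squeeze_zero_norm' ?_ hlim
      have hn : {z : ℂ | 1/2 < ‖z‖} ∈ nhds (-1:ℂ) := (isOpen_lt continuous_const continuous_norm).mem_nhds (by simp; norm_num)
      filter_upwards [mem_nhdsWithin_of_mem_nhds hn, self_mem_nhdsWithin] with w hw1 hw2
      have hw1 : 1/2 < ‖w‖ := hw1
      have hw2' : ‖w‖ ≤ 1 := by simpa using hw2
      by_cases hw : w = -1
      · rw [hw, hm1, norm_zero]; unfold dd; positivity
      have hwP : w ∈ Pd := ⟨hw2', hw⟩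
      have hdp := Pd_pos hwP
      have hd2 : dd w ≤ 2 := dd_le_two hw2'
      have hw0 : w ≠ 0 := by intro h; rw [h, norm_zero] at hw1; linarith
      have hLb := hCb w hwP
      rw [Real.rpow_neg_one] at hLb
      simp only [hh]
      rw [hds w hw0, norm_mul, norm_pow, norm_div]
      have e1 : ‖L w - L 0‖ / ‖w‖ ≤ 2 * ((C + ‖L 0‖ * 2) * (dd w)⁻¹) := by
        rw [div_le_iff₀ (by linarith)]
        have a1 := norm_sub_le (L w) (L 0)
        have a2 : ‖L 0‖ ≤ ‖L 0‖ * 2 * (dd w)⁻¹ := by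
          rw [mul_assoc]
          refine le_mul_of_one_le_right (norm_nonneg _) ?_
          rw [← div_eq_mul_inv, le_div_iff₀ hdp]; linarith
        have a3 : ‖L w - L 0‖ ≤ (C + ‖L 0‖ * 2) * (dd w)⁻¹ := by rw [add_mul]; linarith
        have a4 : 0 ≤ (C + ‖L 0‖ * 2) * (dd w)⁻¹ := by positivity
        nlinarith
      calc ‖1 + w‖^2 * (‖L w - L 0‖ / ‖w‖) ≤ dd w ^ 2 * (2 * ((C + ‖L 0‖ * 2) * (dd w)⁻¹)) :=
            mul_le_mul_of_nonneg_left e1 (by positivity)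
        _ = _ := by field_simp
    · exact (hdiff.continuousOn.continuousAt (hop.mem_nhds (Pd_sl ⟨hz', hz1⟩))).continuousWithinAt
  have key := const_of_im_zero h hcont (hdiff.mono hball) (by
    intro z hz
    by_cases hz1 : z = -1
    · rw [hz1, hm1]; simp
    have hS : z ∈ Sc := ⟨hz, hz1⟩
    have hz0 := slitPlane_ne_zero (Sc_sl hS)
    have hcz : conj z * z = 1 := by rw [← Sc_inv hS]; exact inv_mul_cancel₀ hz0
    simp only [hh]
    rw [hds z hz0]
    have e : (1+z)^2 * ((L z - L 0) / z) = ((normSq (1+z) : ℝ) : ℂ) * (L z - L 0) := by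
      rw [← Complex.mul_conj, div_eq_mul_inv, Sc_inv hS, map_add, map_one]
      linear_combination (1+z) * (L z - L 0) * hcz
    rw [e, Complex.im_ofReal_mul]; simp [him z hS, h0])
  intro z hz
  by_cases hz0 : z = 0
  · rw [hz0]
  have h1 := key z hz.1
  have h2 := key (-1) (by simp)
  rw [hm1] at h2
  rw [← h2] at h1
  simp only [hh] at h1
  rw [hds z hz0] at h1
  have hne : (1+z)^2 ≠ 0 := pow_ne_zero _ (slitPlane_ne_zero (Pd_sl hz))
  have h3 := (mul_eq_zero.1 h1).resolve_left hne
  have h4 := (div_eq_zero_iff.1 h3).resolve_right hz0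
  exact sub_eq_zero.1 h4

lemma Frames_exist (t : ℝ) (ht0 : Real.sqrt 3 / 2 ≤ t) (ht1 : t < 1) :
    ∃ (g δ C0 C' : ℝ) (χ f0 f1 K0 K1 : ℂ → ℂ), Frames t g δ C0 C' χ f0 f1 K0 K1 := by
  have hsq : 0 < Real.sqrt 3 := by positivity
  have htp : 0 < t := by linarith
  obtain ⟨ν, hν0, hν, hts⟩ : ∃ ν : ℝ, 1/3 < ν ∧ ν ≤ 1/2 ∧ Real.sin (Real.pi * ν) = Real.sqrt 3 / 2 / t := by
    have hpi := Real.pi_pos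
    have h1 : Real.sqrt 3 / 2 / t ≤ 1 := by rw [div_le_one htp]; exact ht0
    have h2 : Real.sqrt 3 / 2 < Real.sqrt 3 / 2 / t := by rw [lt_div_iff₀ htp]; nlinarith
    refine ⟨Real.arcsin (Real.sqrt 3 / 2 / t) / Real.pi, ?_, ?_, ?_⟩
    · rw [lt_div_iff₀ hpi]
      have := (Real.lt_arcsin_iff_sin_lt (x := Real.pi/3) (y := Real.sqrt 3 / 2 / t) ⟨by linarith, by linarith⟩ ⟨by linarith, h1⟩).2 (by rw [Real.sin_pi_div_three]; exact h2)
      linarith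
    · rw [div_le_iff₀ hpi]
      have := Real.arcsin_le_pi_div_two (Real.sqrt 3 / 2 / t)
      linarith
    · rw [mul_div_cancel₀ _ hpi.ne', Real.sin_arcsin (by linarith) h1]
  obtain ⟨μ, hνμ⟩ : ∃ μ : ℝ, μ = ν - 1/3 := ⟨_, rfl⟩
  obtain ⟨δ, hμδ⟩ : ∃ δ : ℝ, μ = 10 * δ := ⟨μ/10, by ring⟩
  have hμ : 0 < μ := by linarith
  have hδ : 0 < δ := by linarith
  have hδ1 : δ ≤ 1/60 := by linarith
  have hs : 0 < Real.sin (Real.pi * ν) := by rw [hts]; positivity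
  have ht : t * Real.sin (Real.pi * ν) = Real.sqrt 3 / 2 := by rw [hts]; field_simp
  have hs2 : 0 < Real.sin (2*Real.pi/3 - Real.pi * ν) := by
    have hpi := Real.pi_pos
    apply Real.sin_pos_of_pos_of_lt_pi <;> nlinarith
  obtain ⟨C, hC, hCp⟩ : ∃ C : ℝ, C * Real.sin (Real.pi * ν) = Real.sin (2*Real.pi/3 - Real.pi * ν) ∧ 0 < C :=
    ⟨_, div_mul_cancel₀ _ hs.ne', by positivity⟩
  have R0 : ∀ z ∈ Sc, _ := fun z hz => R0c ν μ t C hμ hνμ (by linarith) hs ht hC (z := z) hz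
  have R1 : ∀ z ∈ Sc, E1 ν μ (μ/2) z + t * z^((-μ:ℝ):ℂ) * conj (E1 ν μ (μ/2) z) = C * z^((1/3:ℝ):ℂ) * E1 ν (μ+2/3) (μ/2+1/3) z := by
    intro z hz
    have := R1c ν μ t C hμ hνμ (by linarith) hs ht hC (z := z) hz
    unfold E1
    push_cast at this ⊢
    exact this
  -- relations
  have r0 : ∀ z ∈ Sc, I * F0 ν μ μ z + t * conj (I * F0 ν μ μ z) = z^((1/3:ℝ):ℂ) * ((I * C) * F0 ν μ (μ+2/3) z) := by
    intro z hz
    have h := R0 z hz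
    unfold F0
    rw [map_mul, map_mul, Pw_conj μ hz, conj_I]
    linear_combination I * Pw μ z * h
  have r1 : ∀ z ∈ Sc, F1 ν μ μ (μ/2) z + t * conj (F1 ν μ μ (μ/2) z) = z^((1/3:ℝ):ℂ) * (C * F1 ν μ (μ+2/3) (μ/2+1/3) z) := by
    intro z hz
    have h := R1 z hz
    unfold F1
    rw [map_mul, Pw_conj μ hz]
    linear_combination Pw μ z * h
  -- Wronskian
  set L : ℂ → ℂ := fun z => Pw (2/3) z * (F0 ν μ μ z * F1 ν μ (μ+2/3) (μ/2+1/3) z - F1 ν μ μ (μ/2) z * F0 ν μ (μ+2/3) z) with hLdef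
  have hid : ∀ z ∈ Sc, (((2 * t * (I * F0 ν μ μ z * conj (F1 ν μ μ (μ/2) z)).im * dd z ^ (2/3:ℝ) : ℝ)) : ℂ) = C * L z := by
    intro z hz
    have h0 := r0 z hz
    have h1 := r1 z hz
    have hsub := Complex.sub_conj (I * F0 ν μ μ z * conj (F1 ν μ μ (μ/2) z))
    simp only [hLdef]
    rw [Pw_23 hz]
    generalize z^((1/3:ℝ):ℂ) = χ at *
    generalize F1 ν μ μ (μ/2) z = f1 at *
    generalize F1 ν μ (μ+2/3) (μ/2+1/3) z = k1 at *
    generalize F0 ν μ μ z = f0 at *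
    generalize F0 ν μ (μ+2/3) z = k0 at *
    generalize dd z ^ (2/3:ℝ) = d at *
    generalize (I * f0 * conj f1).im = J at *
    simp only [map_mul, conj_I, Complex.conj_conj] at h0 h1 hsub
    push_cast at hsub ⊢
    have hI : I * I = -1 := I_mul_I
    have : I * (2 * t * J * d) = I * (C * (d * χ * (f0 * k1 - f1 * k0))) := by
      linear_combination -t * d * hsub + d * (I * f0 * h1 - f1 * h0)
    exact mul_left_cancel₀ I_ne_zero this
  have hLim : ∀ z ∈ Sc, (L z).im = 0 := by
    intro z hz
    have h := congrArg Complex.im (hid z hz)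
    rw [Complex.ofReal_im, Complex.im_ofReal_mul] at h
    exact (mul_eq_zero.1 h.symm).resolve_left hCp.ne'
  have he0 := Er_pos ν μ ν hμ (by linarith) (by linarith) (y := 0) le_rfl
  have hk0 := Er_pos ν (μ+2/3) ν (by linarith) (by linarith) (by linarith) (y := 0) le_rfl
  obtain ⟨L0, hL0p, hL0⟩ : ∃ L0 : ℝ, 0 < L0 ∧ L 0 = L0 := by
    have e1 := Eu_real ν μ ν (y := 0) le_rfl
    have e2 := Eu_real ν (μ+2/3) ν (y := 0) le_rfl
    generalize (∫ s in Set.Ioo (0:ℝ) 1, s^(μ-1) * (1-s)^(-ν) * (1+s*0)^(-ν)) = x at *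
    generalize (∫ s in Set.Ioo (0:ℝ) 1, s^(μ+2/3-1) * (1-s)^(-ν) * (1+s*0)^(-ν)) = y at *
    refine ⟨x * y / 3, by positivity, ?_⟩
    rw [Complex.ofReal_zero] at e1 e2
    simp only [hLdef, F0, F1, E1, Pw, add_zero, Complex.one_cpow, e1, e2]
    push_cast; ring
  have hLb : Bdd' (-1) L := by
    have b0 (a : ℝ) (ha : 0 < a) := (Bdd'.pow μ).mul (Eu0_b ν δ a ha hν hδ (by linarith))
    have b1 (a c : ℝ) (ha : 0 < a) := (Bdd'.pow μ).mul (E1_b ν δ a c ha hν0 hν hδ hδ1)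
    have h1 := (b0 μ hμ).mul (b1 (μ+2/3) (μ/2+1/3) (by linarith))
    have h2 := ((b1 μ (μ/2) hμ).mul (b0 (μ+2/3) (by linarith))).cmul (-1)
    have h3 := ((Bdd'.pow (2/3)).mul (h1.add (h2.mono (by linarith)))).mono (r := -1) (by linarith)
    obtain ⟨D, hD, h⟩ := h3
    refine ⟨D, hD, fun z hz => (le_of_eq ?_).trans (h z hz)⟩
    simp only [hLdef, F0, F1, Pw]
    congr 1; ring
  have d0 (a : ℝ) (ha : 0 < a) (z : ℂ) (hz : 1 + z ∈ slitPlane) : DifferentiableAt ℂ (F0 ν μ a) z := (F0_d ν μ a ha (by linarith) (by linarith) hz).differentiableAt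
  have d1 (a c : ℝ) (ha : 0 < a) (z : ℂ) (hz : 1 + z ∈ slitPlane) : DifferentiableAt ℂ (F1 ν μ a c) z := (F1_d ν μ a c ha (by linarith) (by linarith) hz).differentiableAt
  have hLd : ∀ z, 1 + z ∈ slitPlane → DifferentiableAt ℂ L z := by
    intro z hz
    exact (Pw_deriv (2/3) hz).differentiableAt.mul (((d0 μ hμ z hz).mul (d1 _ _ (by linarith) z hz)).sub ((d1 _ _ hμ z hz).mul (d0 _ (by linarith) z hz)))
  have hLc := const_of_real L hLd hLb hLim (by rw [hL0]; simp)
  have hball : ∀ z ∈ Metric.ball (0:ℂ) 1, 1 + z ∈ slitPlane := by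
    intro z hz
    have hz' : ‖z‖ < 1 := by simpa using hz
    exact Pd_sl ⟨hz'.le, ball_ne hz'⟩
  obtain ⟨c1, hc1, cl1⟩ := F0_cl ν μ δ (99/100) μ hμ hνμ hμδ hδ hδ1 (by norm_num) (by norm_num)
  obtain ⟨c2, hc2, cl2⟩ := F0_cl ν μ δ (99/100) (μ+2/3) (by linarith) hνμ hμδ hδ hδ1 (by norm_num) (by norm_num)
  obtain ⟨c3, hc3, cl3⟩ := F1_cl ν μ δ (99/100) μ (μ/2) hμ hνμ hμδ hδ hδ1 (by norm_num) (by norm_num)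
  obtain ⟨c4, hc4, cl4⟩ := F1_cl ν μ δ (99/100) (μ+2/3) (μ/2+1/3) (by linarith) hνμ hμδ hδ hδ1 (by norm_num) (by norm_num)
  have nC : ‖(C:ℂ)‖ = C := by rw [Complex.norm_real, Real.norm_of_nonneg hCp.le]
  have nIC : ‖I * (C:ℂ)‖ = C := by rw [norm_mul, nC, Complex.norm_I, one_mul]
  have g1 := cl1.const_mul I
  have g2 := cl2.const_mul (I * C)
  have g4 := cl4.const_mul (C:ℂ)
  rw [Complex.norm_I, one_mul] at g1
  rw [nIC] at g2
  rw [nC] at g4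
  have m2 : 0 ≤ C * c2 := by positivity
  have m4 : 0 ≤ C * c4 := by positivity
  refine ⟨99/100, δ, c1 + C * c2 + c3 + C * c4 + 1, C * L0 / (2 * t), fun z => z^((1/3:ℝ):ℂ), fun z => I * F0 ν μ μ z, F1 ν μ μ (μ/2),
    fun z => (I * C) * F0 ν μ (μ+2/3) z, fun z => C * F1 ν μ (μ+2/3) (μ/2+1/3) z,
    { ht := htp, hδ := hδ, hδ1 := hδ1, hg := by linarith, hg1 := by norm_num, hC0 := by linarith, hC' := by positivity,
      cf0 := g1.mono_M (by linarith), cK0 := g2.mono_M (by linarith), cf1 := cl3.mono_M (by linarith), cK1 := g4.mono_M (by linarith),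
      df0 := fun z hz => ((d0 μ hμ z (hball z hz)).const_mul I).differentiableWithinAt
      df1 := fun z hz => (d1 μ _ hμ z (hball z hz)).differentiableWithinAt
      dK0 := fun z hz => ((d0 _ (by linarith) z (hball z hz)).const_mul _).differentiableWithinAt
      dK1 := fun z hz => ((d1 _ _ (by linarith) z (hball z hz)).const_mul _).differentiableWithinAt
      zf0 := ?_, zK0 := ?_, r0 := r0, r1 := r1, wr := ?_, hχ := ?_ }⟩
  · simp [F0, Pw, hμ.ne']
  · simp [F0, Pw, hμ.ne']
  · intro z hz
    have h := hid z hz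
    rw [hLc z (Sc_sub hz), hL0, ← Complex.ofReal_mul, Complex.ofReal_inj] at h
    have hdp : 0 < dd z := Pd_pos (Sc_sub hz)
    have e : dd z ^ (-2/3:ℝ) = (dd z ^ (2/3:ℝ))⁻¹ := by rw [← Real.rpow_neg hdp.le]; congr 1; ring
    have hp : 0 < dd z ^ (2/3:ℝ) := by positivity
    rw [e, ← h]
    field_simp
  · intro z hz
    show (z^((1/3:ℝ):ℂ))^3 = z
    rw [← Complex.cpow_nat_mul]
    norm_num

/-- for `√3/2 ≤ t < 1` and any `C^∞`-smooth `F` on a neighbourhood `U` of `0`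
whose derivatives of all orders `≤ 3` vanish at `0`, the polynomially convex hull of
`M_t ∩ B̄(0;δ)` contains a one-parameter family of analytic discs with boundary in `M_t`
and passing through the origin. -/
theorem stmt_13 (t : ℝ) (ht0 : Real.sqrt 3 / 2 ≤ t) (ht1 : t < 1)
    (U : Set ℂ) (hU : IsOpen U) (h0U : (0 : ℂ) ∈ U) (F : ℂ → ℂ)
    (hF : ContDiffOn ℝ (⊤ : ℕ∞) F U)
    (hders : ∀ k : ℕ, k ≤ 3 → iteratedFDerivWithin ℝ k F U 0 = 0)
    (δ : ℝ) (hδ : 0 < δ) :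
    ∃ G : ℝ × ℂ → ℂ × ℂ,
      ContinuousOn G (Set.Ioo (0 : ℝ) 1 ×ˢ Metric.closedBall (0 : ℂ) 1) ∧
      (∀ s ∈ Set.Ioo (0 : ℝ) 1,
        -- `φ_s` is holomorphic on the open unit disc
        DifferentiableOn ℂ (fun ζ => G (s, ζ)) (Metric.ball (0 : ℂ) 1) ∧
        -- `φ_s` is nonconstant
        (¬ ∀ ζ₁ ∈ Metric.closedBall (0 : ℂ) 1, ∀ ζ₂ ∈ Metric.closedBall (0 : ℂ) 1,
            G (s, ζ₁) = G (s, ζ₂)) ∧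
        -- `φ_s(∂𝔻) ⊆ M_t ∩ B̄(0;δ)`
        (∀ ζ : ℂ, ‖ζ‖ = 1 → G (s, ζ) ∈ Mset t U F ∩ eClosedBall δ) ∧
        -- `0 ∈ φ_s(𝔻̄)`
        (∃ ζ ∈ Metric.closedBall (0 : ℂ) 1, G (s, ζ) = 0) ∧
        -- `φ_s(𝔻̄)` lies in the polynomially convex hull of `M_t ∩ B̄(0;δ)`
        (∀ ζ ∈ Metric.closedBall (0 : ℂ) 1, G (s, ζ) ∈ polyHull2 (Mset t U F ∩ eClosedBall δ))) ∧
      -- the images for distinct parameters are distinct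
      (∀ s₁ ∈ Set.Ioo (0 : ℝ) 1, ∀ s₂ ∈ Set.Ioo (0 : ℝ) 1, s₁ ≠ s₂ →
        (fun ζ => G (s₁, ζ)) '' Metric.closedBall (0 : ℂ) 1 ≠
          (fun ζ => G (s₂, ζ)) '' Metric.closedBall (0 : ℂ) 1) := by
  obtain ⟨g, δ', C0, C', χ, f0, f1, K0, K1, H⟩ := Frames_exist t ht0 ht1
  exact final_of_frames t (lt_of_lt_of_le (by positivity) ht0) ht1 H U hU h0U F hF hders δ hδ
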